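/- Let n be an integer, m a real number with 1 < m < n, and p, q real exponents with 0 < p < n(m-1)/(n-m) and m-1 < q < (n-1)(m-1)/(n-m) (the Serrin index range). Then there is no nontrivial nonnegative C^2 function u on the closed upper half-space ℝ^n_+ such that the vector field |∇u|^{m-2}∇u is continuously differentiable on {∇u ≠ 0}, Δ_m u + u^p = 0 and u > 0 hold in ℝ^n_+, and |∇u|^{m-2} ∂u/∂x_n = -u^q holds on ∂ℝ^n_+. -/

import Mathlib

open MeasureTheory
open scoped RealInnerProductSpace

noncomputable section

/-- The last coordinate of a point in `EuclideanSpace ℝ (Fin n)`. -/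
def lastC {n : ℕ} (x : EuclideanSpace ℝ (Fin n)) : ℝ :=
  if h : 0 < n then x ⟨n - 1, Nat.sub_lt h Nat.one_pos⟩ else 0

/-- Partial derivative of `f` in the `i`-th coordinate direction. -/
def pd {n : ℕ} (i : Fin n) (f : EuclideanSpace ℝ (Fin n) → ℝ)
    (x : EuclideanSpace ℝ (Fin n)) : ℝ :=
  fderiv ℝ f x (EuclideanSpace.single i 1)

/-- Partial derivative in the last coordinate direction. -/
def pdn {n : ℕ} (f : EuclideanSpace ℝ (Fin n) → ℝ)
    (x : EuclideanSpace ℝ (Fin n)) : ℝ :=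
  if h : 0 < n then pd ⟨n - 1, Nat.sub_lt h Nat.one_pos⟩ f x else 0

/-- The vector field `X = |∇u|^{m-2} ∇u`. -/
def fieldX {n : ℕ} (m : ℝ) (u : EuclideanSpace ℝ (Fin n) → ℝ)
    (x : EuclideanSpace ℝ (Fin n)) : EuclideanSpace ℝ (Fin n) :=
  ‖gradient u x‖ ^ (m - 2) • gradient u x

/-- `X^i_j = ∂_j (|∇u|^{m-2} u_i)`. -/
def Xmat {n : ℕ} (m : ℝ) (u : EuclideanSpace ℝ (Fin n) → ℝ)
    (x : EuclideanSpace ℝ (Fin n)) (i j : Fin n) : ℝ :=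
  pd j (fun y => fieldX m u y i) x

/-- The `m`-Laplacian `Δ_m u = div (|∇u|^{m-2} ∇u)`. -/
def pLap {n : ℕ} (m : ℝ) (u : EuclideanSpace ℝ (Fin n) → ℝ)
    (x : EuclideanSpace ℝ (Fin n)) : ℝ :=
  ∑ i : Fin n, Xmat m u x i i

/-- The open upper half-space `ℝⁿ₊`. -/
def openHalf (n : ℕ) : Set (EuclideanSpace ℝ (Fin n)) := {x | 0 < lastC x}

/-- The closed upper half-space. -/
def closedHalf (n : ℕ) : Set (EuclideanSpace ℝ (Fin n)) := {x | 0 ≤ lastC x}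

/-- The boundary hyperplane `{xₙ = 0}`. -/
def bdry (n : ℕ) : Set (EuclideanSpace ℝ (Fin n)) := {x | lastC x = 0}

section HalfSpace

open Filter Topology

/-- `F` is differentiable near `0` with derivative `a` at `0`, and has second derivative `d` at `0`. -/
def HasJet (F : ℝ → ℝ) (a d : ℝ) : Prop :=
  ∃ F' : ℝ → ℝ, F' 0 = a ∧ (∀ᶠ s in 𝓝 0, HasDerivAt F (F' s) s) ∧ HasDerivAt F' d 0

theorem HasJet.add {F G : ℝ → ℝ} {a b c d : ℝ} (hF : HasJet F a c) (hG : HasJet G b d) :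
    HasJet (fun s => F s + G s) (a + b) (c + d) := by
  obtain ⟨F', h1, h2, h3⟩ := hF
  obtain ⟨G', k1, k2, k3⟩ := hG
  refine ⟨fun s => F' s + G' s, by simp [h1, k1], ?_, h3.add k3⟩
  filter_upwards [h2, k2] with s hs ks using hs.add ks

theorem HasJet.sub {F G : ℝ → ℝ} {a b c d : ℝ} (hF : HasJet F a c) (hG : HasJet G b d) :
    HasJet (fun s => F s - G s) (a - b) (c - d) := by
  obtain ⟨F', h1, h2, h3⟩ := hF
  obtain ⟨G', k1, k2, k3⟩ := hG
  refine ⟨fun s => F' s - G' s, by simp [h1, k1], ?_, h3.sub k3⟩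
  filter_upwards [h2, k2] with s hs ks using hs.sub ks

/-- First and second order necessary conditions at a minimum. -/
theorem HasJet.of_isLocalMin {F : ℝ → ℝ} {a d : ℝ} (hF : HasJet F a d)
    (hmin : IsLocalMin F 0) : a = 0 ∧ 0 ≤ d := by
  obtain ⟨F', h1, h2, h3⟩ := hF
  have ha : a = 0 := by
    rw [← h1]; exact hmin.hasDerivAt_eq_zero h2.self_of_nhds
  refine ⟨ha, ?_⟩
  by_contra! hd
  have hderiv : deriv F =ᶠ[𝓝 0] F' := by
    filter_upwards [h2] with s hs using hs.deriv
  have hmax : IsLocalMax F 0 := by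
    apply isLocalMax_of_deriv_deriv_neg
    · rw [hderiv.deriv_eq, h3.deriv]; exact hd
    · rw [hderiv.self_of_nhds, h1, ha]
    · exact h2.self_of_nhds.continuousAt
  have hconst : F =ᶠ[𝓝 0] fun _ => F 0 := by
    filter_upwards [hmin, hmax] with s h h' using le_antisymm h' h
  have h4 : F' =ᶠ[𝓝 0] fun _ => 0 := by
    filter_upwards [h2, hconst.eventuallyEq_nhds] with s hs hc
    rw [← hs.deriv, hc.deriv_eq]; simp
  have := h4.deriv_eq
  rw [h3.deriv] at this
  simp at this
  linarith

theorem HasJet.of_isLocalMax {F : ℝ → ℝ} {a d : ℝ} (hF : HasJet F a d)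
    (hmax : IsLocalMax F 0) : a = 0 ∧ d ≤ 0 := by
  obtain ⟨F', h1, h2, h3⟩ := hF
  have h : HasJet (fun s => - F s) (-a) (-d) :=
    ⟨fun s => - F' s, by simp [h1], by filter_upwards [h2] with s hs using hs.neg, h3.neg⟩
  have := h.of_isLocalMin hmax.neg
  constructor <;> linarith [this.1, this.2]

variable {n : ℕ}

/-- The Hessian of `v` as a bilinear form. -/
def hess (v : EuclideanSpace ℝ (Fin n) → ℝ) (x : EuclideanSpace ℝ (Fin n)) :
    EuclideanSpace ℝ (Fin n) →L[ℝ] EuclideanSpace ℝ (Fin n) →L[ℝ] ℝ :=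
  fderiv ℝ (fderiv ℝ v) x

theorem hasFDerivAt_fderiv {v : EuclideanSpace ℝ (Fin n) → ℝ} {x : EuclideanSpace ℝ (Fin n)}
    (hv : ContDiffAt ℝ 2 v x) : HasFDerivAt (fderiv ℝ v) (hess v x) x := by
  have : ContDiffAt ℝ 1 (fderiv ℝ v) x := hv.fderiv_right (by norm_num)
  exact (this.differentiableAt (by norm_num)).hasFDerivAt

theorem eventually_differentiableAt {v : EuclideanSpace ℝ (Fin n) → ℝ}
    {x : EuclideanSpace ℝ (Fin n)} (hv : ContDiffAt ℝ 2 v x) :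
    ∀ᶠ y in 𝓝 x, DifferentiableAt ℝ v y := by
  filter_upwards [hv.eventually (by norm_num)] with y hy using hy.differentiableAt (by norm_num)

theorem hess_symm {v : EuclideanSpace ℝ (Fin n) → ℝ}
    {x : EuclideanSpace ℝ (Fin n)} (hv : ContDiffAt ℝ 2 v x) (ξ ζ : EuclideanSpace ℝ (Fin n)) :
    hess v x ξ ζ = hess v x ζ ξ := by
  have h := (hv.isSymmSndFDerivAt (by simp))
  exact h.eq ξ ζ

theorem hasJet_line {v : EuclideanSpace ℝ (Fin n) → ℝ}
    {x : EuclideanSpace ℝ (Fin n)} (hv : ContDiffAt ℝ 2 v x) (ξ : EuclideanSpace ℝ (Fin n)) :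
    HasJet (fun s => v (x + s • ξ)) (fderiv ℝ v x ξ) (hess v x ξ ξ) := by
  have hl : ∀ s : ℝ, HasDerivAt (fun s : ℝ => x + s • ξ) ξ s := fun s => by
    simpa using ((hasDerivAt_id s).smul_const ξ).const_add x
  have hc : Tendsto (fun s : ℝ => x + s • ξ) (𝓝 0) (𝓝 x) := by
    simpa using (hl 0).continuousAt.tendsto
  refine ⟨fun s => fderiv ℝ v (x + s • ξ) ξ, by simp, ?_, ?_⟩
  · filter_upwards [hc.eventually (eventually_differentiableAt hv)] with s hs
    exact hs.hasFDerivAt.comp_hasDerivAt s (hl s)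
  · have h : HasFDerivAt (fderiv ℝ v) (hess v x) (x + (0:ℝ) • ξ) := by
      simpa using hasFDerivAt_fderiv hv
    have := h.comp_hasDerivAt (0:ℝ) (hl 0)
    exact this.clm_apply (hasDerivAt_const _ ξ) |>.congr_deriv (by simp)

theorem hasJet_normSq (w δ : EuclideanSpace ℝ (Fin n)) {Q Q' : ℝ → ℝ} {Q2 : ℝ}
    (h1 : ∀ᶠ τ in 𝓝 (‖w‖ ^ 2), HasDerivAt Q (Q' τ) τ) (h2 : HasDerivAt Q' Q2 (‖w‖ ^ 2)) :
    HasJet (fun s => Q (‖w + s • δ‖ ^ 2)) (2 * Q' (‖w‖ ^ 2) * ⟪w, δ⟫)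
      (4 * Q2 * ⟪w, δ⟫ ^ 2 + 2 * Q' (‖w‖ ^ 2) * ‖δ‖ ^ 2) := by
  have he : ∀ s : ℝ, ‖w + s • δ‖ ^ 2 = ‖w‖ ^ 2 + 2 * s * ⟪w, δ⟫ + s ^ 2 * ‖δ‖ ^ 2 := by
    intro s
    rw [norm_add_sq_real, inner_smul_right, norm_smul, mul_pow, Real.norm_eq_abs, sq_abs]; ring
  simp_rw [he]
  have hp : ∀ s : ℝ, HasDerivAt (fun s => ‖w‖ ^ 2 + 2 * s * ⟪w, δ⟫ + s ^ 2 * ‖δ‖ ^ 2)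
      (2 * ⟪w, δ⟫ + 2 * s * ‖δ‖ ^ 2) s := by
    intro s
    have a1 := (((hasDerivAt_id s).const_mul 2).mul_const ⟪w, δ⟫).const_add (‖w‖ ^ 2)
    have a2 := ((hasDerivAt_id s).pow 2).mul_const (‖δ‖ ^ 2)
    exact (a1.add a2).congr_deriv (by simp)
  have hc : Tendsto (fun s : ℝ => ‖w‖ ^ 2 + 2 * s * ⟪w, δ⟫ + s ^ 2 * ‖δ‖ ^ 2) (𝓝 0)
      (𝓝 (‖w‖ ^ 2)) := by simpa using (hp 0).continuousAt.tendsto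
  refine ⟨fun s => Q' (‖w‖ ^ 2 + 2 * s * ⟪w, δ⟫ + s ^ 2 * ‖δ‖ ^ 2) *
    (2 * ⟪w, δ⟫ + 2 * s * ‖δ‖ ^ 2), by simp; ring, ?_, ?_⟩
  · filter_upwards [hc.eventually h1] with s hs using hs.comp s (hp s)
  · have h2' : HasDerivAt Q' Q2 (‖w‖ ^ 2 + 2 * (0:ℝ) * ⟪w, δ⟫ + (0:ℝ) ^ 2 * ‖δ‖ ^ 2) := by
      simpa using h2
    have a1 := h2'.comp (0:ℝ) (hp 0)
    have a2 : HasDerivAt (fun s : ℝ => 2 * ⟪w, δ⟫ + 2 * s * ‖δ‖ ^ 2) (2 * ‖δ‖ ^ 2) 0 := by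
      have := (((hasDerivAt_id (0:ℝ)).const_mul 2).mul_const (‖δ‖ ^ 2)).const_add (2 * ⟪w, δ⟫)
      exact this.congr_deriv (by simp)
    exact (a1.mul a2).congr_deriv (by simp; ring)

/-- Sum of a quadratic form over the images of the standard basis under `1 + c ν ⊗ ν`. -/
theorem sum_bilin_shear (M : EuclideanSpace ℝ (Fin n) →L[ℝ] EuclideanSpace ℝ (Fin n) →L[ℝ] ℝ)
    (ν : EuclideanSpace ℝ (Fin n)) (c : ℝ) (hν : ‖ν‖ = 1) :
    ∑ i, M (EuclideanSpace.single i 1 + (c * ν i) • ν) (EuclideanSpace.single i 1 + (c * ν i) • ν)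
      = ∑ i, M (EuclideanSpace.single i 1) (EuclideanSpace.single i 1)
        + (2 * c + c ^ 2) * M ν ν := by
  have hsum : ∑ i, ν i • EuclideanSpace.single i (1:ℝ) = ν := by
    ext j
    simp [Finset.sum_apply, Pi.single_apply]
  have hsq : ∑ i, ν i ^ 2 = 1 := by
    have := EuclideanSpace.real_norm_sq_eq ν
    rw [hν] at this; linarith
  have hlin : ∀ l : EuclideanSpace ℝ (Fin n) →L[ℝ] ℝ,
      ∑ i, ν i * l (EuclideanSpace.single i 1) = l ν := by
    intro l
    conv_rhs => rw [← hsum, map_sum]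
    simp
  have h1 : ∑ i, ν i * M (EuclideanSpace.single i 1) ν = M ν ν := hlin (M.flip ν)
  have h2 : ∑ i, ν i * M ν (EuclideanSpace.single i 1) = M ν ν := hlin (M ν)
  have : ∀ i, M (EuclideanSpace.single i 1 + (c * ν i) • ν)
      (EuclideanSpace.single i 1 + (c * ν i) • ν) =
      M (EuclideanSpace.single i 1) (EuclideanSpace.single i 1)
      + c * (ν i * M (EuclideanSpace.single i 1) ν) + c * (ν i * M ν (EuclideanSpace.single i 1))
      + c ^ 2 * M ν ν * ν i ^ 2 := by
    intro i
    simp only [map_add, map_smul, add_apply, smul_apply,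
      smul_eq_mul]
    ring
  simp_rw [this, Finset.sum_add_distrib, ← Finset.mul_sum, h1, h2, hsq]
  ring

/-- `v` is `C²` at `x` and, unless `x` is critical, satisfies `-Δ_m v = F` there, written in
nondivergence form. -/
def MEq (m : ℝ) (v : EuclideanSpace ℝ (Fin n) → ℝ) (x : EuclideanSpace ℝ (Fin n)) (F : ℝ) : Prop :=
  ContDiffAt ℝ 2 v x ∧ (gradient v x ≠ 0 →
    ∑ i, hess v x (EuclideanSpace.single i 1) (EuclideanSpace.single i 1)
      + (m - 2) / ‖gradient v x‖ ^ 2 * hess v x (gradient v x) (gradient v x)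
      = -(F * ‖gradient v x‖ ^ (2 - m)))

theorem fderiv_eq_inner_gradient (v : EuclideanSpace ℝ (Fin n) → ℝ)
    (x ξ : EuclideanSpace ℝ (Fin n)) : fderiv ℝ v x ξ = ⟪gradient v x, ξ⟫ := by
  simp [gradient]

theorem gradient_eq_of_fderiv {v : EuclideanSpace ℝ (Fin n) → ℝ}
    {x g : EuclideanSpace ℝ (Fin n)} (h : ∀ ξ, fderiv ℝ v x ξ = ⟪g, ξ⟫) : gradient v x = g := by
  apply ext_inner_right ℝ
  intro ξ
  rw [← fderiv_eq_inner_gradient, h]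

theorem MEq.sum_shear {m : ℝ} (hm : 1 < m) {v : EuclideanSpace ℝ (Fin n) → ℝ}
    {x : EuclideanSpace ℝ (Fin n)} {F c : ℝ} (h : MEq m v x F) (hg : gradient v x ≠ 0)
    (hc : (1 + c) ^ 2 = m - 1) {ν : EuclideanSpace ℝ (Fin n)} (hν : ‖ν‖ = 1)
    {t : ℝ} (hgν : gradient v x = t • ν) :
    ∑ i, hess v x (EuclideanSpace.single i 1 + (c * ν i) • ν)
      (EuclideanSpace.single i 1 + (c * ν i) • ν) = -(F * ‖gradient v x‖ ^ (2 - m)) := by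
  rw [sum_bilin_shear _ _ _ hν, ← h.2 hg]
  have ht : t ≠ 0 := by rintro rfl; simp at hgν; exact hg hgν
  have hn : ‖gradient v x‖ ^ 2 = t ^ 2 := by
    rw [hgν, norm_smul, hν, mul_one, Real.norm_eq_abs, sq_abs]
  rw [hn, hgν]
  simp only [map_smul, smul_apply, smul_eq_mul]
  field_simp
  linear_combination (hess v x ν ν) * hc

/-- The bilinear form `(a, b) ↦ A ⟪w, a⟫ ⟪w, b⟫ + B ⟪a, b⟫`. -/
def radialForm (A B : ℝ) (w : EuclideanSpace ℝ (Fin n)) :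
    EuclideanSpace ℝ (Fin n) →L[ℝ] EuclideanSpace ℝ (Fin n) →L[ℝ] ℝ :=
  A • (innerSL ℝ w).smulRight (innerSL ℝ w) +
    B • ∑ i, (EuclideanSpace.proj i : EuclideanSpace ℝ (Fin n) →L[ℝ] ℝ).smulRight
      (EuclideanSpace.proj i)

theorem radialForm_apply (A B : ℝ) (w a b : EuclideanSpace ℝ (Fin n)) :
    radialForm A B w a b = A * (⟪w, a⟫ * ⟪w, b⟫) + B * ⟪a, b⟫ := by
  simp [radialForm, PiLp.inner_apply, mul_comm]

theorem sum_radialForm (A B : ℝ) (w : EuclideanSpace ℝ (Fin n)) :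
    ∑ i, radialForm A B w (EuclideanSpace.single i 1) (EuclideanSpace.single i 1)
      = A * ‖w‖ ^ 2 + B * n := by
  simp_rw [radialForm_apply, Finset.sum_add_distrib, ← Finset.mul_sum]
  congr 1
  · rw [EuclideanSpace.real_norm_sq_eq]
    congr 1
    refine Finset.sum_congr rfl fun i _ => ?_
    rw [EuclideanSpace.inner_single_right]; simp [sq]
  · simp

/-- Comparison at a point where a radial function touches a solution from below. -/
theorem MEq.touch {m : ℝ} (hm : 1 < m) {v : EuclideanSpace ℝ (Fin n) → ℝ}
    {x z : EuclideanSpace ℝ (Fin n)} {F : ℝ} (h : MEq m v x F) (hxz : x ≠ z)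
    {Q Q' : ℝ → ℝ} {Q2 : ℝ} (h1 : ∀ᶠ τ in 𝓝 (‖x - z‖ ^ 2), HasDerivAt Q (Q' τ) τ)
    (h2 : HasDerivAt Q' Q2 (‖x - z‖ ^ 2)) (hQ : Q' (‖x - z‖ ^ 2) ≠ 0)
    (hmin : IsLocalMin (fun y => v y - Q (‖y - z‖ ^ 2)) x) :
    4 * (m - 1) * Q2 * ‖x - z‖ ^ 2 + 2 * (n + m - 2) * Q' (‖x - z‖ ^ 2)
      ≤ -(F * (2 * |Q' (‖x - z‖ ^ 2)| * ‖x - z‖) ^ (2 - m)) := by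
  set w := x - z with hw
  have hw0 : ‖w‖ ≠ 0 := by simpa [hw, sub_eq_zero] using hxz
  have key : ∀ ξ, fderiv ℝ v x ξ - 2 * Q' (‖w‖ ^ 2) * ⟪w, ξ⟫ = 0 ∧
      0 ≤ hess v x ξ ξ - (4 * Q2 * ⟪w, ξ⟫ ^ 2 + 2 * Q' (‖w‖ ^ 2) * ‖ξ‖ ^ 2) := by
    intro ξ
    apply ((hasJet_line h.1 ξ).sub (hasJet_normSq w ξ h1 h2)).of_isLocalMin
    have hc : Tendsto (fun s : ℝ => x + s • ξ) (𝓝 0) (𝓝 x) := by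
      have : Continuous (fun s : ℝ => x + s • ξ) := by fun_prop
      simpa using this.tendsto 0
    have := hc.eventually hmin
    filter_upwards [this] with s hs
    simp only [hw, zero_smul, add_zero] at hs ⊢
    rwa [show x - z + s • ξ = x + s • ξ - z by abel]
  have hgr : gradient v x = (2 * Q' (‖w‖ ^ 2)) • w := by
    apply gradient_eq_of_fderiv
    intro ξ
    rw [inner_smul_left]
    have := (key ξ).1
    simp only [conj_trivial]; linarith
  have hgn : ‖gradient v x‖ = 2 * |Q' (‖w‖ ^ 2)| * ‖w‖ := by
    rw [hgr, norm_smul, Real.norm_eq_abs, abs_mul]; simp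
  have hg0 : gradient v x ≠ 0 := by
    rw [← norm_ne_zero_iff, hgn]; positivity
  have hc : (1 + (Real.sqrt (m - 1) - 1)) ^ 2 = m - 1 := by
    rw [add_sub_cancel, Real.sq_sqrt (by linarith)]
  have hν : ‖(‖w‖⁻¹ • w)‖ = 1 := by rw [norm_smul]; simp [hw0]
  have e1 := h.sum_shear hm hg0 hc hν (t := 2 * Q' (‖w‖ ^ 2) * ‖w‖) (by
    rw [hgr, smul_smul]; congr 1; field_simp)
  rw [hgn] at e1
  rw [← e1]
  have e2 := sum_bilin_shear (radialForm (4 * Q2) (2 * Q' (‖w‖ ^ 2)) w) (‖w‖⁻¹ • w)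
    (Real.sqrt (m - 1) - 1) hν
  rw [sum_radialForm, radialForm_apply] at e2
  have e3 : ⟪w, ‖w‖⁻¹ • w⟫ = ‖w‖ := by
    rw [inner_smul_right, real_inner_self_eq_norm_sq]; field_simp
  rw [e3, real_inner_self_eq_norm_sq, hν] at e2
  refine le_trans (le_of_eq ?_) (Finset.sum_le_sum (s := Finset.univ) fun i _ =>
    sub_nonneg.1 (key (EuclideanSpace.single i 1 +
      ((Real.sqrt (m - 1) - 1) * (‖w‖⁻¹ • w) i) • (‖w‖⁻¹ • w))).2)
  rw [show (∑ i, (4 * Q2 * ⟪w, (EuclideanSpace.single i 1 +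
      ((Real.sqrt (m - 1) - 1) * (‖w‖⁻¹ • w) i) • (‖w‖⁻¹ • w))⟫ ^ 2 + 2 * Q' (‖w‖ ^ 2) *
      ‖(EuclideanSpace.single i 1 +
      ((Real.sqrt (m - 1) - 1) * (‖w‖⁻¹ • w) i) • (‖w‖⁻¹ • w))‖ ^ 2)) = _ from
    (Finset.sum_congr rfl fun i _ => by
      rw [radialForm_apply, real_inner_self_eq_norm_sq, sq])|>.trans e2]
  generalize Real.sqrt (m - 1) - 1 = c at hc
  generalize Q' (‖w‖ ^ 2) = q1
  have hc' : 2 * c + c ^ 2 = m - 2 := by linarith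
  rw [hc']; ring

theorem sum_sq_eq_one {ν : EuclideanSpace ℝ (Fin n)} (hν : ‖ν‖ = 1) : ∑ i, ν i ^ 2 = 1 := by
  have := EuclideanSpace.real_norm_sq_eq ν
  rw [hν] at this; linarith

theorem sum_mul_eq_inner (ν e : EuclideanSpace ℝ (Fin n)) : ∑ i, ν i * e i = ⟪e, ν⟫ := by
  rw [PiLp.inner_apply]; simp

/-- The quadratic form of a radial function summed over the differences of two families of
sheared basis vectors. -/
theorem sum_radial_shear_diff (A B r c : ℝ) {ν e w : EuclideanSpace ℝ (Fin n)} (hν : ‖ν‖ = 1)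
    (he : ‖e‖ = 1) (hw : w = r • e) :
    ∑ i, (A * ⟪w, (c * ν i) • ν + ((2 + c) * e i) • e⟫ ^ 2
      + B * ‖(c * ν i) • ν + ((2 + c) * e i) • e‖ ^ 2)
    = (A * r ^ 2 + B) * ((3 * c ^ 2 + 4 * c) * ⟪e, ν⟫ ^ 2 + (2 + c) ^ 2)
      + B * c ^ 2 * (1 - ⟪e, ν⟫ ^ 2) := by
  have h : ∀ i, A * ⟪w, (c * ν i) • ν + ((2 + c) * e i) • e⟫ ^ 2
      + B * ‖(c * ν i) • ν + ((2 + c) * e i) • e‖ ^ 2 =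
      (A * r ^ 2 * c ^ 2 * ⟪e, ν⟫ ^ 2 + B * c ^ 2) * ν i ^ 2
      + ((A * r ^ 2 + B) * (2 * c * (2 + c) * ⟪e, ν⟫)) * (ν i * e i)
      + ((A * r ^ 2 + B) * (2 + c) ^ 2) * e i ^ 2 := by
    intro i
    rw [norm_add_sq_real, norm_smul, norm_smul, hν, he, hw]
    simp only [inner_add_right, inner_smul_left, inner_smul_right, conj_trivial,
      real_inner_self_eq_norm_sq, he, real_inner_comm e ν, Real.norm_eq_abs, mul_one, sq_abs]
    ring
  simp_rw [h, Finset.sum_add_distrib, ← Finset.mul_sum, sum_sq_eq_one hν, sum_sq_eq_one he,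
    sum_mul_eq_inner]
  ring

theorem sum_norm_sq_shear (c : ℝ) {ν : EuclideanSpace ℝ (Fin n)} (hν : ‖ν‖ = 1) :
    ∑ i, ‖EuclideanSpace.single i 1 + (c * ν i) • ν‖ ^ 2 = n + (2 * c + c ^ 2) := by
  have := sum_bilin_shear (radialForm 0 1 ν) ν c hν
  rw [sum_radialForm] at this
  simp only [radialForm_apply, zero_mul, zero_add, one_mul, real_inner_self_eq_norm_sq, hν] at this
  linarith

set_option maxHeartbeats 1000000 in
/-- Doubling of variables: at a maximum of `v x - v y - Q (‖x - y‖²) - K / 2 ‖x - x₀‖²` the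
concavity of the radial profile is bounded by the right-hand side and the localization terms. -/
theorem MEq.doubling {m : ℝ} (hm : 1 < m) {v : EuclideanSpace ℝ (Fin n) → ℝ}
    {x y x0 : EuclideanSpace ℝ (Fin n)} {Fx Fy K : ℝ} (hx : MEq m v x Fx) (hy : MEq m v y Fy)
    (hxy : x ≠ y) {Q Q' : ℝ → ℝ} {Q1 Q2 : ℝ}
    (h1 : ∀ᶠ τ in 𝓝 (‖x - y‖ ^ 2), HasDerivAt Q (Q' τ) τ)
    (h2 : HasDerivAt Q' Q2 (‖x - y‖ ^ 2)) (hQ' : Q' (‖x - y‖ ^ 2) = Q1) (hQ : 0 < Q1)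
    (hmax : IsLocalMax (fun z : EuclideanSpace ℝ (Fin n) × EuclideanSpace ℝ (Fin n) =>
      v z.1 - v z.2 - Q (‖z.1 - z.2‖ ^ 2) - K / 2 * ‖z.1 - x0‖ ^ 2) (x, y))
    (hK : 0 ≤ K) (hKx : K * ‖x - x0‖ ≤ ‖x - y‖ * Q1)
    (hconc : 4 * Q2 * ‖x - y‖ ^ 2 + 2 * Q1 ≤ 0) (hFy : 0 ≤ Fy) :
    ‖x - y‖ * Q1 ≤ ‖gradient v x‖ ∧ ‖gradient v x‖ ≤ 3 * (‖x - y‖ * Q1) ∧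
    -(Fx * ‖gradient v x‖ ^ (2 - m)) ≤
      4 * min 1 (m - 1) * (4 * Q2 * ‖x - y‖ ^ 2 + 2 * Q1) + K * (n + m - 2)
      + 2 * Q1 * (Real.sqrt (m - 1) - 1) ^ 2 * (K * ‖x - x0‖ / (‖x - y‖ * Q1)) ^ 2 := by
  set w := x - y with hw
  set r := ‖w‖ with hr
  have hr0 : 0 < r := by simpa [hr, hw, sub_eq_zero] using hxy
  have key : ∀ ξ ζ, fderiv ℝ v x ξ - fderiv ℝ v y ζ - 2 * Q1 * ⟪w, ξ - ζ⟫
        - K * ⟪x - x0, ξ⟫ = 0 ∧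
      hess v x ξ ξ - hess v y ζ ζ - (4 * Q2 * ⟪w, ξ - ζ⟫ ^ 2 + 2 * Q1 * ‖ξ - ζ‖ ^ 2)
        - K * ‖ξ‖ ^ 2 ≤ 0 := by
    intro ξ ζ
    have j1 := ((hasJet_line hx.1 ξ).sub (hasJet_line hy.1 ζ)).sub
      (hasJet_normSq w (ξ - ζ) h1 h2)
    have j2 := j1.sub (hasJet_normSq (Q := fun τ => K / 2 * τ) (Q' := fun _ => K / 2) (Q2 := 0)
      (x - x0) ξ (Eventually.of_forall fun τ => by
        simpa using (hasDerivAt_id τ).const_mul (K / 2)) (hasDerivAt_const _ _))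
    have j3 := j2.of_isLocalMax (by
      have hc : Tendsto (fun s : ℝ => (x + s • ξ, y + s • ζ)) (𝓝 0) (𝓝 (x, y)) := by
        have : Continuous (fun s : ℝ => (x + s • ξ, y + s • ζ)) := by fun_prop
        simpa using this.tendsto 0
      have := hc.eventually hmax
      filter_upwards [this] with s hs
      simp only [zero_smul, add_zero] at hs ⊢
      have e1 : w + s • (ξ - ζ) = x + s • ξ - (y + s • ζ) := by rw [hw, smul_sub]; abel
      have e2 : x - x0 + s • ξ = x + s • ξ - x0 := by abel
      rw [e1, e2]
      exact hs)
    rw [hQ'] at j3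
    constructor <;> linarith [j3.1, j3.2]
  have hgx : gradient v x = (2 * Q1) • w + K • (x - x0) := by
    apply gradient_eq_of_fderiv
    intro ξ
    have := (key ξ 0).1
    simp only [map_zero, sub_zero] at this
    rw [inner_add_left, inner_smul_left, inner_smul_left]
    simp only [conj_trivial]; linarith
  have hgy : gradient v y = (2 * Q1) • w := by
    apply gradient_eq_of_fderiv
    intro ξ
    have := (key 0 ξ).1
    simp only [map_zero, zero_sub, inner_neg_right, inner_zero_right] at this
    rw [inner_smul_left]
    simp only [conj_trivial]; linarith
  have n1 : ‖(2 * Q1) • w‖ = 2 * (r * Q1) := by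
    rw [norm_smul, Real.norm_eq_abs, abs_of_pos (by positivity)]; ring
  have n2 : ‖K • (x - x0)‖ = K * ‖x - x0‖ := by
    rw [norm_smul, Real.norm_eq_abs, abs_of_nonneg hK]
  have lo : r * Q1 ≤ ‖gradient v x‖ := by
    have := norm_sub_le ((2 * Q1) • w + K • (x - x0)) (K • (x - x0))
    rw [add_sub_cancel_right, n1, n2] at this
    rw [hgx]; linarith
  have hi : ‖gradient v x‖ ≤ 3 * (r * Q1) := by
    have := norm_add_le ((2 * Q1) • w) (K • (x - x0))
    rw [n1, n2] at this
    rw [hgx]; linarith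
  refine ⟨lo, hi, ?_⟩
  set G := ‖gradient v x‖ with hG
  have hG0 : 0 < G := lt_of_lt_of_le (by positivity) lo
  set c := Real.sqrt (m - 1) - 1 with hcdef
  have hc : (1 + c) ^ 2 = m - 1 := by
    rw [hcdef, add_sub_cancel, Real.sq_sqrt (by linarith)]
  have hc1 : 0 < 1 + c := by rw [hcdef, add_sub_cancel]; exact Real.sqrt_pos.2 (by linarith)
  set ν := G⁻¹ • gradient v x with hνd
  set e := r⁻¹ • w with hed
  have hν : ‖ν‖ = 1 := by
    rw [hνd, norm_smul, ← hG, norm_inv, Real.norm_of_nonneg hG0.le]; field_simp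
  have he : ‖e‖ = 1 := by
    rw [hed, norm_smul, ← hr, norm_inv, Real.norm_of_nonneg hr0.le]; field_simp
  have hwe : w = r • e := by rw [hed, smul_smul, mul_inv_cancel₀ hr0.ne', one_smul]
  have hgν : gradient v x = G • ν := by rw [hνd, smul_smul, mul_inv_cancel₀ hG0.ne', one_smul]
  have sx := hx.sum_shear hm (by rw [← norm_ne_zero_iff]; exact hG0.ne') hc hν hgν
  have hgy0 : gradient v y ≠ 0 := by
    rw [← norm_ne_zero_iff, hgy, n1]; positivity
  have sy := hy.sum_shear hm hgy0 (c := -(2 + c)) (by rw [← hc]; ring) he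
    (t := 2 * Q1 * r) (by rw [hgy, hwe, smul_smul])
  have hdiff : ∀ i : Fin n, (EuclideanSpace.single i 1 + (c * ν i) • ν) -
      (EuclideanSpace.single i 1 + (-(2 + c) * e i) • e) =
      (c * ν i) • ν + ((2 + c) * e i) • e := by
    intro i
    rw [neg_mul, neg_smul]; abel
  have hsum := Finset.sum_le_sum (s := Finset.univ) fun i (_ : i ∈ Finset.univ) =>
    (key (EuclideanSpace.single i 1 + (c * ν i) • ν)
      (EuclideanSpace.single i 1 + (-(2 + c) * e i) • e)).2
  simp_rw [hdiff, Finset.sum_sub_distrib] at hsum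
  rw [sx, sy, sum_radial_shear_diff _ _ r c hν he hwe, ← Finset.mul_sum, sum_norm_sq_shear c hν]
    at hsum
  simp only [Finset.sum_const_zero] at hsum
  have hyF : 0 ≤ Fy * ‖gradient v y‖ ^ (2 - m) := by positivity
  set s := ⟪e, ν⟫ with hs
  have hs1 : s ^ 2 ≤ 1 := by
    have := abs_real_inner_le_norm e ν
    rw [hν, he, mul_one] at this
    exact (sq_le_one_iff_abs_le_one _).2 this
  have hperp : 1 - s ^ 2 ≤ (K * ‖x - x0‖ / (r * Q1)) ^ 2 := by
    have t1 : ‖gradient v x - (2 * Q1 * r) • e‖ ^ 2 = (K * ‖x - x0‖) ^ 2 := by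
      rw [hgx, hwe, smul_smul, add_sub_cancel_left, n2]
    rw [norm_sub_sq_real, norm_smul, he, mul_one, Real.norm_eq_abs, sq_abs, ← hG,
      inner_smul_right, hgν, inner_smul_left, real_inner_comm, ← hs] at t1
    simp only [conj_trivial] at t1
    have t2 : G ^ 2 * (1 - s ^ 2) ≤ (K * ‖x - x0‖) ^ 2 := by
      nlinarith [sq_nonneg (2 * Q1 * r - G * s)]
    rw [div_pow, le_div_iff₀ (by positivity)]
    have : (r * Q1) ^ 2 ≤ G ^ 2 := by gcongr
    nlinarith
  have hbr : 4 * min 1 (m - 1) ≤ (3 * c ^ 2 + 4 * c) * s ^ 2 + (2 + c) ^ 2 := by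
    have a1 : min 1 (m - 1) ≤ 1 := min_le_left _ _
    have a2 : min 1 (m - 1) ≤ (1 + c) ^ 2 := hc ▸ min_le_right _ _
    have b1 : 4 * min 1 (m - 1) ≤ (2 + c) ^ 2 := by
      rcases le_total 0 c with h | h
      · nlinarith
      · nlinarith
    have b2 : (3 * c ^ 2 + 4 * c) * s ^ 2 + (2 + c) ^ 2
      = (1 - s ^ 2) * (2 + c) ^ 2 + s ^ 2 * (4 * (1 + c) ^ 2) := by ring
    rw [b2]
    nlinarith [sq_nonneg s]
  have f1 := mul_le_mul_of_nonpos_left hbr hconc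
  have f2 := mul_le_mul_of_nonneg_left hperp (by positivity : 0 ≤ 2 * Q1 * c ^ 2)
  have f3 : (2 * c + c ^ 2) = m - 2 := by linarith
  rw [f3] at hsum
  linarith

theorem fderiv_const_smul_comp_affine {G : Type*} [NormedAddCommGroup G] [NormedSpace ℝ G]
    (f : EuclideanSpace ℝ (Fin n) → G) (a ρ : ℝ) (x0 : EuclideanSpace ℝ (Fin n)) :
    fderiv ℝ (fun y => a • f (x0 + ρ • y)) = fun y => (a * ρ) • fderiv ℝ f (x0 + ρ • y) := by
  funext y
  have h1 := congrFun (fderiv_const_smul_field (𝕜 := ℝ) (f := fun y => f (x0 + ρ • y)) a) y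
  have h2 := fderiv_comp_smul (𝕜 := ℝ) (f := fun y => f (x0 + y)) (x := y) ρ
  have h3 := fderiv_comp_add_left (𝕜 := ℝ) (f := f) (x := ρ • y) x0
  rw [h3] at h2
  rw [Pi.smul_apply, h2, smul_smul] at h1
  exact h1

theorem fderiv_const_mul_comp_affine (f : EuclideanSpace ℝ (Fin n) → ℝ) (a ρ : ℝ)
    (x0 : EuclideanSpace ℝ (Fin n)) :
    fderiv ℝ (fun y => a * f (x0 + ρ • y)) = fun y => (a * ρ) • fderiv ℝ f (x0 + ρ • y) :=
  fderiv_const_smul_comp_affine f a ρ x0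

theorem gradient_const_mul_comp_affine (f : EuclideanSpace ℝ (Fin n) → ℝ) (a ρ : ℝ)
    (x0 y : EuclideanSpace ℝ (Fin n)) :
    gradient (fun y => a * f (x0 + ρ • y)) y = (a * ρ) • gradient f (x0 + ρ • y) := by
  apply gradient_eq_of_fderiv
  intro ξ
  rw [fderiv_const_mul_comp_affine, inner_smul_left, ← fderiv_eq_inner_gradient]
  simp

theorem hess_const_mul_comp_affine (f : EuclideanSpace ℝ (Fin n) → ℝ) (a ρ : ℝ)
    (x0 y : EuclideanSpace ℝ (Fin n)) :
    hess (fun y => a * f (x0 + ρ • y)) y = (a * ρ * ρ) • hess f (x0 + ρ • y) := by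
  unfold hess
  rw [fderiv_const_mul_comp_affine]
  exact congrFun (fderiv_const_smul_comp_affine (fderiv ℝ f) (a * ρ) ρ x0) y

/-- Scaling invariance of the `m`-Laplace equation. -/
theorem MEq.rescale {m : ℝ} {v : EuclideanSpace ℝ (Fin n) → ℝ} {a ρ F : ℝ} (ha : 0 < a)
    (hρ : 0 < ρ) {x0 y : EuclideanSpace ℝ (Fin n)} (h : MEq m v (x0 + ρ • y) F) :
    MEq m (fun y => a * v (x0 + ρ • y)) y (a ^ (m - 1) * ρ ^ m * F) := by
  refine ⟨?_, ?_⟩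
  · exact contDiffAt_const.mul (h.1.comp y (by fun_prop))
  · rw [gradient_const_mul_comp_affine, hess_const_mul_comp_affine]
    intro hg
    have hg' : gradient v (x0 + ρ • y) ≠ 0 := fun h0 => hg (by rw [h0, smul_zero])
    have e := h.2 hg'
    have hn : 0 < ‖gradient v (x0 + ρ • y)‖ := norm_pos_iff.2 hg'
    set g := gradient v (x0 + ρ • y)
    rw [norm_smul, Real.norm_of_nonneg (by positivity), Real.mul_rpow (by positivity) (by positivity),
      Real.mul_rpow (by positivity) (by positivity)]
    have e1 : a ^ (m - 1) * a ^ (2 - m) = a := by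
      rw [← Real.rpow_add ha]; norm_num
    have e2 : ρ ^ m * ρ ^ (2 - m) = ρ * ρ := by
      rw [← Real.rpow_add hρ]; norm_num [sq]
    simp only [smul_apply, smul_eq_mul, map_smul, ← Finset.mul_sum]
    have e3 : a ^ (m - 1) * ρ ^ m * F * (a ^ (2 - m) * ρ ^ (2 - m) * ‖g‖ ^ (2 - m))
      = a * (ρ * ρ) * (F * ‖g‖ ^ (2 - m)) := by
      calc _ = (a ^ (m - 1) * a ^ (2 - m)) * (ρ ^ m * ρ ^ (2 - m)) * (F * ‖g‖ ^ (2 - m)) := by ring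
        _ = _ := by rw [e1, e2]
    rw [e3]
    have e4 : (m - 2) / (a * ρ * ‖g‖) ^ 2 *
        (a * ρ * (a * ρ * (a * ρ * ρ * hess v (x0 + ρ • y) g g)))
       = a * (ρ * ρ) * ((m - 2) / ‖g‖ ^ 2 * hess v (x0 + ρ • y) g g) := by
      field_simp
    rw [e4]
    linear_combination (a * (ρ * ρ)) * e

/-- A one-sided Lipschitz bound at a point bounds the gradient there. -/
theorem norm_gradient_le_of_sub_le {v : EuclideanSpace ℝ (Fin n) → ℝ}
    {x0 : EuclideanSpace ℝ (Fin n)} {L : ℝ} (hv : DifferentiableAt ℝ v x0) (hL : 0 ≤ L)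
    (h : ∀ᶠ y in 𝓝 x0, v x0 - v y ≤ L * ‖y - x0‖) : ‖gradient v x0‖ ≤ L := by
  set g := gradient v x0 with hg
  rcases eq_or_ne g 0 with h0 | h0
  · simpa [h0] using hL
  have hg0 : 0 < ‖g‖ := norm_pos_iff.2 h0
  have hl : HasDerivAt (fun s : ℝ => x0 + s • (-g)) (-g) 0 := by
    simpa using ((hasDerivAt_id (0:ℝ)).smul_const (-g)).const_add x0
  have hd : HasDerivAt (fun s : ℝ => v (x0 + s • (-g))) (fderiv ℝ v x0 (-g)) 0 := by
    have : HasFDerivAt v (fderiv ℝ v x0) (x0 + (0:ℝ) • (-g)) := by simpa using hv.hasFDerivAt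
    exact this.comp_hasDerivAt (0:ℝ) hl
  have ht := hd.tendsto_slope.mono_left (nhdsGT_le_nhdsNE 0)
  have hc : Tendsto (fun s : ℝ => x0 + s • (-g)) (𝓝[>] 0) (𝓝 x0) := by
    have : Tendsto (fun s : ℝ => x0 + s • (-g)) (𝓝 0) (𝓝 x0) := by
      simpa using hl.continuousAt.tendsto
    exact this.mono_left nhdsWithin_le_nhds
  have hge : -(L * ‖g‖) ≤ fderiv ℝ v x0 (-g) := by
    refine ge_of_tendsto ht ?_
    filter_upwards [hc.eventually h, self_mem_nhdsWithin] with s hs hs0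
    have hs0 : 0 < s := hs0
    rw [slope_def_field]
    simp only [add_sub_cancel_left, norm_smul, norm_neg, Real.norm_of_nonneg hs0.le] at hs
    rw [sub_zero, le_div_iff₀ hs0]
    simp only [zero_smul, add_zero]
    linarith
  rw [fderiv_eq_inner_gradient, ← hg, inner_neg_right, real_inner_self_eq_norm_sq] at hge
  nlinarith

theorem rpow_le_of_mem_Icc {x s : ℝ} (h1 : 1 / 8 ≤ x) (h2 : x ≤ 8) : x ^ s ≤ 8 ^ |s| := by
  rcases le_total 0 s with h | h
  · rw [abs_of_nonneg h]; exact Real.rpow_le_rpow (by linarith) h2 h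
  · rw [abs_of_nonpos h, Real.rpow_neg (by norm_num), ← Real.inv_rpow (by norm_num)]
    exact Real.rpow_le_rpow_of_nonpos (by norm_num) (by linarith) h

set_option maxHeartbeats 400000 in
/-- A solution on a large ball with small oscillation and small right-hand side has gradient
less than one at the center. -/
theorem exists_norm_gradient_lt_one (n : ℕ) {m : ℝ} (hm : 1 < m) :
    ∃ R > 0, ∃ ε > 0, ∀ (v : EuclideanSpace ℝ (Fin n) → ℝ) (x0 : EuclideanSpace ℝ (Fin n))
      (F : EuclideanSpace ℝ (Fin n) → ℝ),
      (∀ x ∈ Metric.ball x0 R, MEq m v x (F x) ∧ 0 ≤ F x ∧ F x ≤ ε ∧ 0 ≤ v x ∧ v x ≤ 1 ∧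
        ‖gradient v x‖ ≤ 2) → ‖gradient v x0‖ < 1 := by
  obtain ⟨μ, hμ⟩ : ∃ a : ℝ, a = min 1 (m - 1) := ⟨_, rfl⟩
  have hμ0 : 0 < μ := hμ ▸ lt_min one_pos (by linarith)
  obtain ⟨c, hc⟩ : ∃ a : ℝ, a = Real.sqrt (m - 1) - 1 := ⟨_, rfl⟩
  obtain ⟨D, hD⟩ : ∃ a : ℝ, a = n + m + 64 * c ^ 2 := ⟨_, rfl⟩
  have hD0 : 0 < D := by rw [hD]; positivity
  obtain ⟨R, hR⟩ : ∃ a : ℝ, a = 16 + 16 * D / μ := ⟨_, rfl⟩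
  have hR0 : 16 ≤ R := by have : 0 ≤ 16 * D / μ := by positivity
                          linarith
  obtain ⟨B, hB⟩ : ∃ a : ℝ, a = 8 ^ |2 - m| := ⟨_, rfl⟩
  have hB0 : 0 < B := by rw [hB]; positivity
  refine ⟨R + 5, by positivity, μ / (8 * B), by positivity, fun v x0 F h => ?_⟩
  obtain ⟨K, hK⟩ : ∃ a : ℝ, a = 2 / R ^ 2 := ⟨_, rfl⟩
  have hK0 : 0 < K := by rw [hK]; positivity
  have hKD : K * D ≤ μ / 8 := by
    have : 16 * D ≤ R * μ := by
      rw [hR, add_mul, div_mul_cancel₀ _ hμ0.ne']; nlinarith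
    rw [hK, div_mul_eq_mul_div, div_le_iff₀ (by positivity)]
    nlinarith
  set Q : ℝ → ℝ := fun τ => 3 / 4 * √τ - τ / 16 with hQ
  set Q' : ℝ → ℝ := fun τ => 3 / 8 * (√τ)⁻¹ - 1 / 16 with hQ'
  have hQr : ∀ w : EuclideanSpace ℝ (Fin n), Q (‖w‖ ^ 2) = 3 / 4 * ‖w‖ - ‖w‖ ^ 2 / 16 := by
    intro w; simp [hQ]
  set S : Set (EuclideanSpace ℝ (Fin n) × EuclideanSpace ℝ (Fin n)) :=
    {z | ‖z.1 - x0‖ ≤ R ∧ ‖z.1 - z.2‖ ≤ 4} with hS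
  have hSc : IsCompact S := by
    apply Metric.isCompact_of_isClosed_isBounded
    · exact IsClosed.inter
        (isClosed_le (f := fun z : EuclideanSpace ℝ (Fin n) × EuclideanSpace ℝ (Fin n) =>
          ‖z.1 - x0‖) (by fun_prop) continuous_const)
        (isClosed_le (f := fun z : EuclideanSpace ℝ (Fin n) × EuclideanSpace ℝ (Fin n) =>
          ‖z.1 - z.2‖) (by fun_prop) continuous_const)
    · refine (Metric.isBounded_closedBall (x := x0) (r := R + 4)).prod
        (Metric.isBounded_closedBall (x := x0) (r := R + 4)) |>.subset ?_
      rintro ⟨x, y⟩ ⟨h1, h2⟩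
      simp only at h1 h2
      refine ⟨?_, ?_⟩
      · simp only [mem_closedBall_iff_norm]; linarith
      · simp only [mem_closedBall_iff_norm]
        have := norm_sub_le (x - x0) (x - y)
        rw [sub_sub_sub_cancel_left] at this
        linarith
  have hS1 : ∀ z ∈ S, z.1 ∈ Metric.ball x0 (R + 5) := by
    rintro z ⟨h1, h2⟩; rw [mem_ball_iff_norm]; linarith
  have hS2 : ∀ z ∈ S, z.2 ∈ Metric.ball x0 (R + 5) := by
    rintro z ⟨h1, h2⟩; rw [mem_ball_iff_norm]
    have := norm_sub_le (z.1 - x0) (z.1 - z.2)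
    rw [sub_sub_sub_cancel_left] at this
    linarith
  have hvc : ContinuousOn v (Metric.ball x0 (R + 5)) := fun x hx =>
    (h x hx).1.1.continuousAt.continuousWithinAt
  set f : EuclideanSpace ℝ (Fin n) × EuclideanSpace ℝ (Fin n) → ℝ := fun z =>
    v z.1 - v z.2 - Q (‖z.1 - z.2‖ ^ 2) - K / 2 * ‖z.1 - x0‖ ^ 2 with hf
  have hfc : ContinuousOn f S := by
    have hQc : Continuous Q := by fun_prop
    have c1 : ContinuousOn (fun z : EuclideanSpace ℝ (Fin n) × EuclideanSpace ℝ (Fin n) => v z.1) S :=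
      hvc.comp continuousOn_fst hS1
    have c2 : ContinuousOn (fun z : EuclideanSpace ℝ (Fin n) × EuclideanSpace ℝ (Fin n) => v z.2) S :=
      hvc.comp continuousOn_snd hS2
    have c3 : Continuous (fun z : EuclideanSpace ℝ (Fin n) × EuclideanSpace ℝ (Fin n) =>
      Q (‖z.1 - z.2‖ ^ 2)) := by fun_prop
    have c4 : Continuous (fun z : EuclideanSpace ℝ (Fin n) × EuclideanSpace ℝ (Fin n) =>
      K / 2 * ‖z.1 - x0‖ ^ 2) := by fun_prop
    exact ((c1.sub c2).sub c3.continuousOn).sub c4.continuousOn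
  obtain ⟨⟨x, y⟩, hzS, hzmax⟩ := hSc.exists_isMaxOn ⟨(x0, x0), by simp [hS]; linarith⟩ hfc
  have hx0 : x0 ∈ Metric.ball x0 (R + 5) := by simp; linarith
  rcases le_or_gt (f (x, y)) 0 with hle | hgt
  · refine lt_of_le_of_lt (norm_gradient_le_of_sub_le (L := 3 / 4)
      ((h x0 hx0).1.1.differentiableAt (by norm_num)) (by norm_num) ?_) (by norm_num)
    filter_upwards [Metric.ball_mem_nhds x0 (by norm_num : (0:ℝ) < 4)] with y' hy'
    rw [mem_ball_iff_norm'] at hy'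
    have := (hzmax (show (x0, y') ∈ S from ⟨by simp; linarith, hy'.le⟩)).trans hle
    simp only [hf, hQr, sub_self, norm_zero] at this
    rw [norm_sub_rev]
    nlinarith [sq_nonneg ‖x0 - y'‖]
  exfalso
  have hx := h x (hS1 (x, y) hzS)
  have hy := h y (hS2 (x, y) hzS)
  have hx1 : ‖x - x0‖ ≤ R := hzS.1
  have hx2 : ‖x - y‖ ≤ 4 := hzS.2
  simp only [hf, hQr] at hgt
  clear_value f S
  set r := ‖x - y‖ with hr
  have hφ : 0 ≤ 3 / 4 * r - r ^ 2 / 16 := by nlinarith [norm_nonneg (x - y)]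
  have hxy : x ≠ y := by
    rintro rfl
    have : 0 ≤ K / 2 * ‖x - x0‖ ^ 2 := by positivity
    simp only [sub_self] at hgt; linarith
  have hr0 : 0 < r := by simpa [hr, sub_eq_zero] using hxy
  have hr4 : r < 4 := by
    rcases hx2.lt_or_eq with h4 | h4
    · exact h4
    · rw [h4] at hgt
      have : 0 ≤ K / 2 * ‖x - x0‖ ^ 2 := by positivity
      linarith [hx.2.2.2.2.1, hy.2.2.2.1]
  have hxR : ‖x - x0‖ < R := by
    rcases hx1.lt_or_eq with h4 | h4
    · exact h4
    · rw [h4] at hgt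
      have : K / 2 * R ^ 2 = 1 := by rw [hK]; field_simp
      linarith [hx.2.2.2.2.1, hy.2.2.2.1]
  have hmax : IsLocalMax f (x, y) := by
    have ho : IsOpen {z : EuclideanSpace ℝ (Fin n) × EuclideanSpace ℝ (Fin n) |
        ‖z.1 - x0‖ < R ∧ ‖z.1 - z.2‖ < 4} :=
      IsOpen.inter
        (isOpen_lt (f := fun z : EuclideanSpace ℝ (Fin n) × EuclideanSpace ℝ (Fin n) =>
          ‖z.1 - x0‖) (by fun_prop) continuous_const)
        (isOpen_lt (f := fun z : EuclideanSpace ℝ (Fin n) × EuclideanSpace ℝ (Fin n) =>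
          ‖z.1 - z.2‖) (by fun_prop) continuous_const)
    filter_upwards [ho.mem_nhds ⟨hxR, hr4⟩] with z hz
    exact hzmax (hS ▸ ⟨hz.1.le, hz.2.le⟩)
  obtain ⟨Q1, hQ1⟩ : ∃ a : ℝ, a = 3 / (8 * r) - 1 / 16 := ⟨_, rfl⟩
  obtain ⟨Q2, hQ2⟩ : ∃ a : ℝ, a = -(3 / (16 * r ^ 3)) := ⟨_, rfl⟩
  have hrQ : r * Q1 = 3 / 8 - r / 16 := by rw [hQ1]; field_simp
  have hrQlo : 1 / 8 ≤ r * Q1 := by rw [hrQ]; linarith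
  have hQ1pos : 0 < Q1 := pos_of_mul_pos_right (lt_of_lt_of_le (by norm_num) hrQlo) hr0.le
  have hconc : 4 * Q2 * r ^ 2 + 2 * Q1 = -(1 / 8) := by
    rw [hQ1, hQ2]; field_simp; ring
  have hKx : K * ‖x - x0‖ ≤ r * Q1 := by
    have : K * ‖x - x0‖ ≤ K * R := by gcongr
    have h2 : K * R ≤ 1 / 8 := by
      rw [hK, div_mul_eq_mul_div, div_le_iff₀ (by positivity)]; nlinarith
    linarith
  have hdQ : ∀ τ : ℝ, 0 < τ → HasDerivAt Q (Q' τ) τ := by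
    intro τ hτ
    have := ((Real.hasDerivAt_sqrt hτ.ne').const_mul (3 / 4)).sub ((hasDerivAt_id τ).div_const 16)
    refine this.congr_deriv ?_
    simp only [hQ']; field_simp; ring
  have hdQ' : HasDerivAt Q' Q2 (r ^ 2) := by
    have := (((Real.hasDerivAt_sqrt (by positivity : r ^ 2 ≠ 0)).inv
      (by rw [Real.sqrt_sq hr0.le]; exact hr0.ne')).const_mul (3 / 8)).sub_const (1 / 16)
    refine this.congr_deriv ?_
    rw [Real.sqrt_sq hr0.le, hQ2]; field_simp; ring
  have hQ'r : Q' (r ^ 2) = Q1 := by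
    simp only [hQ', Real.sqrt_sq hr0.le, hQ1]; field_simp
  obtain ⟨g1, g2, g3⟩ := hx.1.doubling hm hy.1 hxy (Q := Q) (Q' := Q') (Q1 := Q1) (Q2 := Q2)
    (K := K) (x0 := x0)
    (by filter_upwards [lt_mem_nhds (show 0 < ‖x - y‖ ^ 2 by positivity)] with τ hτ
        exact hdQ τ hτ) hdQ' hQ'r hQ1pos (hf ▸ hmax) hK0.le hKx (by rw [hconc]; norm_num) hy.2.1
  rw [← hr, hconc, ← hc, ← hμ] at g3
  have hlip : v x - v y ≤ 2 * r := by
    have := (convex_ball x0 (R + 5)).norm_image_sub_le_of_norm_fderiv_le (𝕜 := ℝ) (f := v) (C := 2)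
      (fun z hz => (h z hz).1.1.differentiableAt (by norm_num))
      (fun z hz => by
        have := (h z hz).2.2.2.2.2
        rwa [gradient, LinearIsometryEquiv.norm_map] at this)
      (hS2 (x, y) hzS) (hS1 (x, y) hzS)
    exact (le_abs_self _).trans this
  have hKs : K * ‖x - x0‖ ^ 2 ≤ 4 * r := by linarith
  have herr : 2 * Q1 * c ^ 2 * (K * ‖x - x0‖ / (r * Q1)) ^ 2 ≤ 64 * c ^ 2 * K := by
    have e1 : 2 * Q1 * c ^ 2 * (K * ‖x - x0‖ / (r * Q1)) ^ 2
      = 2 * c ^ 2 * K * (K * ‖x - x0‖ ^ 2) / (r * (r * Q1)) := by field_simp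
    rw [e1, div_le_iff₀ (by positivity)]
    have e2 : 2 * c ^ 2 * K * (K * ‖x - x0‖ ^ 2) ≤ 2 * c ^ 2 * K * (4 * r) := by gcongr
    have e3 : 64 * c ^ 2 * K * (r * (1 / 8)) ≤ 64 * c ^ 2 * K * (r * (r * Q1)) := by gcongr
    linarith
  have hpow : F x * ‖gradient v x‖ ^ (2 - m) ≤ μ / (8 * B) * B := by
    apply mul_le_mul hx.2.2.1 _ (by positivity) (by positivity)
    rw [hB]
    exact rpow_le_of_mem_Icc (hrQlo.trans g1) (by linarith [hx.2.2.2.2.2])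
  have : μ / (8 * B) * B = μ / 8 := by field_simp
  have hfin : K * (n + m - 2) + 64 * c ^ 2 * K ≤ K * D := by rw [hD]; nlinarith
  linarith

theorem continuousAt_gradient {v : EuclideanSpace ℝ (Fin n) → ℝ} {x : EuclideanSpace ℝ (Fin n)}
    (h : ContDiffAt ℝ 2 v x) : ContinuousAt (gradient v) x :=
  ((InnerProductSpace.toDual ℝ _).symm.continuous.continuousAt).comp
    (hasFDerivAt_fderiv h).continuousAt

/-- Interior gradient estimate at unit scale. -/
theorem exists_norm_gradient_le_unit (n : ℕ) {m : ℝ} (hm : 1 < m) {Λ : ℝ} (hΛ : 0 ≤ Λ) :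
    ∃ C > 0, ∀ (v : EuclideanSpace ℝ (Fin n) → ℝ) (x0 : EuclideanSpace ℝ (Fin n))
      (F : EuclideanSpace ℝ (Fin n) → ℝ),
      (∀ x ∈ Metric.ball x0 1, MEq m v x (F x) ∧ 0 ≤ F x ∧ F x ≤ Λ ∧ 0 ≤ v x ∧ v x ≤ 1) →
        ‖gradient v x0‖ ≤ C := by
  obtain ⟨R, hR, ε, hε, hflat⟩ := exists_norm_gradient_lt_one n hm
  have hΛε : 0 ≤ Λ / ε := by positivity
  refine ⟨2 * (2 * R + Λ / ε + 1), by positivity, fun v x0 F h => ?_⟩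
  have hsub : Metric.closedBall x0 (1 / 2) ⊆ Metric.ball x0 1 :=
    Metric.closedBall_subset_ball (by norm_num)
  have hcont : ContinuousOn (fun x => (1 / 2 - ‖x - x0‖) * ‖gradient v x‖)
      (Metric.closedBall x0 (1 / 2)) := by
    intro x hx
    have := continuousAt_gradient (h x (hsub hx)).1.1
    exact (ContinuousAt.mul (by fun_prop) this.norm).continuousWithinAt
  obtain ⟨xb, hxb, hmax⟩ := (isCompact_closedBall x0 (1 / 2)).exists_isMaxOn
    ⟨x0, by simp⟩ hcont
  have hbound : ∀ x ∈ Metric.closedBall x0 (1 / 2),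
      (1 / 2 - ‖x - x0‖) * ‖gradient v x‖ ≤ (1 / 2 - ‖xb - x0‖) * ‖gradient v xb‖ := hmax
  set d := 1 / 2 - ‖xb - x0‖ with hd
  set G := ‖gradient v xb‖ with hG
  by_contra! hlarge
  have hN : 2 * R + Λ / ε + 1 < d * G := by
    have := hbound x0 (by simp)
    simp only [sub_self, norm_zero, sub_zero] at this
    linarith
  have hG0 : 0 ≤ G := norm_nonneg _
  have hd1 : d ≤ 1 / 2 := by rw [hd]; linarith [norm_nonneg (xb - x0)]
  have hdG : d * G ≤ G := by nlinarith
  have hGpos : 0 < G := by linarith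
  have hdpos : 0 < d := by
    by_contra! hd0
    nlinarith
  have hlt := hflat (fun y => 1 * v (xb + G⁻¹ • y)) 0
    (fun y => 1 ^ (m - 1) * G⁻¹ ^ m * F (xb + G⁻¹ • y)) (by
    intro y hy
    rw [mem_ball_zero_iff] at hy
    have hyn : ‖G⁻¹ • y‖ ≤ d / 2 := by
      rw [norm_smul, norm_inv, Real.norm_of_nonneg hG0, ← div_eq_inv_mul, div_le_iff₀ hGpos]
      linarith
    have hmem : ‖xb + G⁻¹ • y - x0‖ ≤ 1 / 2 - d / 2 := by
      have := norm_add_le (xb - x0) (G⁻¹ • y)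
      rw [show xb - x0 + G⁻¹ • y = xb + G⁻¹ • y - x0 by abel] at this
      linarith
    have hmem' : xb + G⁻¹ • y ∈ Metric.closedBall x0 (1 / 2) := by
      rw [mem_closedBall_iff_norm]; linarith
    obtain ⟨k1, k2, k3, k4, k5⟩ := h _ (hsub hmem')
    refine ⟨k1.rescale one_pos (by positivity), by positivity, ?_, by linarith, by linarith, ?_⟩
    · rw [Real.one_rpow, one_mul, Real.inv_rpow hG0]
      have : G ≤ G ^ m := Real.self_le_rpow_of_one_le (by linarith) hm.le
      have h2 : (G ^ m)⁻¹ * F (xb + G⁻¹ • y) ≤ G⁻¹ * Λ := by gcongr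
      refine h2.trans ?_
      rw [inv_mul_le_iff₀ hGpos, ← div_le_iff₀ hε]
      linarith
    · rw [gradient_const_mul_comp_affine, norm_smul, one_mul, norm_inv, Real.norm_of_nonneg hG0,
        inv_mul_le_iff₀ hGpos]
      have := hbound _ hmem'
      have h3 : d / 2 * ‖gradient v (xb + G⁻¹ • y)‖ ≤ d * G := by
        refine le_trans ?_ this
        gcongr
        linarith
      nlinarith)
  rw [gradient_const_mul_comp_affine, norm_smul, one_mul, norm_inv, Real.norm_of_nonneg hG0,
    smul_zero, add_zero, ← hG, inv_mul_cancel₀ hGpos.ne'] at hlt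
  exact lt_irrefl _ hlt

/-- Interior gradient estimate. -/
theorem exists_norm_gradient_le (n : ℕ) {m : ℝ} (hm : 1 < m) {Λ : ℝ} (hΛ : 0 ≤ Λ) :
    ∃ C > 0, ∀ (v : EuclideanSpace ℝ (Fin n) → ℝ) (x0 : EuclideanSpace ℝ (Fin n))
      (F : EuclideanSpace ℝ (Fin n) → ℝ) (ρ M : ℝ), 0 < ρ → 0 < M →
      (∀ x ∈ Metric.ball x0 ρ, MEq m v x (F x) ∧ 0 ≤ F x ∧ F x ≤ Λ * M ^ (m - 1) / ρ ^ m ∧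
        0 ≤ v x ∧ v x ≤ M) → ‖gradient v x0‖ ≤ C * M / ρ := by
  obtain ⟨C, hC, hunit⟩ := exists_norm_gradient_le_unit n hm hΛ
  refine ⟨C, hC, fun v x0 F ρ M hρ hM h => ?_⟩
  have := hunit (fun y => M⁻¹ * v (x0 + ρ • y)) 0
    (fun y => M⁻¹ ^ (m - 1) * ρ ^ m * F (x0 + ρ • y)) (by
    intro y hy
    rw [mem_ball_zero_iff] at hy
    have hmem : x0 + ρ • y ∈ Metric.ball x0 ρ := by
      rw [mem_ball_iff_norm, add_sub_cancel_left, norm_smul, Real.norm_of_nonneg hρ.le]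
      nlinarith
    obtain ⟨k1, k2, k3, k4, k5⟩ := h _ hmem
    refine ⟨k1.rescale (by positivity) hρ, by positivity, ?_, by positivity, ?_⟩
    · rw [Real.inv_rpow hM.le, mul_assoc, inv_mul_le_iff₀ (by positivity)]
      rw [le_div_iff₀ (by positivity)] at k3
      linarith
    · rw [inv_mul_le_iff₀ hM]; linarith)
  rw [gradient_const_mul_comp_affine, smul_zero, add_zero, norm_smul,
    Real.norm_of_nonneg (by positivity), ← div_eq_inv_mul, div_mul_eq_mul_div, div_le_iff₀ hM] at this
  rw [le_div_iff₀ hρ]; linarith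

/-- Off the critical set, the divergence form of the `m`-Laplacian agrees with the
nondivergence form. -/
theorem pLap_eq {m : ℝ} {u : EuclideanSpace ℝ (Fin n) → ℝ} {x : EuclideanSpace ℝ (Fin n)}
    (hu : ContDiffAt ℝ 2 u x) (hg : gradient u x ≠ 0) :
    pLap m u x = ‖gradient u x‖ ^ (m - 2) *
      (∑ i, hess u x (EuclideanSpace.single i 1) (EuclideanSpace.single i 1)
      + (m - 2) / ‖gradient u x‖ ^ 2 * hess u x (gradient u x) (gradient u x)) := by
  set g := gradient u x with hgd
  have hn : 0 < ‖g‖ := norm_pos_iff.2 hg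
  have hcoord : ∀ (y : EuclideanSpace ℝ (Fin n)) (i : Fin n),
      gradient u y i = fderiv ℝ u y (EuclideanSpace.single i 1) := by
    intro y i
    rw [fderiv_eq_inner_gradient, EuclideanSpace.inner_single_right]; simp
  have hi : ∀ i : Fin n, HasFDerivAt (fun y => gradient u y i)
      ((hess u x).flip (EuclideanSpace.single i 1)) x := by
    intro i
    simp_rw [hcoord]
    exact ((hasFDerivAt_fderiv hu).clm_apply (hasFDerivAt_const _ x)).congr_fderiv
      (by ext ξ; simp)
  have hg4 : ∑ i, g i • EuclideanSpace.single i (1:ℝ) = g := by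
    ext j; simp [Finset.sum_apply, Pi.single_apply]
  have hNsq : HasFDerivAt (fun y => ‖gradient u y‖ ^ 2) (2 • (hess u x).flip g) x := by
    simp_rw [EuclideanSpace.real_norm_sq_eq]
    refine (HasFDerivAt.fun_sum fun i _ => (hi i).pow 2).congr_fderiv ?_
    ext ξ
    conv_rhs => rw [← hg4]
    simp [Finset.mul_sum, mul_assoc, hgd]
  have hN := hNsq.rpow_const (p := (m - 2) / 2) (Or.inl (by rw [← hgd]; positivity))
  have hNeq : ∀ y, (‖gradient u y‖ ^ 2) ^ ((m - 2) / 2) = ‖gradient u y‖ ^ (m - 2) := by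
    intro y
    rw [← Real.rpow_natCast, ← Real.rpow_mul (norm_nonneg _)]; congr 1; push_cast; ring
  have hX : ∀ i, Xmat m u x i i =
      ((m - 2) / ‖g‖ ^ 2 * ‖g‖ ^ (m - 2)) * (g i * hess u x (EuclideanSpace.single i 1) g)
      + ‖g‖ ^ (m - 2) * hess u x (EuclideanSpace.single i 1) (EuclideanSpace.single i 1) := by
    intro i
    have hprod := hN.fun_mul (hi i)
    unfold Xmat pd
    have hfun : (fun y => fieldX m u y i) =
        fun y => (‖gradient u y‖ ^ 2) ^ ((m - 2) / 2) * gradient u y i := by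
      funext y; rw [hNeq]; simp [fieldX]
    rw [hfun, hprod.fderiv, hNeq, ← hgd]
    have h3 : (‖g‖ ^ 2) ^ ((m - 2) / 2 - 1) = ‖g‖ ^ (m - 2) / ‖g‖ ^ 2 := by
      rw [Real.rpow_sub_one (by positivity), hNeq]
    simp [h3]
    ring
  have hsum : ∑ i, g i * hess u x (EuclideanSpace.single i 1) g = hess u x g g := by
    have h5 := congrArg (fun w => hess u x w g) hg4
    simp only [map_sum, map_smul] at h5
    rw [← h5]; simp
  unfold pLap
  simp_rw [hX, Finset.sum_add_distrib, ← Finset.mul_sum, hsum]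
  ring

/-- A positive solution of the half-space problem. -/
structure HalfSol (n : ℕ) (m p q : ℝ) (u : EuclideanSpace ℝ (Fin n) → ℝ) : Prop where
  one_lt : 1 < m
  lt_dim : m < n
  p_pos : 0 < p
  nonneg : ∀ x ∈ closedHalf n, 0 ≤ u x
  contDiffOn : ContDiffOn ℝ 2 u (closedHalf n)
  eq : ∀ x ∈ openHalf n, pLap m u x + u x ^ p = 0
  pos : ∀ x ∈ openHalf n, 0 < u x
  bc : ∀ x ∈ bdry n, ‖gradient u x‖ ^ (m - 2) * pdn u x = -(u x ^ q)

theorem continuous_lastC : Continuous (lastC : EuclideanSpace ℝ (Fin n) → ℝ) := by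
  unfold lastC
  split_ifs with h
  · fun_prop
  · fun_prop

theorem isOpen_openHalf : IsOpen (openHalf n) := isOpen_lt continuous_const continuous_lastC

theorem isClosed_closedHalf : IsClosed (closedHalf n) :=
  isClosed_le continuous_const continuous_lastC

theorem openHalf_subset : openHalf n ⊆ closedHalf n :=
  fun x hx => (show 0 < lastC x from hx).le

theorem mem_openHalf_or_bdry {x : EuclideanSpace ℝ (Fin n)} (hx : x ∈ closedHalf n) :
    x ∈ openHalf n ∨ x ∈ bdry n := by
  rcases (show 0 ≤ lastC x from hx).lt_or_eq with h | h
  · exact Or.inl h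
  · exact Or.inr h.symm

theorem closedHalf_mem_nhds {x : EuclideanSpace ℝ (Fin n)} (hx : x ∈ openHalf n) :
    closedHalf n ∈ 𝓝 x := mem_of_superset (isOpen_openHalf.mem_nhds hx) openHalf_subset

/-- The unit normal pointing into the half-space. -/
def eN (n : ℕ) : EuclideanSpace ℝ (Fin n) :=
  if h : 0 < n then EuclideanSpace.single ⟨n - 1, Nat.sub_lt h Nat.one_pos⟩ 1 else 0

theorem lastC_eq_inner (x : EuclideanSpace ℝ (Fin n)) : lastC x = ⟪x, eN n⟫ := by
  unfold lastC eN
  split_ifs with h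
  · rw [EuclideanSpace.inner_single_right]; simp
  · simp

theorem pdn_eq (f : EuclideanSpace ℝ (Fin n) → ℝ) (x : EuclideanSpace ℝ (Fin n)) :
    pdn f x = fderiv ℝ f x (eN n) := by
  unfold pdn eN pd
  split_ifs with h
  · rfl
  · simp

theorem norm_eN (hn : 0 < n) : ‖eN n‖ = 1 := by simp [eN, hn]

theorem lastC_add_smul (x y : EuclideanSpace ℝ (Fin n)) (s : ℝ) :
    lastC (x + s • y) = lastC x + s * lastC y := by
  simp [lastC_eq_inner, inner_add_left, inner_smul_left]

theorem lastC_sub (x y : EuclideanSpace ℝ (Fin n)) : lastC (x - y) = lastC x - lastC y := by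
  simp [lastC_eq_inner, inner_sub_left]

theorem lastC_eN (hn : 0 < n) : lastC (eN n) = 1 := by
  rw [lastC_eq_inner, real_inner_self_eq_norm_sq, norm_eN hn]; norm_num

theorem abs_lastC_le (hn : 0 < n) (x : EuclideanSpace ℝ (Fin n)) : |lastC x| ≤ ‖x‖ := by
  rw [lastC_eq_inner]
  simpa [norm_eN hn] using abs_real_inner_le_norm x (eN n)

namespace HalfSol

variable {m p q : ℝ} {u : EuclideanSpace ℝ (Fin n) → ℝ}

theorem dim_pos (hu : HalfSol n m p q u) : 0 < n := by
  have h1 := hu.one_lt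
  have h2 := hu.lt_dim
  have : (0:ℝ) < n := by linarith
  exact_mod_cast this

theorem contDiffAt (hu : HalfSol n m p q u) {x : EuclideanSpace ℝ (Fin n)} (hx : x ∈ openHalf n) :
    ContDiffAt ℝ 2 u x := hu.contDiffOn.contDiffAt (closedHalf_mem_nhds hx)

theorem mEq (hu : HalfSol n m p q u) {x : EuclideanSpace ℝ (Fin n)} (hx : x ∈ openHalf n) :
    MEq m u x (u x ^ p) := by
  refine ⟨hu.contDiffAt hx, fun hg => ?_⟩
  have h1 := hu.eq x hx
  rw [pLap_eq (hu.contDiffAt hx) hg] at h1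
  have hn : 0 < ‖gradient u x‖ := norm_pos_iff.2 hg
  have h2 : ‖gradient u x‖ ^ (2 - m) * ‖gradient u x‖ ^ (m - 2) = 1 := by
    rw [← Real.rpow_add hn]; norm_num
  set Z := ∑ i, hess u x (EuclideanSpace.single i 1) (EuclideanSpace.single i 1)
      + (m - 2) / ‖gradient u x‖ ^ 2 * hess u x (gradient u x) (gradient u x)
  linear_combination ‖gradient u x‖ ^ (2 - m) * h1 - Z * h2

/-- Noncritical points are dense. -/
theorem exists_gradient_ne_zero (hu : HalfSol n m p q u) {x : EuclideanSpace ℝ (Fin n)}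
    (hx : x ∈ openHalf n) {ε : ℝ} (hε : 0 < ε) :
    ∃ z ∈ openHalf n, dist z x < ε ∧ gradient u z ≠ 0 := by
  by_contra! hcon
  have hev : ∀ᶠ y in 𝓝 x, gradient u y = 0 := by
    filter_upwards [isOpen_openHalf.mem_nhds hx, Metric.ball_mem_nhds x hε] with y h1 h2
    exact hcon y h1 h2
  have hz : pLap m u x = 0 := by
    unfold pLap Xmat pd
    refine Finset.sum_eq_zero fun i _ => ?_
    have : (fun y => fieldX m u y i) =ᶠ[𝓝 x] fun _ => (0:ℝ) := by
      filter_upwards [hev] with y hy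
      simp [fieldX, hy]
    rw [this.fderiv_eq]; simp
  have h1 := hu.eq x hx
  have h2 : 0 < u x ^ p := Real.rpow_pos_of_pos (hu.pos x hx) p
  linarith

/-- At boundary points where `u` is positive it is differentiable with negative normal
derivative. -/
theorem differentiableAt_bdry (hu : HalfSol n m p q u) {x : EuclideanSpace ℝ (Fin n)}
    (hx : x ∈ bdry n) (hux : 0 < u x) :
    DifferentiableAt ℝ u x ∧ fderiv ℝ u x (eN n) < 0 := by
  have h1 := hu.bc x hx
  have h2 : 0 < u x ^ q := Real.rpow_pos_of_pos hux q
  rw [pdn_eq] at h1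
  have hneg : fderiv ℝ u x (eN n) < 0 := by
    by_contra! h3
    have : 0 ≤ ‖gradient u x‖ ^ (m - 2) * fderiv ℝ u x (eN n) := by positivity
    linarith
  refine ⟨?_, hneg⟩
  by_contra hd
  rw [fderiv_zero_of_not_differentiableAt hd] at hneg
  simp at hneg

end HalfSol

/-- A function with negative derivative at `0` is not minimal from the right at `0`. -/
theorem not_eventually_ge_of_hasDerivAt_neg {f : ℝ → ℝ} {d : ℝ} (hf : HasDerivAt f d 0)
    (hd : d < 0) (h : ∀ᶠ s in 𝓝[>] (0:ℝ), f 0 ≤ f s) : False := by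
  have ht := hf.tendsto_slope.mono_left (nhdsGT_le_nhdsNE 0)
  refine absurd (ge_of_tendsto ht ?_) (not_le.2 hd)
  filter_upwards [h, self_mem_nhdsWithin] with s hs hs0
  have hs0 : 0 < s := hs0
  rw [slope_def_field]
  exact div_nonneg (by linarith) (by linarith)

namespace HalfSol

variable {m p q : ℝ} {u : EuclideanSpace ℝ (Fin n) → ℝ}

/-- Balls on which radial comparison is possible: either the ball does not meet the boundary, or
it is centered on the boundary and `u` is positive there. -/
def Good (u : EuclideanSpace ℝ (Fin n) → ℝ) (z : EuclideanSpace ℝ (Fin n)) (R : ℝ) : Prop :=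
  (∀ x ∈ closedHalf n, dist x z < R → x ∈ openHalf n) ∨ (z ∈ bdry n ∧ ∀ x ∈ bdry n, 0 < u x)

theorem Good.mono {z : EuclideanSpace ℝ (Fin n)} {R R' : ℝ} (h : Good u z R) (hR : R' ≤ R) :
    Good u z R' := h.imp_left fun h x hx hd => h x hx (hd.trans_le hR)

theorem Good.pos {z : EuclideanSpace ℝ (Fin n)} {R : ℝ} (hu : HalfSol n m p q u)
    (h : Good u z R) {x : EuclideanSpace ℝ (Fin n)} (hx : x ∈ closedHalf n) (hxR : dist x z < R) :
    0 < u x := by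
  rcases h with h | h
  · exact hu.pos x (h x hx hxR)
  · rcases mem_openHalf_or_bdry hx with h1 | h1
    · exact hu.pos x h1
    · exact h.2 x h1

theorem continuousOn (hu : HalfSol n m p q u) : ContinuousOn u (closedHalf n) :=
  hu.contDiffOn.continuousOn

/-- Radial comparison at a minimum relative to the closed half-space. -/
theorem min_radial (hu : HalfSol n m p q u) {z x : EuclideanSpace ℝ (Fin n)} {R : ℝ}
    (hG : Good u z R) (hx : x ∈ closedHalf n) (hxR : dist x z < R) (hxz : x ≠ z)
    {Q Q' : ℝ → ℝ} {Q2 : ℝ} (h1 : ∀ᶠ τ in 𝓝 (‖x - z‖ ^ 2), HasDerivAt Q (Q' τ) τ)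
    (h2 : HasDerivAt Q' Q2 (‖x - z‖ ^ 2)) (hQ : Q' (‖x - z‖ ^ 2) ≠ 0)
    (hmin : IsLocalMinOn (fun y => u y - Q (‖y - z‖ ^ 2)) (closedHalf n) x) :
    4 * (m - 1) * Q2 * ‖x - z‖ ^ 2 + 2 * (n + m - 2) * Q' (‖x - z‖ ^ 2)
      ≤ -(u x ^ p * (2 * |Q' (‖x - z‖ ^ 2)| * ‖x - z‖) ^ (2 - m)) := by
  rcases mem_openHalf_or_bdry hx with hxo | hxb
  · exact (hu.mEq hxo).touch hu.one_lt hxz h1 h2 hQ (hmin.isLocalMin (closedHalf_mem_nhds hxo))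
  exfalso
  rcases hG with hG | ⟨hz, hpos⟩
  · exact (show 0 < lastC x from hG x hx hxR).ne' hxb
  obtain ⟨hd, hneg⟩ := hu.differentiableAt_bdry hxb (hpos x hxb)
  have hl : HasDerivAt (fun s : ℝ => x + s • eN n) (eN n) 0 := by
    simpa using ((hasDerivAt_id (0:ℝ)).smul_const (eN n)).const_add x
  have hd1 : HasDerivAt (fun s : ℝ => u (x + s • eN n)) (fderiv ℝ u x (eN n)) 0 := by
    have : HasFDerivAt u (fderiv ℝ u x) (x + (0:ℝ) • eN n) := by simpa using hd.hasFDerivAt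
    exact this.comp_hasDerivAt (0:ℝ) hl
  obtain ⟨P', hP0, hP1, -⟩ := hasJet_normSq (x - z) (eN n) h1 h2
  have hP := hP1.self_of_nhds
  have hw : ⟪x - z, eN n⟫ = 0 := by
    rw [← lastC_eq_inner, lastC_sub, show lastC x = 0 from hxb, show lastC z = 0 from hz, sub_zero]
  rw [hP0, hw, mul_zero] at hP
  have hf := hd1.sub hP
  refine not_eventually_ge_of_hasDerivAt_neg hf (by linarith) ?_
  have ht : Tendsto (fun s : ℝ => x + s • eN n) (𝓝[>] 0) (𝓝[closedHalf n] x) := by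
    refine tendsto_nhdsWithin_iff.2 ⟨?_, ?_⟩
    · have : Tendsto (fun s : ℝ => x + s • eN n) (𝓝 0) (𝓝 x) := by
        simpa using hl.continuousAt.tendsto
      exact this.mono_left nhdsWithin_le_nhds
    · filter_upwards [self_mem_nhdsWithin] with s hs
      have hs : 0 < s := hs
      change 0 ≤ lastC (x + s • eN n)
      rw [lastC_add_smul, lastC_eN hu.dim_pos, show lastC x = 0 from hxb]; linarith
  filter_upwards [ht.eventually hmin] with s hs
  simp only [Pi.sub_apply, zero_smul, add_zero]
  rwa [show x - z + s • eN n = x + s • eN n - z by abel]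

/-- The exponent of the fundamental solution. -/
def gam (n : ℕ) (m : ℝ) : ℝ := (n - m) / (m - 1)

theorem gam_pos (hu : HalfSol n m p q u) : 0 < gam n m :=
  div_pos (by linarith [hu.lt_dim]) (by linarith [hu.one_lt])

/-- Lower barrier built from the fundamental solution. -/
theorem lower_barrier (hu : HalfSol n m p q u) {z : EuclideanSpace ℝ (Fin n)} {R ρ a : ℝ}
    (hG : Good u z R) (hρ : 0 < ρ) (hρR : ρ < R) (ha : 0 < a)
    (hin : ∀ x ∈ closedHalf n, dist x z = ρ → a ≤ u x) {x : EuclideanSpace ℝ (Fin n)}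
    (hx : x ∈ closedHalf n) (hx1 : ρ ≤ dist x z) (hx2 : dist x z ≤ R) :
    a * ((dist x z ^ (-gam n m) - R ^ (-gam n m)) / (ρ ^ (-gam n m) - R ^ (-gam n m))) ≤ u x := by
  set γ := gam n m with hγ
  have hγ0 : 0 < γ := hu.gam_pos
  have hm := hu.one_lt
  have hγm : γ * (m - 1) = n - m := by rw [hγ, gam]; field_simp [(by linarith : m - 1 ≠ 0)]
  have hR : 0 < R := hρ.trans hρR
  have hden : 0 < ρ ^ (-γ) - R ^ (-γ) :=
    sub_pos.2 (Real.rpow_lt_rpow_of_neg hρ hρR (by linarith))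
  set A := a / (ρ ^ (-γ) - R ^ (-γ)) with hA
  have hA0 : 0 < A := by positivity
  set Q : ℝ → ℝ := fun τ => A * τ ^ (-γ / 2) - A * R ^ (-γ) with hQ
  have hQr : ∀ r : ℝ, 0 ≤ r → Q (r ^ 2) = A * r ^ (-γ) - A * R ^ (-γ) := by
    intro r hr
    simp only [hQ]
    rw [← Real.rpow_natCast, ← Real.rpow_mul hr]
    congr 3; push_cast; ring
  have hrw : a * ((dist x z ^ (-γ) - R ^ (-γ)) / (ρ ^ (-γ) - R ^ (-γ))) = Q (‖x - z‖ ^ 2) := by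
    rw [hQr _ (norm_nonneg _), ← dist_eq_norm, hA]; ring
  rw [hrw]
  set T := closedHalf n ∩ ({y | ρ ≤ dist y z} ∩ {y | dist y z ≤ R}) with hT
  have hTc : IsCompact T := by
    apply Metric.isCompact_of_isClosed_isBounded
    · exact isClosed_closedHalf.inter ((isClosed_le (g := fun y => dist y z)
        continuous_const (by fun_prop)).inter
        (isClosed_le (f := fun y => dist y z) (by fun_prop) continuous_const))
    · exact Metric.isBounded_closedBall (x := z) (r := R) |>.subset fun y hy => hy.2.2
  have hcont : ContinuousOn (fun y => u y - Q (‖y - z‖ ^ 2)) T := by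
    apply (hu.continuousOn.mono fun y hy => hy.1).sub
    intro y hy
    have hy0 : ‖y - z‖ ^ 2 ≠ 0 := by
      have h : ρ ≤ dist y z := hy.2.1
      rw [dist_eq_norm] at h
      exact (pow_pos (hρ.trans_le h) 2).ne'
    have : ContinuousAt Q (‖y - z‖ ^ 2) :=
      ((Real.continuousAt_rpow_const _ _ (Or.inl hy0)).const_mul A).sub continuousAt_const
    exact (ContinuousAt.comp (f := fun y => ‖y - z‖ ^ 2) this (by fun_prop)).continuousWithinAt
  obtain ⟨y, hy, hmin⟩ := hTc.exists_isMinOn ⟨x, hx, hx1, hx2⟩ hcont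
  have hyx : u y - Q (‖y - z‖ ^ 2) ≤ u x - Q (‖x - z‖ ^ 2) :=
    hmin (show x ∈ T from ⟨hx, hx1, hx2⟩)
  have hyρ : ρ ≤ dist y z := hy.2.1
  have hyR : dist y z ≤ R := hy.2.2
  by_contra! hlt
  have hneg : u y - Q (‖y - z‖ ^ 2) < 0 := by linarith
  have hy1 : ρ < dist y z := by
    rcases hyρ.lt_or_eq with h | h
    · exact h
    · exfalso
      have h1 := hin y hy.1 h.symm
      rw [hQr _ (norm_nonneg _), ← dist_eq_norm, ← h, ← mul_sub, hA,
        div_mul_cancel₀ _ hden.ne'] at hneg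
      linarith
  have hy2 : dist y z < R := by
    rcases hyR.lt_or_eq with h | h
    · exact h
    · exfalso
      rw [hQr _ (norm_nonneg _), ← dist_eq_norm, h] at hneg
      linarith [hu.nonneg y hy.1]
  have hloc : IsLocalMinOn (fun y => u y - Q (‖y - z‖ ^ 2)) (closedHalf n) y := by
    have ho : IsOpen ({w : EuclideanSpace ℝ (Fin n) | ρ < dist w z} ∩ {w | dist w z < R}) :=
      (isOpen_lt (g := fun y => dist y z) continuous_const (by fun_prop)).inter
        (isOpen_lt (f := fun y => dist y z) (by fun_prop) continuous_const)
    filter_upwards [mem_nhdsWithin_of_mem_nhds (ho.mem_nhds ⟨hy1, hy2⟩), self_mem_nhdsWithin]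
      with w hw hwc
    exact hmin ⟨hwc, (show ρ < dist w z from hw.1).le, (show dist w z < R from hw.2).le⟩
  have hr0 : 0 < ‖y - z‖ := by rw [← dist_eq_norm]; linarith
  have hyz : y ≠ z := by rintro rfl; simp at hr0
  set τ := ‖y - z‖ ^ 2 with hτ
  have hτ0 : 0 < τ := by positivity
  have hdQ : ∀ t : ℝ, 0 < t → HasDerivAt Q (A * (-γ / 2 * t ^ (-γ / 2 - 1))) t := fun t ht =>
    ((Real.hasDerivAt_rpow_const (Or.inl ht.ne')).const_mul A).sub_const _
  have hdQ' : HasDerivAt (fun t : ℝ => A * (-γ / 2 * t ^ (-γ / 2 - 1)))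
      (A * (-γ / 2 * ((-γ / 2 - 1) * τ ^ (-γ / 2 - 1 - 1)))) τ :=
    ((Real.hasDerivAt_rpow_const (Or.inl hτ0.ne')).const_mul _).const_mul A
  have hne : A * (-γ / 2 * τ ^ (-γ / 2 - 1)) < 0 := by
    have : 0 < A * (γ / 2 * τ ^ (-γ / 2 - 1)) := by positivity
    have h2 : A * (-γ / 2 * τ ^ (-γ / 2 - 1)) = -(A * (γ / 2 * τ ^ (-γ / 2 - 1))) := by ring
    linarith
  have key := hu.min_radial hG hy.1 hy2 hyz (Q := Q)
    (by filter_upwards [lt_mem_nhds hτ0] with t ht using hdQ t ht) hdQ' hne.ne hloc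
  have hpos : 0 < u y ^ p * (2 * |A * (-γ / 2 * τ ^ (-γ / 2 - 1))| * ‖y - z‖) ^ (2 - m) := by
    have h1 := Real.rpow_pos_of_pos (Good.pos hu hG hy.1 hy2) p
    have h2 := abs_pos.2 hne.ne
    positivity
  have hzero : 4 * (m - 1) * (A * (-γ / 2 * ((-γ / 2 - 1) * τ ^ (-γ / 2 - 1 - 1)))) * ‖y - z‖ ^ 2
      + 2 * (n + m - 2) * (A * (-γ / 2 * τ ^ (-γ / 2 - 1))) = 0 := by
    rw [← hτ, Real.rpow_sub_one hτ0.ne' (-γ / 2 - 1)]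
    have hdiv : τ ^ (-γ / 2 - 1) / τ * τ = τ ^ (-γ / 2 - 1) := div_mul_cancel₀ _ hτ0.ne'
    clear_value A
    linear_combination A * γ * τ ^ (-γ / 2 - 1) * hγm
      + 4 * (m - 1) * A * (-γ / 2) * (-γ / 2 - 1) * hdiv
  rw [← hτ] at key hzero
  linarith

end HalfSol

namespace HalfSol

variable {m p q : ℝ} {u : EuclideanSpace ℝ (Fin n) → ℝ}

/-- The constant in the spreading of lower bounds. -/
theorem one_sub_two_rpow_pos (hu : HalfSol n m p q u) : 0 < 1 - (2:ℝ) ^ (-gam n m) := by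
  have := Real.rpow_lt_one_of_one_lt_of_neg (x := 2) (z := -gam n m) (by norm_num)
    (by linarith [hu.gam_pos])
  linarith

/-- A lower bound on a ball spreads to larger balls with a power loss. -/
theorem lower_bound_spread (hu : HalfSol n m p q u) {z : EuclideanSpace ℝ (Fin n)} {r ρ a : ℝ}
    (hG : Good u z (2 * r)) (hρ : 0 < ρ) (hρr : ρ ≤ r) (ha : 0 < a)
    (hin : ∀ x ∈ closedHalf n, dist x z ≤ ρ → a ≤ u x) {x : EuclideanSpace ℝ (Fin n)}
    (hx : x ∈ closedHalf n) (hxr : dist x z ≤ r) :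
    (1 - (2:ℝ) ^ (-gam n m)) * a * (ρ / r) ^ gam n m ≤ u x := by
  have hγ := hu.gam_pos
  have hc := hu.one_sub_two_rpow_pos
  have hr : 0 < r := hρ.trans_le hρr
  have hq1 : (ρ / r) ^ gam n m ≤ 1 :=
    Real.rpow_le_one (by positivity) ((div_le_one hr).2 hρr) hγ.le
  have h2 : 0 < (2:ℝ) ^ (-gam n m) := by positivity
  by_cases hxρ : dist x z ≤ ρ
  · refine le_trans ?_ (hin x hx hxρ)
    calc _ ≤ 1 * a * 1 := by gcongr; linarith
      _ = a := by ring
  push Not at hxρ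
  have hb := hu.lower_barrier hG hρ (by linarith) ha (fun y hy h => hin y hy h.le) hx hxρ.le
    (by linarith)
  refine le_trans ?_ hb
  rw [mul_comm _ a, mul_assoc]
  refine mul_le_mul_of_nonneg_left ?_ ha.le
  have hden : 0 < ρ ^ (-gam n m) - (2 * r) ^ (-gam n m) :=
    sub_pos.2 (Real.rpow_lt_rpow_of_neg hρ (by linarith) (by linarith))
  have h2r : (2 * r) ^ (-gam n m) = 2 ^ (-gam n m) * r ^ (-gam n m) :=
    Real.mul_rpow (by norm_num) hr.le
  have hx0 : 0 < dist x z := hρ.trans hxρ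
  have hdr : r ^ (-gam n m) ≤ dist x z ^ (-gam n m) :=
    Real.rpow_le_rpow_of_nonpos hx0 hxr (by linarith)
  have hratio : (ρ / r) ^ gam n m * ρ ^ (-gam n m) = r ^ (-gam n m) := by
    rw [Real.div_rpow hρ.le hr.le, Real.rpow_neg hρ.le, Real.rpow_neg hr.le]
    have := (Real.rpow_pos_of_pos hρ (gam n m)).ne'
    field_simp
  have hr2 : 0 < (2 * r) ^ (-gam n m) := by positivity
  rw [le_div_iff₀ hden]
  calc (1 - (2:ℝ) ^ (-gam n m)) * (ρ / r) ^ gam n m * (ρ ^ (-gam n m) - (2 * r) ^ (-gam n m))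
      ≤ (1 - (2:ℝ) ^ (-gam n m)) * (ρ / r) ^ gam n m * ρ ^ (-gam n m) := by
        refine mul_le_mul_of_nonneg_left (by linarith) (by positivity)
    _ = (1 - (2:ℝ) ^ (-gam n m)) * r ^ (-gam n m) := by rw [mul_assoc, hratio]
    _ = r ^ (-gam n m) - (2 * r) ^ (-gam n m) := by rw [h2r]; ring
    _ ≤ _ := by linarith

/-- Points at which `u` strictly decreases in some direction pointing into the half-space. -/
def Descends (u : EuclideanSpace ℝ (Fin n) → ℝ) (z : EuclideanSpace ℝ (Fin n)) : Prop :=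
  DifferentiableAt ℝ u z ∧ ∃ ξ, fderiv ℝ u z ξ < 0 ∧ ∀ᶠ s in 𝓝[>] (0:ℝ), z + s • ξ ∈ closedHalf n

theorem descends_of_gradient_ne_zero (hu : HalfSol n m p q u) {z : EuclideanSpace ℝ (Fin n)}
    (hz : z ∈ openHalf n) (hg : gradient u z ≠ 0) : Descends u z := by
  refine ⟨(hu.contDiffAt hz).differentiableAt (by norm_num), -gradient u z, ?_, ?_⟩
  · rw [fderiv_eq_inner_gradient, inner_neg_right, real_inner_self_eq_norm_sq]
    have := norm_pos_iff.2 hg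
    have : 0 < ‖gradient u z‖ ^ 2 := by positivity
    linarith
  · have ht : Tendsto (fun s : ℝ => z + s • -gradient u z) (𝓝 0) (𝓝 z) := by
      have : ContinuousAt (fun s : ℝ => z + s • -gradient u z) 0 := by fun_prop
      simpa [ContinuousAt] using this
    exact (ht.mono_left nhdsWithin_le_nhds).eventually (closedHalf_mem_nhds hz)

theorem descends_of_mem_bdry (hu : HalfSol n m p q u) {z : EuclideanSpace ℝ (Fin n)}
    (hz : z ∈ bdry n) (hz0 : 0 < u z) : Descends u z := by
  obtain ⟨h1, h2⟩ := hu.differentiableAt_bdry hz hz0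
  refine ⟨h1, eN n, h2, ?_⟩
  filter_upwards [self_mem_nhdsWithin] with s hs
  have hs : 0 < s := hs
  change 0 ≤ lastC (z + s • eN n)
  rw [lastC_add_smul, lastC_eN hu.dim_pos, show lastC z = 0 from hz]; linarith

/-- A point of strict descent does not minimize `u y + A ‖y - z‖ ^ μ` when `1 < μ`. -/
theorem Descends.not_isMin {z : EuclideanSpace ℝ (Fin n)} (h : Descends u z) {A μ : ℝ}
    (hμ : 1 < μ) (hmin : ∀ᶠ y in 𝓝[closedHalf n] z, u z ≤ u y + A * ‖y - z‖ ^ μ) : False := by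
  obtain ⟨hd, ξ, hneg, hin⟩ := h
  have hl : HasDerivAt (fun s : ℝ => z + s • ξ) ξ 0 := by
    simpa using ((hasDerivAt_id (0:ℝ)).smul_const ξ).const_add z
  have hd1 : HasDerivAt (fun s : ℝ => u (z + s • ξ)) (fderiv ℝ u z ξ) 0 := by
    have : HasFDerivAt u (fderiv ℝ u z) (z + (0:ℝ) • ξ) := by simpa using hd.hasFDerivAt
    exact this.comp_hasDerivAt (0:ℝ) hl
  have hd2 := (Real.hasDerivAt_rpow_const (x := (0:ℝ)) (p := μ) (Or.inr hμ.le)).const_mul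
    (A * ‖ξ‖ ^ μ)
  refine not_eventually_ge_of_hasDerivAt_neg (hd1.fun_add hd2) ?_ ?_
  · rw [Real.zero_rpow (by linarith)]; linarith
  · have ht : Tendsto (fun s : ℝ => z + s • ξ) (𝓝[>] 0) (𝓝[closedHalf n] z) := by
      refine tendsto_nhdsWithin_iff.2 ⟨?_, hin⟩
      have : Tendsto (fun s : ℝ => z + s • ξ) (𝓝 0) (𝓝 z) := by
        simpa using hl.continuousAt.tendsto
      exact this.mono_left nhdsWithin_le_nhds
    filter_upwards [ht.eventually hmin, self_mem_nhdsWithin] with s hs hs0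
    have hs0 : 0 < s := hs0
    rw [add_sub_cancel_left, norm_smul, Real.norm_of_nonneg hs0.le,
      Real.mul_rpow hs0.le (norm_nonneg _)] at hs
    simp only [zero_smul, add_zero, Real.zero_rpow (by linarith : μ ≠ 0), mul_zero]
    linarith

/-- At a radial minimum with profile `a - A r ^ (m / (m - 1))`, the source term is bounded. -/
theorem rpow_le_of_radial_min (hu : HalfSol n m p q u) {z x : EuclideanSpace ℝ (Fin n)} {R a A : ℝ}
    (hG : Good u z R) (hx : x ∈ closedHalf n) (hxR : dist x z < R) (hxz : x ≠ z) (hA : 0 < A)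
    (hmin : IsLocalMinOn (fun y => u y - (a - A * ‖y - z‖ ^ (m / (m - 1)))) (closedHalf n) x) :
    u x ^ p ≤ n * (A * (m / (m - 1))) ^ (m - 1) := by
  have hm := hu.one_lt
  have hm0 : m - 1 ≠ 0 := by linarith
  obtain ⟨β, hβ⟩ : ∃ β : ℝ, β = m / (m - 1) / 2 := ⟨_, rfl⟩
  have hβm : β * (m - 1) = m / 2 := by rw [hβ]; field_simp
  have hβ0 : 0 < β := by
    rw [hβ]; exact div_pos (div_pos (by linarith) (by linarith)) (by norm_num)
  have hmm : m / (m - 1) = 2 * β := by rw [hβ]; ring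
  rw [hmm] at hmin ⊢
  obtain ⟨r, hr⟩ : ∃ r : ℝ, r = ‖x - z‖ := ⟨_, rfl⟩
  have hr0 : 0 < r := by rw [hr]; exact norm_pos_iff.2 (sub_ne_zero.2 hxz)
  have hτ0 : 0 < r ^ 2 := by positivity
  have hdQ : ∀ t : ℝ, 0 < t →
      HasDerivAt (fun t => a - A * t ^ β) (-(A * (β * t ^ (β - 1)))) t := fun t ht =>
    ((Real.hasDerivAt_rpow_const (Or.inl ht.ne')).const_mul A).const_sub _
  have hdQ' : HasDerivAt (fun t : ℝ => -(A * (β * t ^ (β - 1))))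
      (-(A * (β * ((β - 1) * (r ^ 2) ^ (β - 1 - 1))))) (r ^ 2) :=
    (((Real.hasDerivAt_rpow_const (Or.inl hτ0.ne')).const_mul _).const_mul A).fun_neg
  have hne : 0 < A * (β * (r ^ 2) ^ (β - 1)) := by positivity
  have hfun : ∀ y : EuclideanSpace ℝ (Fin n), ‖y - z‖ ^ (2 * β) = (‖y - z‖ ^ 2) ^ β := by
    intro y
    rw [Real.rpow_mul (norm_nonneg _)]; norm_num
  simp_rw [hfun] at hmin
  rw [hr] at hdQ' hne hτ0
  have key := hu.min_radial hG hx hxR hxz (Q := fun t => a - A * t ^ β)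
    (by filter_upwards [lt_mem_nhds hτ0] with t ht using hdQ t ht) hdQ' (neg_ne_zero.2 hne.ne') hmin
  rw [← hr] at key hτ0 hne
  rw [abs_neg, abs_of_pos hne, Real.rpow_sub_one hτ0.ne' (β - 1)] at key
  have hdiv : (r ^ 2) ^ (β - 1) / r ^ 2 * r ^ 2 = (r ^ 2) ^ (β - 1) := div_mul_cancel₀ _ hτ0.ne'
  have hr2 : (r ^ 2) ^ (β - 1) = r ^ (2 * β - 1) / r := by
    rw [← Real.rpow_sub_one hr0.ne', ← Real.rpow_natCast, ← Real.rpow_mul hr0.le]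
    congr 1; push_cast; ring
  have hlhs : 4 * (m - 1) * -(A * (β * ((β - 1) * ((r ^ 2) ^ (β - 1) / r ^ 2)))) * r ^ 2
      + 2 * (n + m - 2) * -(A * (β * (r ^ 2) ^ (β - 1)))
      = -(n * (A * (2 * β) * (r ^ 2) ^ (β - 1))) := by
    linear_combination -(4 * (m - 1) * A * β * (β - 1)) * hdiv
      - 4 * A * β * (r ^ 2) ^ (β - 1) * hβm
  rw [hlhs, hr2] at key
  obtain ⟨E, hE⟩ : ∃ E : ℝ, E = A * (2 * β) * r ^ (2 * β - 1) := ⟨_, rfl⟩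
  have hE0 : 0 < E := by rw [hE]; positivity
  have hE1 : 2 * (A * (β * (r ^ (2 * β - 1) / r))) * r = E := by rw [hE]; field_simp
  have hE2 : A * (2 * β) * (r ^ (2 * β - 1) / r) = E / r := by rw [hE]; ring
  rw [hE1, hE2] at key
  have hpow : E ^ (2 - m) * E ^ (m - 1) = E := by
    rw [← Real.rpow_add hE0]; norm_num
  have hpow2 : E ^ (m - 1) = (A * (2 * β)) ^ (m - 1) * r := by
    rw [hE, Real.mul_rpow (by positivity) (by positivity), ← Real.rpow_mul hr0.le]
    congr 1
    rw [show (2 * β - 1) * (m - 1) = 1 by linear_combination 2 * hβm, Real.rpow_one]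
  have hE3 : 0 < E ^ (2 - m) := by positivity
  have h1 : u x ^ p * E ^ (2 - m) ≤ (n * (A * (2 * β)) ^ (m - 1)) * E ^ (2 - m) := by
    have : (n * (A * (2 * β)) ^ (m - 1)) * E ^ (2 - m) = n * (E / r) := by
      rw [eq_comm, mul_div_assoc', div_eq_iff hr0.ne']
      calc (n:ℝ) * E = n * (E ^ (2 - m) * E ^ (m - 1)) := by rw [hpow]
        _ = _ := by rw [hpow2]; ring
    rw [this]; linarith
  exact le_of_mul_le_mul_right h1 hE3

/-- The minimum of a solution over a ball is controlled by the radius. -/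
theorem exists_min_bound (hu : HalfSol n m p q u) : ∃ C > 0, ∀ (z : EuclideanSpace ℝ (Fin n))
    (ρ b : ℝ), 0 < ρ → 0 < b → Good u z (2 * ρ) → z ∈ closedHalf n → Descends u z →
    (∀ x ∈ closedHalf n, dist x z ≤ ρ / 2 → b ≤ u x) →
    (∃ x ∈ closedHalf n, dist x z ≤ ρ / 2 ∧ u x ≤ b) → b ^ p * ρ ^ m ≤ C * b ^ (m - 1) := by
  have hm := hu.one_lt
  obtain ⟨μ, hμ⟩ : ∃ μ : ℝ, μ = m / (m - 1) := ⟨_, rfl⟩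
  have hμ1 : 1 < μ := by rw [hμ, lt_div_iff₀ (by linarith)]; linarith
  have hμm : μ * (m - 1) = m := by rw [hμ]; field_simp [(by linarith : m - 1 ≠ 0)]
  obtain ⟨k, hk⟩ : ∃ k : ℝ, k = 1 - (2:ℝ) ^ (-μ) := ⟨_, rfl⟩
  have hk0 : 0 < k := by
    have := Real.rpow_lt_one_of_one_lt_of_neg (x := 2) (z := -μ) (by norm_num) (by linarith)
    linarith
  obtain ⟨c, hc⟩ : ∃ c : ℝ, c = (1 - (2:ℝ) ^ (-gam n m)) * (1 / 2) ^ gam n m := ⟨_, rfl⟩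
  have hc0 : 0 < c := by
    rw [hc]; exact mul_pos hu.one_sub_two_rpow_pos (by positivity)
  have hn : (0:ℝ) < n := by exact_mod_cast hu.dim_pos
  refine ⟨n * (μ / k) ^ (m - 1) / c ^ p, by positivity, ?_⟩
  intro z ρ b hρ hb hG hz hdesc hlow ⟨x1, hx1, hx1ρ, hx1b⟩
  obtain ⟨A, hA⟩ : ∃ A : ℝ, A = b / k * ρ ^ (-μ) := ⟨_, rfl⟩
  have hA0 : 0 < A := by rw [hA]; positivity
  have hAρ : A * ρ ^ μ = b / k := by
    rw [hA, mul_assoc, ← Real.rpow_add hρ]; simp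
  obtain ⟨φ, hφ⟩ : ∃ φ : EuclideanSpace ℝ (Fin n) → ℝ,
    φ = fun y => u y - (b / k - A * ‖y - z‖ ^ μ) := ⟨_, rfl⟩
  have hTc : IsCompact (closedHalf n ∩ Metric.closedBall z ρ) :=
    (isCompact_closedBall z ρ).inter_left isClosed_closedHalf
  have hcont : ContinuousOn φ (closedHalf n ∩ Metric.closedBall z ρ) := by
    rw [hφ]
    refine (hu.continuousOn.mono Set.inter_subset_left).sub (Continuous.continuousOn ?_)
    have : Continuous fun y : EuclideanSpace ℝ (Fin n) => ‖y - z‖ ^ μ :=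
      (by fun_prop : Continuous fun y : EuclideanSpace ℝ (Fin n) => ‖y - z‖).rpow_const
        fun _ => Or.inr (by linarith)
    fun_prop
  have hx1mem : x1 ∈ closedHalf n ∩ Metric.closedBall z ρ :=
    ⟨hx1, Metric.mem_closedBall.2 (by linarith)⟩
  obtain ⟨y, hy, hmin⟩ := hTc.exists_isMinOn ⟨x1, hx1mem⟩ hcont
  have hyρ : dist y z ≤ ρ := hy.2
  have hφ1 : φ x1 ≤ 0 := by
    have h1 : ‖x1 - z‖ ^ μ ≤ (ρ / 2) ^ μ :=
      Real.rpow_le_rpow (norm_nonneg _) (by rwa [← dist_eq_norm]) (by linarith)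
    have h2 : A * (ρ / 2) ^ μ = b / k * 2 ^ (-μ) := by
      rw [Real.div_rpow hρ.le (by norm_num), Real.rpow_neg (by norm_num), ← hAρ]; ring
    have h3 : b / k * 2 ^ (-μ) = b / k - b := by
      rw [show (2:ℝ) ^ (-μ) = 1 - k by rw [hk]; ring]; field_simp
    have h4 := mul_le_mul_of_nonneg_left h1 hA0.le
    rw [hφ]; simp only; linarith
  have hyx1 : φ y ≤ 0 := (hmin hx1mem : φ y ≤ φ x1).trans hφ1
  have hyρ' : dist y z < ρ := by
    rcases hyρ.lt_or_eq with h | h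
    · exact h
    · exfalso
      have hp := Good.pos hu hG hy.1 (by linarith)
      rw [hφ] at hyx1
      simp only at hyx1
      rw [← dist_eq_norm, h, hAρ] at hyx1
      linarith
  have hloc : IsLocalMinOn φ (closedHalf n) y := by
    filter_upwards [mem_nhdsWithin_of_mem_nhds (Metric.isOpen_ball.mem_nhds
      (Metric.mem_ball.2 hyρ')), self_mem_nhdsWithin] with w hw hwc
    exact hmin ⟨hwc, Metric.ball_subset_closedBall hw⟩
  have hyz : y ≠ z := by
    rintro rfl
    refine hdesc.not_isMin (A := A) hμ1 ?_
    filter_upwards [hloc] with w hw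
    rw [hφ] at hw
    simp only [sub_self, norm_zero, Real.zero_rpow (by linarith : μ ≠ 0), mul_zero] at hw
    linarith
  rw [hφ, hμ] at hloc
  have h1 := hu.rpow_le_of_radial_min hG hy.1 (by linarith) hyz hA0 hloc
  rw [← hμ] at h1
  have h2 := hu.lower_bound_spread hG (by linarith : 0 < ρ / 2) (by linarith) hb hlow hy.1 hyρ
  rw [show ρ / 2 / ρ = 1 / 2 by field_simp,
    show (1 - (2:ℝ) ^ (-gam n m)) * b * (1 / 2) ^ gam n m = c * b by rw [hc]; ring] at h2
  have h3 : (c * b) ^ p ≤ u y ^ p := Real.rpow_le_rpow (by positivity) h2 hu.p_pos.le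
  rw [Real.mul_rpow hc0.le hb.le] at h3
  have h4 : (A * μ) ^ (m - 1) * ρ ^ m = (μ / k) ^ (m - 1) * b ^ (m - 1) := by
    have hρm : ρ ^ m = (ρ ^ μ) ^ (m - 1) := by rw [← Real.rpow_mul hρ.le, hμm]
    rw [← Real.mul_rpow (by positivity) hb.le, hρm,
      ← Real.mul_rpow (by positivity) (by positivity)]
    congr 1
    rw [mul_assoc, mul_comm μ, ← mul_assoc, hAρ]; ring
  have hcp : 0 < c ^ p := by positivity
  rw [div_mul_eq_mul_div, le_div_iff₀ hcp]
  calc b ^ p * ρ ^ m * c ^ p = c ^ p * b ^ p * ρ ^ m := by ring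
    _ ≤ n * (A * μ) ^ (m - 1) * ρ ^ m := by
      refine mul_le_mul_of_nonneg_right (h3.trans h1) (by positivity)
    _ = n * (μ / k) ^ (m - 1) * b ^ (m - 1) := by rw [mul_assoc, h4]; ring

end HalfSol

/-- A positive power of a real variable is unbounded. -/
theorem false_of_rpow_le {e K t0 : ℝ} (he : 0 < e) (h : ∀ t ≥ t0, t ^ e ≤ K) : False := by
  obtain ⟨t, h1, h2⟩ := (((tendsto_rpow_atTop he).eventually_gt_atTop K).and
    (eventually_ge_atTop t0)).exists
  exact absurd (h t h2) (not_le.2 h1)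

theorem one_add_mul_le_rpow_neg {γ w : ℝ} (hγ : 0 < γ) (hw : w < 1) :
    1 + γ * w ≤ (1 - w) ^ (-γ) := by
  rw [Real.rpow_def_of_pos (by linarith)]
  have h1 := Real.log_le_sub_one_of_pos (by linarith : 0 < 1 - w)
  have h2 : γ * w ≤ Real.log (1 - w) * -γ := by nlinarith
  have h3 := Real.add_one_le_exp (Real.log (1 - w) * -γ)
  linarith

theorem convex_closedHalf : Convex ℝ (closedHalf n) := by
  intro x hx y hy a b ha hb _
  change 0 ≤ lastC (a • x + b • y)
  have hx : 0 ≤ lastC x := hx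
  have hy : 0 ≤ lastC y := hy
  simp only [lastC_eq_inner, inner_add_left, inner_smul_left] at *
  simp only [conj_trivial]
  positivity

theorem convex_bdry : Convex ℝ (bdry n) := by
  intro x hx y hy a b ha hb _
  change lastC (a • x + b • y) = 0
  have hx : lastC x = 0 := hx
  have hy : lastC y = 0 := hy
  simp only [lastC_eq_inner, inner_add_left, inner_smul_left] at *
  simp [hx, hy]

theorem bdry_subset : bdry n ⊆ closedHalf n := fun x hx => (show lastC x = 0 from hx).ge

theorem add_smul_eN_mem_openHalf (hn : 0 < n) {x : EuclideanSpace ℝ (Fin n)}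
    (hx : x ∈ closedHalf n) {s : ℝ} (hs : 0 < s) : x + s • eN n ∈ openHalf n := by
  change 0 < lastC (x + s • eN n)
  have : 0 ≤ lastC x := hx
  rw [lastC_add_smul, lastC_eN hn]; linarith

theorem add_smul_eN_mem_closedHalf (hn : 0 < n) {x : EuclideanSpace ℝ (Fin n)}
    (hx : x ∈ closedHalf n) {s : ℝ} (hs : 0 ≤ s) : x + s • eN n ∈ closedHalf n := by
  change 0 ≤ lastC (x + s • eN n)
  have : 0 ≤ lastC x := hx
  rw [lastC_add_smul, lastC_eN hn]; linarith

theorem uniqueDiffOn_closedHalf (hn : 0 < n) : UniqueDiffOn ℝ (closedHalf n) := by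
  refine uniqueDiffOn_convex convex_closedHalf ⟨eN n, ?_⟩
  refine mem_interior_iff_mem_nhds.2 (closedHalf_mem_nhds ?_)
  change 0 < lastC (eN n)
  rw [lastC_eN hn]; exact one_pos

theorem le_lastC_of_dist_le (hn : 0 < n) (x z : EuclideanSpace ℝ (Fin n)) :
    lastC z - dist x z ≤ lastC x := by
  have h := (abs_le.1 (abs_lastC_le hn (x - z))).1
  rw [lastC_sub, ← dist_eq_norm] at h; linarith

theorem lastC_le_of_dist_le (hn : 0 < n) (x z : EuclideanSpace ℝ (Fin n)) :
    lastC x ≤ lastC z + dist x z := by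
  have h := (abs_le.1 (abs_lastC_le hn (x - z))).2
  rw [lastC_sub, ← dist_eq_norm] at h; linarith

/-- The normal derivative, taken from inside the closed half-space. -/
def dn (u : EuclideanSpace ℝ (Fin n) → ℝ) (x : EuclideanSpace ℝ (Fin n)) : ℝ :=
  fderivWithin ℝ u (closedHalf n) x (eN n)

namespace HalfSol

variable {m p q : ℝ} {u : EuclideanSpace ℝ (Fin n) → ℝ}

theorem good_of_le_lastC (hn : 0 < n) {z : EuclideanSpace ℝ (Fin n)} {R : ℝ} (h : R ≤ lastC z) :
    Good u z R := by
  refine Or.inl fun x _ hd => ?_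
  change 0 < lastC x
  linarith [le_lastC_of_dist_le hn x z]

theorem exists_min (hu : HalfSol n m p q u) {z : EuclideanSpace ℝ (Fin n)} {r R : ℝ}
    (hG : Good u z R) (hr : 0 ≤ r) (hrR : r < R) (hz : z ∈ closedHalf n) :
    ∃ b > 0, (∀ x ∈ closedHalf n, dist x z ≤ r → b ≤ u x) ∧
      ∃ x ∈ closedHalf n, dist x z ≤ r ∧ u x ≤ b := by
  obtain ⟨y, hy, hmin⟩ := ((isCompact_closedBall z r).inter_left
    isClosed_closedHalf).exists_isMinOn ⟨z, hz, Metric.mem_closedBall_self hr⟩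
    (hu.continuousOn.mono Set.inter_subset_left)
  have hyr : dist y z ≤ r := hy.2
  exact ⟨u y, Good.pos hu hG hy.1 (hyr.trans_lt hrR), fun x hx hxr => hmin ⟨hx, hxr⟩,
    y, hy.1, hyr, le_rfl⟩

/-- There is no solution which is positive on the boundary. -/
theorem false_of_pos_bdry (hu : HalfSol n m p q u) (hp : p * (n - m) < n * (m - 1))
    (hpos : ∀ x ∈ bdry n, 0 < u x) : False := by
  have hm := hu.one_lt
  have hz : (0 : EuclideanSpace ℝ (Fin n)) ∈ bdry n := by
    change lastC 0 = 0
    rw [lastC_eq_inner, inner_zero_left]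
  have hzc := bdry_subset hz
  have hG : ∀ R, Good u 0 R := fun R => Or.inr ⟨hz, hpos⟩
  obtain ⟨C, hC, hT⟩ := hu.exists_min_bound
  obtain ⟨b1, hb1, hb1l, -⟩ := hu.exists_min (hG 2) zero_le_one one_lt_two hzc
  have hc := hu.one_sub_two_rpow_pos
  have hmain : ∀ ρ ≥ (2:ℝ), ∃ b > 0, b ≤ u 0 ∧ b ^ p * ρ ^ m ≤ C * b ^ (m - 1) ∧
      (1 - (2:ℝ) ^ (-gam n m)) * b1 * (1 / ρ) ^ gam n m ≤ b := by
    intro ρ hρ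
    obtain ⟨b, hb, hbl, x, hx, hxr, hxb⟩ := hu.exists_min (hG ρ) (r := ρ / 2) (by linarith)
      (by linarith) hzc
    refine ⟨b, hb, hbl 0 hzc (by rw [dist_self]; linarith), hT 0 ρ b (by linarith) hb (hG _) hzc
      (hu.descends_of_mem_bdry hz (hpos 0 hz)) hbl ⟨x, hx, hxr, hxb⟩, ?_⟩
    exact (hu.lower_bound_spread (hG _) one_pos (by linarith) hb1 hb1l hx
      (by linarith : dist x 0 ≤ ρ)).trans hxb
  rcases le_or_gt p (m - 1) with hpm | hpm
  · refine false_of_rpow_le (e := m) (K := C * u 0 ^ (m - 1 - p)) (t0 := 2) (by linarith)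
      fun ρ hρ => ?_
    obtain ⟨b, hb, hb0, hbT, -⟩ := hmain ρ hρ
    rw [show m - 1 = p + (m - 1 - p) by ring, Real.rpow_add hb, ← mul_assoc, mul_comm C,
      mul_assoc] at hbT
    refine (le_of_mul_le_mul_left hbT (by positivity)).trans ?_
    exact mul_le_mul_of_nonneg_left (Real.rpow_le_rpow hb.le hb0 (by linarith)) hC.le
  · obtain ⟨e, he⟩ : ∃ e : ℝ, e = p - (m - 1) := ⟨_, rfl⟩
    have he0 : 0 < e := by linarith
    obtain ⟨c, hc'⟩ : ∃ c : ℝ, c = (1 - (2:ℝ) ^ (-gam n m)) * b1 := ⟨_, rfl⟩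
    have hc0 : 0 < c := by rw [hc']; positivity
    have hgm : gam n m * (m - 1) = n - m := by
      rw [gam]; field_simp [(by linarith : m - 1 ≠ 0)]
    have hexp : 0 < m - gam n m * e := by
      have : 0 < (m - gam n m * e) * (m - 1) := by
        have : (m - gam n m * e) * (m - 1) = n * (m - 1) - p * (n - m) := by
          rw [he]; linear_combination -(p - (m - 1)) * hgm
        linarith
      exact pos_of_mul_pos_left this (by linarith)
    refine false_of_rpow_le (K := C / c ^ e) (t0 := 2) hexp fun ρ hρ => ?_
    have hρ0 : 0 < ρ := by linarith
    obtain ⟨b, hb, -, hbT, hbl⟩ := hmain ρ hρ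
    rw [show p = (m - 1) + e by rw [he]; ring, Real.rpow_add hb, mul_comm C, mul_assoc] at hbT
    have h1 : b ^ e * ρ ^ m ≤ C := le_of_mul_le_mul_left hbT (by positivity)
    rw [← hc'] at hbl
    have h2 : (c * (1 / ρ) ^ gam n m) ^ e ≤ b ^ e := Real.rpow_le_rpow (by positivity) hbl he0.le
    rw [Real.mul_rpow hc0.le (by positivity), ← Real.rpow_mul (by positivity), one_div,
      Real.inv_rpow hρ0.le] at h2
    rw [le_div_iff₀ (by positivity), Real.rpow_sub hρ0]
    calc ρ ^ m / ρ ^ (gam n m * e) * c ^ e = c ^ e * (ρ ^ (gam n m * e))⁻¹ * ρ ^ m := by ring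
      _ ≤ b ^ e * ρ ^ m := mul_le_mul_of_nonneg_right h2 (by positivity)
      _ ≤ C := h1

theorem continuousOn_dn (hu : HalfSol n m p q u) : ContinuousOn (dn u) (closedHalf n) :=
  (hu.contDiffOn.continuousOn_fderivWithin (uniqueDiffOn_closedHalf hu.dim_pos)
    (by norm_num)).clm_apply continuousOn_const

theorem dn_neg (hu : HalfSol n m p q u) {x : EuclideanSpace ℝ (Fin n)} (hx : x ∈ bdry n)
    (hux : 0 < u x) : dn u x < 0 := by
  obtain ⟨h1, h2⟩ := hu.differentiableAt_bdry hx hux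
  rwa [dn, h1.fderivWithin (uniqueDiffOn_closedHalf hu.dim_pos x (bdry_subset hx))]

/-- Quantitative Hopf lemma. -/
theorem hopf (hu : HalfSol n m p q u) {x0 : EuclideanSpace ℝ (Fin n)} (hx0 : x0 ∈ bdry n)
    (hux : u x0 = 0) {t a : ℝ} (ht : 0 < t) (ha : 0 < a)
    (hin : ∀ x ∈ closedHalf n, dist x (x0 + t • eN n) ≤ t / 16 → a ≤ u x) :
    gam n m / ((16:ℝ) ^ gam n m - 1) * a / t ≤ dn u x0 := by
  have hn := hu.dim_pos
  have hγ := hu.gam_pos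
  have hd : HasFDerivWithinAt u (fderivWithin ℝ u (closedHalf n) x0) (closedHalf n)
      (x0 + (0:ℝ) • eN n) := by
    rw [zero_smul, add_zero]
    exact (hu.contDiffOn.differentiableOn (by norm_num) x0 (bdry_subset hx0)).hasFDerivWithinAt
  have hl : HasDerivAt (fun s : ℝ => x0 + s • eN n) (eN n) 0 := by
    simpa using ((hasDerivAt_id (0:ℝ)).smul_const (eN n)).const_add x0
  have hds : HasDerivWithinAt (fun s : ℝ => u (x0 + s • eN n)) (dn u x0) (Set.Ici 0) 0 :=
    hd.comp_hasDerivWithinAt (0:ℝ) hl.hasDerivWithinAt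
      fun s hs => add_smul_eN_mem_closedHalf hn (bdry_subset hx0) hs
  have hlim := hasDerivWithinAt_iff_tendsto_slope.1 hds
  rw [Set.Ici_sdiff_left] at hlim
  refine ge_of_tendsto hlim ?_
  filter_upwards [self_mem_nhdsWithin, mem_nhdsWithin_of_mem_nhds
    (gt_mem_nhds (show (0:ℝ) < t / 2 by linarith))] with s hs hst
  have hs : 0 < s := hs
  have hlz : lastC (x0 + t • eN n) = t := by
    rw [lastC_add_smul, lastC_eN hn, show lastC x0 = 0 from hx0]; ring
  have hdist : dist (x0 + s • eN n) (x0 + t • eN n) = t - s := by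
    rw [dist_add_left, dist_eq_norm, ← sub_smul, norm_smul, norm_eN hn, mul_one, Real.norm_eq_abs,
      abs_of_nonpos (by linarith)]
    ring
  have hb := hu.lower_barrier (good_of_le_lastC hn hlz.ge) (by linarith : 0 < t / 16)
    (by linarith) ha (fun y hy h => hin y hy h.le)
    (add_smul_eN_mem_closedHalf hn (bdry_subset hx0) hs.le) (by rw [hdist]; linarith)
    (by rw [hdist]; linarith)
  rw [hdist] at hb
  rw [slope_def_field, zero_smul, add_zero, hux, sub_zero, sub_zero, le_div_iff₀ hs]
  refine le_trans (le_of_eq_of_le ?_ (mul_le_mul_of_nonneg_left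
    (div_le_div_of_nonneg_right (c := (t / 16) ^ (-gam n m) - t ^ (-gam n m))
      (a := t ^ (-gam n m) * (gam n m * (s / t))) ?_ ?_) ha.le)) hb
  · have h16 : (t / 16) ^ (-gam n m) = t ^ (-gam n m) * 16 ^ gam n m := by
      rw [Real.div_rpow ht.le (by norm_num), Real.rpow_neg (by norm_num : (0:ℝ) ≤ 16)]
      simp
    rw [h16]
    have h1 : (1:ℝ) < 16 ^ gam n m := Real.one_lt_rpow (by norm_num) hγ
    have h2 : (16:ℝ) ^ gam n m - 1 ≠ 0 := by linarith
    have h3 : t ^ (-gam n m) ≠ 0 := by positivity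
    rw [show t ^ (-gam n m) * 16 ^ gam n m - t ^ (-gam n m)
      = t ^ (-gam n m) * (16 ^ gam n m - 1) by ring]
    field_simp
  · have h1 := one_add_mul_le_rpow_neg hγ (w := s / t) (by rw [div_lt_one ht]; linarith)
    have h2 : t - s = t * (1 - s / t) := by field_simp
    have h3 : 0 ≤ 1 - s / t := by
      rw [sub_nonneg, div_le_one ht]; linarith
    rw [h2, Real.mul_rpow ht.le h3]
    have h4 := mul_le_mul_of_nonneg_left h1 (Real.rpow_pos_of_pos ht (-gam n m)).le
    linarith
  · exact sub_nonneg.2 (Real.rpow_le_rpow_of_nonpos (by linarith) (by linarith) (by linarith))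

theorem dn_pos (hu : HalfSol n m p q u) {x : EuclideanSpace ℝ (Fin n)} (hx : x ∈ bdry n)
    (hux : u x = 0) : 0 < dn u x := by
  have hn := hu.dim_pos
  have hlz : lastC (x + (1:ℝ) • eN n) = 1 := by
    rw [lastC_add_smul, lastC_eN hn, show lastC x = 0 from hx]; ring
  obtain ⟨b, hb, hbl, -⟩ := hu.exists_min (good_of_le_lastC hn hlz.ge) (r := 1 / 16) (by norm_num)
    (by norm_num) (add_smul_eN_mem_closedHalf hn (bdry_subset hx) zero_le_one)
  refine lt_of_lt_of_le ?_ (hu.hopf hx hux one_pos hb hbl)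
  have h1 : (1:ℝ) < 16 ^ gam n m := Real.one_lt_rpow (by norm_num) hu.gam_pos
  exact div_pos (mul_pos (div_pos hu.gam_pos (by linarith)) hb) one_pos

/-- A solution is either positive or zero on the whole boundary. -/
theorem bdry_dichotomy (hu : HalfSol n m p q u) :
    (∀ x ∈ bdry n, 0 < u x) ∨ ∀ x ∈ bdry n, u x = 0 := by
  by_contra! h
  obtain ⟨⟨x, hx, hx0⟩, y, hy, hy0⟩ := h
  have hx1 := hu.dn_pos hx (le_antisymm hx0 (hu.nonneg x (bdry_subset hx)))
  have hy1 := hu.dn_neg hy (lt_of_le_of_ne (hu.nonneg y (bdry_subset hy)) hy0.symm)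
  obtain ⟨w, hw, hw0⟩ := convex_bdry.isPreconnected.intermediate_value hy hx
    (hu.continuousOn_dn.mono bdry_subset) ⟨hy1.le, hx1.le⟩
  rcases (hu.nonneg w (bdry_subset hw)).eq_or_lt with h | h
  · exact (hu.dn_pos hw h.symm).ne' hw0
  · exact (hu.dn_neg hw h).ne hw0

/-- There is no solution vanishing on the boundary when `p ≤ m - 1`. -/
theorem false_of_zero_bdry_of_le (hu : HalfSol n m p q u) (hp : p ≤ m - 1)
    (hz : ∀ x ∈ bdry n, u x = 0) : False := by
  have hm := hu.one_lt
  have hn := hu.dim_pos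
  obtain ⟨C, hC, hT⟩ := hu.exists_min_bound
  obtain ⟨M, hM⟩ := ((isCompact_closedBall (0 : EuclideanSpace ℝ (Fin n)) 2).inter_left
    isClosed_closedHalf).exists_bound_of_continuousOn
    (hu.continuousOn_dn.mono Set.inter_subset_left)
  obtain ⟨c, hc⟩ : ∃ c : ℝ, c = gam n m / ((16:ℝ) ^ gam n m - 1) := ⟨_, rfl⟩
  have hc0 : 0 < c := by
    have h1 : (1:ℝ) < 16 ^ gam n m := Real.one_lt_rpow (by norm_num) hu.gam_pos
    rw [hc]; exact div_pos hu.gam_pos (by linarith)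
  obtain ⟨e, he⟩ : ∃ e : ℝ, e = m - 1 - p := ⟨_, rfl⟩
  have he0 : 0 ≤ e := by linarith
  refine false_of_rpow_le (e := m - e) (K := C * (2 * |M| / c) ^ e * 4 ^ m) (t0 := 8)
    (by linarith [hu.p_pos]) fun t ht => ?_
  have ht0 : 0 < t := by linarith
  have h0c : (0 : EuclideanSpace ℝ (Fin n)) ∈ closedHalf n := by
    change 0 ≤ lastC 0
    rw [lastC_eq_inner, inner_zero_left]
  obtain ⟨z, hzo, hzd, hzg⟩ := hu.exists_gradient_ne_zero (add_smul_eN_mem_openHalf hn h0c ht0)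
    one_pos
  rw [zero_add] at hzd
  obtain ⟨τ, hτ⟩ : ∃ τ : ℝ, τ = lastC z := ⟨_, rfl⟩
  have hlt : lastC (t • eN n) = t := by
    have := lastC_add_smul 0 (eN n) t
    rw [zero_add, lastC_eN hn, lastC_eq_inner 0, inner_zero_left] at this
    linarith
  have hτ1 : t - 1 ≤ τ := by
    have := le_lastC_of_dist_le hn z (t • eN n)
    linarith
  have hτ2 : τ ≤ t + 1 := by
    have := lastC_le_of_dist_le hn z (t • eN n)
    linarith
  have hG : Good u z (2 * (t / 4)) := good_of_le_lastC hn (by linarith)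
  obtain ⟨b, hb, hbl, hbe⟩ := hu.exists_min hG (r := t / 4 / 2) (by linarith) (by linarith)
    (openHalf_subset hzo)
  have hbT := hT z (t / 4) b (by linarith) hb hG (openHalf_subset hzo)
    (hu.descends_of_gradient_ne_zero hzo hzg) hbl hbe
  obtain ⟨x0, hx0⟩ : ∃ x0, x0 = z + (-τ) • eN n := ⟨_, rfl⟩
  have hx0b : x0 ∈ bdry n := by
    change lastC x0 = 0
    rw [hx0, lastC_add_smul, lastC_eN hn, ← hτ]; ring
  have hzx : x0 + τ • eN n = z := by rw [hx0, neg_smul]; abel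
  have hx0n : ‖x0‖ ≤ 2 := by
    have : x0 = (z - t • eN n) + (t - τ) • eN n := by rw [hx0]; module
    rw [this]
    refine (norm_add_le _ _).trans ?_
    rw [← dist_eq_norm, norm_smul, norm_eN hn, mul_one, Real.norm_eq_abs]
    have : |t - τ| ≤ 1 := abs_le.2 ⟨by linarith, by linarith⟩
    linarith
  have hH := hu.hopf hx0b (hz x0 hx0b) (by linarith : 0 < τ) hb (by
    intro x hx hxd
    rw [hzx] at hxd
    exact hbl x hx (by linarith))
  have hMx := (Real.norm_eq_abs _ ▸ hM x0 ⟨bdry_subset hx0b, by simpa using hx0n⟩)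
  rw [← hc, div_le_iff₀ (by linarith)] at hH
  have hbt : b ≤ 2 * |M| / c * t := by
    have h1 : dn u x0 ≤ |M| := (le_abs_self _).trans (hMx.trans (le_abs_self M))
    have h2 : dn u x0 * τ ≤ |M| * (2 * t) :=
      mul_le_mul h1 (by linarith) (by linarith) (abs_nonneg _)
    rw [div_mul_eq_mul_div, le_div_iff₀ hc0]; linarith
  rw [show m - 1 = p + e by rw [he]; ring, Real.rpow_add hb, ← mul_assoc, mul_comm C,
      mul_assoc] at hbT
  have h1 : (t / 4) ^ m ≤ C * b ^ e := le_of_mul_le_mul_left hbT (by positivity)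
  have h2 : b ^ e ≤ (2 * |M| / c) ^ e * t ^ e := by
    rw [← Real.mul_rpow (by positivity) ht0.le]
    exact Real.rpow_le_rpow hb.le hbt he0
  rw [Real.div_rpow ht0.le (by norm_num), div_le_iff₀ (by positivity)] at h1
  rw [Real.rpow_sub ht0, div_le_iff₀ (by positivity)]
  calc t ^ m ≤ C * b ^ e * 4 ^ m := h1
    _ ≤ C * ((2 * |M| / c) ^ e * t ^ e) * 4 ^ m := by gcongr
    _ = _ := by ring

end HalfSol

/-- A weighted maximum point in a ball, around which the function is doubling. -/
theorem exists_weighted_max {v : EuclideanSpace ℝ (Fin n) → ℝ} {x0 : EuclideanSpace ℝ (Fin n)}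
    {r a : ℝ} (hr : 0 < r) (ha : 0 < a) (hv : ContinuousOn v (Metric.closedBall x0 r))
    (hv0 : ∀ x ∈ Metric.closedBall x0 r, 0 < v x) :
    ∃ x σ, 0 < σ ∧ σ = r - dist x x0 ∧ (∀ y, dist y x ≤ σ / 2 → v y ≤ 2 ^ a * v x) ∧
      r ^ a * v x0 ≤ σ ^ a * v x := by
  have hcont : ContinuousOn (fun y => (r - dist y x0) ^ a * v y) (Metric.closedBall x0 r) := by
    refine ContinuousOn.mul (Continuous.continuousOn ?_) hv
    exact (by fun_prop : Continuous fun y => r - dist y x0).rpow_const fun _ => Or.inr ha.le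
  obtain ⟨x, hx, hmax⟩ := (isCompact_closedBall x0 r).exists_isMaxOn
    ⟨x0, Metric.mem_closedBall_self hr.le⟩ hcont
  have hx' : dist x x0 ≤ r := hx
  have h0 : r ^ a * v x0 ≤ (r - dist x x0) ^ a * v x := by
    simpa using hmax (Metric.mem_closedBall_self hr.le)
  have hσ : 0 < r - dist x x0 := by
    rcases (sub_nonneg.2 hx').eq_or_lt with h | h
    · rw [← h, Real.zero_rpow ha.ne', zero_mul] at h0
      have h1 : 0 < r ^ a * v x0 :=
        mul_pos (by positivity) (hv0 x0 (Metric.mem_closedBall_self hr.le))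
      linarith
    · exact h
  refine ⟨x, r - dist x x0, hσ, rfl, fun y hy => ?_, h0⟩
  obtain ⟨σ, hσd⟩ : ∃ σ : ℝ, σ = r - dist x x0 := ⟨_, rfl⟩
  rw [← hσd] at hσ hy
  have hyx := dist_triangle y x x0
  have hyb : y ∈ Metric.closedBall x0 r := Metric.mem_closedBall.2 (by linarith)
  have h1 : (r - dist y x0) ^ a * v y ≤ σ ^ a * v x := hσd ▸ hmax hyb
  have h2 : (σ / 2) ^ a ≤ (r - dist y x0) ^ a :=
    Real.rpow_le_rpow (by positivity) (by linarith) ha.le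
  have h3 := mul_le_mul_of_nonneg_right h2 (hv0 y hyb).le
  rw [Real.div_rpow hσ.le (by norm_num)] at h3
  have h4 : σ ^ a * v y ≤ σ ^ a * (2 ^ a * v x) := by
    have h5 : σ ^ a / 2 ^ a * v y * 2 ^ a = σ ^ a * v y := by field_simp
    have h6 := mul_le_mul_of_nonneg_right (h3.trans h1) (by positivity : (0:ℝ) ≤ 2 ^ a)
    linarith
  exact le_of_mul_le_mul_left h4 (by positivity)

namespace HalfSol

variable {m p q : ℝ} {u : EuclideanSpace ℝ (Fin n) → ℝ}

/-- Where the solution is comparable to its central value, it stays above half of it on a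
smaller ball. -/
theorem exists_half_le (hu : HalfSol n m p q u) {Λ L : ℝ} (hΛ : 0 ≤ Λ) (hL : 0 < L) :
    ∃ c > 0, c ≤ 1 / 4 ∧ ∀ (x : EuclideanSpace ℝ (Fin n)) (s : ℝ), 0 < s → s ≤ lastC x →
      (∀ y, dist y x < s → u y ≤ L * u x ∧ u y ^ p ≤ Λ * (L * u x) ^ (m - 1) / (s / 2) ^ m) →
      ∀ y, dist y x ≤ c * s → u x / 2 ≤ u y := by
  have hn := hu.dim_pos
  obtain ⟨C, hC, hgrad⟩ := exists_norm_gradient_le n hu.one_lt hΛ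
  refine ⟨min (1 / 4) (1 / (4 * C * L)), lt_min (by norm_num) (by positivity), min_le_left _ _, ?_⟩
  intro x s hs hsx hb y hy
  have hxo : x ∈ openHalf n := lt_of_lt_of_le hs hsx
  have hux := hu.pos x hxo
  have hopen : ∀ w, dist w x < s → w ∈ openHalf n := fun w hw => by
    change 0 < lastC w
    linarith [le_lastC_of_dist_le hn w x]
  have hbound : ∀ w ∈ Metric.ball x (s / 2), ‖fderiv ℝ u w‖ ≤ C * (L * u x) / (s / 2) := by
    intro w hw
    have hw : dist w x < s / 2 := hw
    have : ‖gradient u w‖ = ‖fderiv ℝ u w‖ := LinearIsometryEquiv.norm_map _ _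
    rw [← this]
    refine hgrad u w (fun y => u y ^ p) (s / 2) (L * u x) (by linarith) (by positivity) ?_
    intro y hy
    have hy : dist y w < s / 2 := hy
    have hyx : dist y x < s := by linarith [dist_triangle y w x]
    have hyo := hopen y hyx
    have huy := hu.pos y hyo
    exact ⟨hu.mEq hyo, by positivity, (hb y hyx).2, huy.le, (hb y hyx).1⟩
  have hdiff : ∀ w ∈ Metric.ball x (s / 2), DifferentiableAt ℝ u w := fun w hw =>
    (hu.contDiffAt (hopen w (by have : dist w x < s / 2 := hw; linarith))).differentiableAt
      (by norm_num)
  have h14 : min (1 / 4) (1 / (4 * C * L)) * s ≤ 1 / 4 * s :=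
    mul_le_mul_of_nonneg_right (min_le_left _ _) hs.le
  have hyb : y ∈ Metric.ball x (s / 2) := Metric.mem_ball.2 (by linarith)
  have hmv := (convex_ball x (s / 2)).norm_image_sub_le_of_norm_fderiv_le hdiff hbound
    (Metric.mem_ball_self (by linarith)) hyb
  rw [← dist_eq_norm y x, Real.norm_eq_abs] at hmv
  have h2 : min (1 / 4) (1 / (4 * C * L)) * s ≤ 1 / (4 * C * L) * s :=
    mul_le_mul_of_nonneg_right (min_le_right _ _) hs.le
  have h3 : C * (L * u x) / (s / 2) * dist y x ≤ C * (L * u x) / (s / 2) * (1 / (4 * C * L) * s) :=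
    mul_le_mul_of_nonneg_left (hy.trans h2) (by positivity)
  have h4 : C * (L * u x) / (s / 2) * (1 / (4 * C * L) * s) = u x / 2 := by
    field_simp; norm_num
  have h5 := (abs_le.1 (hmv.trans (h3.trans h4.le))).1
  linarith

/-- Universal bound in the subcritical range. -/
theorem exists_le_rpow (hu : HalfSol n m p q u) (hp : p * (n - m) < n * (m - 1))
    (hpm : m - 1 < p) : ∃ C > 0, ∀ x ∈ openHalf n, u x * lastC x ^ (m / (p - (m - 1))) ≤ C := by
  have hm := hu.one_lt
  have hn := hu.dim_pos
  obtain ⟨e, he⟩ : ∃ e : ℝ, e = p - (m - 1) := ⟨_, rfl⟩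
  have he0 : 0 < e := by linarith
  obtain ⟨α, hα⟩ : ∃ α : ℝ, α = m / e := ⟨_, rfl⟩
  have hα0 : 0 < α := by rw [hα]; exact div_pos (by linarith) he0
  have hαe : α * e = m := by rw [hα]; field_simp
  obtain ⟨γ, hγ⟩ : ∃ γ : ℝ, γ = gam n m := ⟨_, rfl⟩
  have hγ0 : 0 < γ := hγ ▸ hu.gam_pos
  have hgm : γ * (m - 1) = n - m := by
    rw [hγ, gam]; field_simp [(by linarith : m - 1 ≠ 0)]
  have hexp : 0 < m - γ * e := by
    have : 0 < (m - γ * e) * (m - 1) := by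
      have : (m - γ * e) * (m - 1) = n * (m - 1) - p * (n - m) := by
        rw [he]; linear_combination -(p - (m - 1)) * hgm
      linarith
    exact pos_of_mul_pos_left this (by linarith)
  rw [← he, ← hα]
  obtain ⟨CT, hCT, hT⟩ := hu.exists_min_bound
  obtain ⟨c0, hc0, hc04, hhalf⟩ := hu.exists_half_le (Λ := 1) (L := 2 ^ α) zero_le_one (by positivity)
  obtain ⟨k, hk⟩ : ∃ k : ℝ, k = (1 - (2:ℝ) ^ (-γ)) / 2 * (4 * c0) ^ γ := ⟨_, rfl⟩
  have hk0 : 0 < k := by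
    have := hu.one_sub_two_rpow_pos
    rw [← hγ] at this
    rw [hk]; positivity
  obtain ⟨A0, hA0⟩ : ∃ A0 : ℝ, A0 = max 2 ((CT * 4 ^ m / k ^ e) ^ (1 / (m - γ * e))) := ⟨_, rfl⟩
  have hA0p : 0 < A0 := by rw [hA0]; exact lt_max_of_lt_left (by norm_num)
  refine ⟨(2 * A0) ^ α, by positivity, fun x0 hx0 => ?_⟩
  obtain ⟨t, ht⟩ : ∃ t : ℝ, t = lastC x0 := ⟨_, rfl⟩
  have ht0 : 0 < t := ht ▸ hx0
  have hball : ∀ x ∈ Metric.closedBall x0 (t / 2), x ∈ openHalf n := fun x hx => by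
    have hx : dist x x0 ≤ t / 2 := hx
    change 0 < lastC x
    linarith [le_lastC_of_dist_le hn x x0]
  obtain ⟨x, σ, hσ, hσd, hdoub, hmax⟩ := exists_weighted_max (v := u) (x0 := x0) (r := t / 2)
    (a := α) (by linarith) hα0 (hu.continuousOn.mono fun x hx => openHalf_subset (hball x hx))
    (fun x hx => hu.pos x (hball x hx))
  have hxt : t / 2 + σ ≤ lastC x := by linarith [le_lastC_of_dist_le hn x x0]
  have hxo : x ∈ openHalf n := by change 0 < lastC x; linarith
  obtain ⟨K, hK⟩ : ∃ K : ℝ, K = u x := ⟨_, rfl⟩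
  have hK0 : 0 < K := hK ▸ hu.pos x hxo
  rw [← hK] at hdoub hmax
  obtain ⟨ℓ, hℓ⟩ : ∃ ℓ : ℝ, ℓ = K ^ (-(1 / α)) := ⟨_, rfl⟩
  have hℓ0 : 0 < ℓ := by rw [hℓ]; positivity
  have hℓK : K * ℓ ^ α = 1 := by
    rw [hℓ, ← Real.rpow_mul hK0.le, show -(1 / α) * α = -1 by field_simp, Real.rpow_neg_one]
    field_simp
  have hℓe : K ^ e * ℓ ^ m = 1 := by
    rw [← hαe, Real.rpow_mul hℓ0.le, ← Real.mul_rpow hK0.le (by positivity), hℓK, Real.one_rpow]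
  have hσA : σ / ℓ ≤ A0 := by
    by_contra! hcon
    have h2 : 2 < σ / ℓ := lt_of_le_of_lt (by rw [hA0]; exact le_max_left _ _) hcon
    rw [lt_div_iff₀ hℓ0] at h2
    have hnear := hhalf x ℓ hℓ0 (by linarith) (by
      intro y hy
      have hy1 := hdoub y (by linarith)
      have hyo : y ∈ openHalf n := by
        change 0 < lastC y
        linarith [le_lastC_of_dist_le hn y x]
      have huy := hu.pos y hyo
      rw [← hK]
      refine ⟨hy1, ?_⟩
      have h3 : (ℓ / 2) ^ m * (2 ^ α * K) ^ e = 1 := by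
        rw [Real.mul_rpow (by positivity) hK0.le, ← Real.rpow_mul (by norm_num), hαe,
          Real.div_rpow hℓ0.le (by norm_num)]
        field_simp
        linarith
      rw [one_mul, le_div_iff₀ (by positivity)]
      calc u y ^ p * (ℓ / 2) ^ m ≤ (2 ^ α * K) ^ p * (ℓ / 2) ^ m := by
            gcongr
            exact hu.p_pos.le
        _ = (2 ^ α * K) ^ (m - 1) * ((ℓ / 2) ^ m * (2 ^ α * K) ^ e) := by
            rw [show p = (m - 1) + e by rw [he]; ring, Real.rpow_add (by positivity)]; ring
        _ = (2 ^ α * K) ^ (m - 1) := by rw [h3, mul_one])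
    rw [← hK] at hnear
    have hcl : c0 * ℓ ≤ σ / 8 := by nlinarith
    obtain ⟨z, hzo, hzd, hzg⟩ := hu.exists_gradient_ne_zero hxo (ε := c0 * ℓ / 2) (by positivity)
    have hzt : σ / 2 ≤ lastC z := by linarith [le_lastC_of_dist_le hn z x]
    have hG : Good u z (2 * (σ / 4)) := good_of_le_lastC hn (by linarith)
    obtain ⟨b, hb, hbl, x1, hx1, hx1d, hx1b⟩ := hu.exists_min hG (r := σ / 4 / 2) (by linarith)
      (by linarith) (openHalf_subset hzo)
    have hbT := hT z (σ / 4) b (by linarith) hb hG (openHalf_subset hzo)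
      (hu.descends_of_gradient_ne_zero hzo hzg) hbl ⟨x1, hx1, hx1d, hx1b⟩
    have hbs := hu.lower_bound_spread (r := σ / 4 / 2) (ρ := c0 * ℓ / 2) (a := K / 2)
      (hG.mono (by linarith)) (by positivity) (by linarith) (by linarith)
      (fun y _ hy => hnear y (by linarith [dist_triangle y z x])) hx1 hx1d
    rw [← hγ, show c0 * ℓ / 2 / (σ / 4 / 2) = 4 * c0 * (ℓ / σ) by field_simp,
      Real.mul_rpow (by positivity) (by positivity)] at hbs
    have hbk : k * K * (ℓ / σ) ^ γ ≤ b := by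
      refine le_trans (le_of_eq ?_) (hbs.trans hx1b)
      rw [hk]; ring
    rw [show p = (m - 1) + e by rw [he]; ring, Real.rpow_add hb, mul_comm CT, mul_assoc] at hbT
    have h3 : b ^ e * (σ / 4) ^ m ≤ CT := le_of_mul_le_mul_left hbT (by positivity)
    have h4 : (k * K * (ℓ / σ) ^ γ) ^ e ≤ b ^ e := Real.rpow_le_rpow (by positivity) hbk he0.le
    obtain ⟨Q, hQ⟩ : ∃ Q : ℝ, Q = σ / ℓ := ⟨_, rfl⟩
    have hQ0 : 0 < Q := by rw [hQ]; positivity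
    have hσQ : σ = Q * ℓ := by rw [hQ]; field_simp
    have h5 : Q ^ (m - γ * e) ≤ CT * 4 ^ m / k ^ e := by
      rw [le_div_iff₀ (by positivity)]
      have h4m : (4:ℝ) ^ m ≠ 0 := by positivity
      have h6 : (k * K * (ℓ / σ) ^ γ) ^ e * (σ / 4) ^ m * 4 ^ m = Q ^ (m - γ * e) * k ^ e := by
        rw [Real.mul_rpow (by positivity) (by positivity), Real.mul_rpow hk0.le hK0.le,
          Real.div_rpow hσ.le (by norm_num), mul_assoc, div_mul_cancel₀ _ h4m,
          ← Real.rpow_mul (by positivity), show ℓ / σ = Q⁻¹ by rw [hQ]; field_simp,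
          Real.inv_rpow hQ0.le, hσQ, Real.mul_rpow hQ0.le hℓ0.le, Real.rpow_sub hQ0]
        linear_combination k ^ e * Q ^ m * (Q ^ (γ * e))⁻¹ * hℓe
      rw [← h6]
      exact mul_le_mul_of_nonneg_right
        ((mul_le_mul_of_nonneg_right h4 (by positivity)).trans h3) (by positivity)
    have h7 : Q ≤ (CT * 4 ^ m / k ^ e) ^ (1 / (m - γ * e)) := by
      have := Real.rpow_le_rpow (by positivity) h5 (by positivity : 0 ≤ 1 / (m - γ * e))
      rwa [← Real.rpow_mul hQ0.le, mul_one_div_cancel hexp.ne', Real.rpow_one] at this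
    have h8 : (CT * 4 ^ m / k ^ e) ^ (1 / (m - γ * e)) ≤ A0 := by rw [hA0]; exact le_max_right _ _
    rw [hQ] at h7
    linarith
  rw [div_le_iff₀ hℓ0] at hσA
  have h1 : σ ^ α * K ≤ A0 ^ α := by
    have h2 : σ ^ α ≤ (A0 * ℓ) ^ α := Real.rpow_le_rpow hσ.le hσA hα0.le
    rw [Real.mul_rpow hA0p.le hℓ0.le] at h2
    calc σ ^ α * K ≤ A0 ^ α * ℓ ^ α * K := mul_le_mul_of_nonneg_right h2 hK0.le
      _ = A0 ^ α := by rw [mul_assoc, mul_comm (ℓ ^ α), hℓK, mul_one]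
  rw [Real.div_rpow ht0.le (by norm_num)] at hmax
  rw [← ht, Real.mul_rpow (by norm_num) hA0p.le]
  have h2 := mul_le_mul_of_nonneg_left (hmax.trans h1) (by positivity : (0:ℝ) ≤ 2 ^ α)
  have h3 : 2 ^ α * (t ^ α / 2 ^ α * u x0) = u x0 * t ^ α := by field_simp
  linarith

/-- Interior Harnack inequality in the subcritical range. -/
theorem exists_harnack (hu : HalfSol n m p q u) (hp : p * (n - m) < n * (m - 1))
    (hpm : m - 1 < p) : ∃ c > 0, ∀ x ∈ openHalf n, ∀ y, dist y x ≤ lastC x / 16 →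
      c * u x ≤ u y := by
  have hm := hu.one_lt
  have hn := hu.dim_pos
  obtain ⟨C, hC, hsup⟩ := hu.exists_le_rpow hp hpm
  obtain ⟨e, he⟩ : ∃ e : ℝ, e = p - (m - 1) := ⟨_, rfl⟩
  have he0 : 0 < e := by linarith
  rw [← he] at hsup
  obtain ⟨γ, hγ⟩ : ∃ γ : ℝ, γ = gam n m := ⟨_, rfl⟩
  have hγ0 : 0 < γ := hγ ▸ hu.gam_pos
  obtain ⟨c0, hc0, hc04, hhalf⟩ := hu.exists_half_le (Λ := C ^ e) (L := 2 ^ γ) (by positivity)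
    (by positivity)
  have hk := hu.one_sub_two_rpow_pos
  rw [← hγ] at hk
  refine ⟨(1 - (2:ℝ) ^ (-γ)) / 2 * (c0 / 3) ^ γ, by positivity, fun x0 hx0 y hy => ?_⟩
  obtain ⟨t, ht⟩ : ∃ t : ℝ, t = lastC x0 := ⟨_, rfl⟩
  have ht0 : 0 < t := ht ▸ hx0
  rw [← ht] at hy
  have hball : ∀ x ∈ Metric.closedBall x0 (t / 4), x ∈ openHalf n := fun x hx => by
    have hx : dist x x0 ≤ t / 4 := hx
    change 0 < lastC x
    linarith [le_lastC_of_dist_le hn x x0]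
  obtain ⟨x, σ, hσ, hσd, hdoub, hmax⟩ := exists_weighted_max (v := u) (x0 := x0) (r := t / 4)
    (a := γ) (by linarith) hγ0 (hu.continuousOn.mono fun x hx => openHalf_subset (hball x hx))
    (fun x hx => hu.pos x (hball x hx))
  have hσt : σ ≤ t / 4 := by linarith [dist_nonneg (x := x) (y := x0)]
  have hxt : 3 * t / 4 ≤ lastC x := by linarith [le_lastC_of_dist_le hn x x0]
  have hxo : x ∈ openHalf n := by change 0 < lastC x; linarith
  have hux := hu.pos x hxo
  have hnear := hhalf x (σ / 2) (by linarith) (by linarith) (by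
    intro w hw
    have hw1 := hdoub w hw.le
    have hwt : t / 2 ≤ lastC w := by linarith [le_lastC_of_dist_le hn w x]
    have hwo : w ∈ openHalf n := by change 0 < lastC w; linarith
    have huw := hu.pos w hwo
    refine ⟨hw1, ?_⟩
    have h1 := hsup w hwo
    have hw0 : 0 < lastC w := hwo
    have h2 : u w ^ e * lastC w ^ m ≤ C ^ e := by
      have := Real.rpow_le_rpow (by positivity) h1 he0.le
      rwa [Real.mul_rpow huw.le (by positivity), ← Real.rpow_mul hw0.le,
        div_mul_cancel₀ _ he0.ne'] at this
    rw [le_div_iff₀ (by positivity)]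
    calc u w ^ p * (σ / 2 / 2) ^ m ≤ u w ^ p * lastC w ^ m := by
          gcongr
          linarith
      _ = u w ^ e * lastC w ^ m * u w ^ (m - 1) := by
          rw [show p = (m - 1) + e by rw [he]; ring, Real.rpow_add huw]; ring
      _ ≤ C ^ e * (2 ^ γ * u x) ^ (m - 1) := by
          gcongr)
  have hyo : y ∈ openHalf n := hball y (Metric.mem_closedBall.2 (by linarith))
  have hsp := hu.lower_bound_spread (z := x) (r := 3 * t / 8) (ρ := c0 * (σ / 2)) (a := u x / 2)
    (good_of_le_lastC hn (by linarith)) (by positivity) (by nlinarith) (by linarith)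
    (fun w _ hw => hnear w hw) (openHalf_subset hyo)
    (by linarith [dist_triangle y x0 x, dist_comm x x0])
  rw [← hγ] at hsp
  refine le_trans ?_ hsp
  have h1 : (c0 * (σ / 2) / (3 * t / 8)) ^ γ = (c0 / 3) ^ γ * (σ ^ γ / (t / 4) ^ γ) := by
    rw [← Real.div_rpow hσ.le (by positivity), ← Real.mul_rpow (by positivity) (by positivity)]
    congr 1
    field_simp
    norm_num
  rw [h1]
  have h2 : u x0 ≤ σ ^ γ / (t / 4) ^ γ * u x := by
    rw [div_mul_eq_mul_div, le_div_iff₀ (by positivity)]; linarith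
  calc _ = (1 - (2:ℝ) ^ (-γ)) / 2 * (c0 / 3) ^ γ * u x0 := by ring
    _ ≤ (1 - (2:ℝ) ^ (-γ)) / 2 * (c0 / 3) ^ γ * (σ ^ γ / (t / 4) ^ γ * u x) :=
      mul_le_mul_of_nonneg_left h2 (by positivity)
    _ = _ := by ring

/-- Interior gradient estimate relative to the value of the solution. -/
theorem exists_norm_gradient_le_div (hu : HalfSol n m p q u) (hp : p * (n - m) < n * (m - 1))
    (hpm : m - 1 < p) : ∃ C > 0, ∀ x ∈ openHalf n, ‖gradient u x‖ ≤ C * u x / lastC x := by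
  have hm := hu.one_lt
  have hn := hu.dim_pos
  obtain ⟨C, hC, hsup⟩ := hu.exists_le_rpow hp hpm
  obtain ⟨e, he⟩ : ∃ e : ℝ, e = p - (m - 1) := ⟨_, rfl⟩
  have he0 : 0 < e := by linarith
  rw [← he] at hsup
  obtain ⟨c, hc, hhar⟩ := hu.exists_harnack hp hpm
  obtain ⟨D, hD, hgrad⟩ := exists_norm_gradient_le n hm (Λ := C ^ e) (by positivity)
  refine ⟨32 * D / c, by positivity, fun x hx => ?_⟩
  obtain ⟨t, ht⟩ : ∃ t : ℝ, t = lastC x := ⟨_, rfl⟩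
  have ht0 : 0 < t := ht ▸ hx
  have hux := hu.pos x hx
  have hG := hgrad u x (fun y => u y ^ p) (t / 32) (u x / c) (by positivity) (by positivity) (by
    intro y hy
    have hy : dist y x < t / 32 := hy
    have hyt : t / 2 ≤ lastC y := by linarith [le_lastC_of_dist_le hn y x]
    have hyo : y ∈ openHalf n := by change 0 < lastC y; linarith
    have huy := hu.pos y hyo
    have hle : u y ≤ u x / c := by
      rw [le_div_iff₀ hc, mul_comm]
      exact hhar y hyo x (by rw [dist_comm]; linarith)
    refine ⟨hu.mEq hyo, by positivity, ?_, huy.le, hle⟩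
    have h1 := hsup y hyo
    have hy0 : 0 < lastC y := hyo
    have h2 : u y ^ e * lastC y ^ m ≤ C ^ e := by
      have := Real.rpow_le_rpow (by positivity) h1 he0.le
      rwa [Real.mul_rpow huy.le (by positivity), ← Real.rpow_mul hy0.le,
        div_mul_cancel₀ _ he0.ne'] at this
    rw [le_div_iff₀ (by positivity)]
    calc u y ^ p * (t / 32) ^ m ≤ u y ^ p * lastC y ^ m := by
          gcongr
          linarith
      _ = u y ^ e * lastC y ^ m * u y ^ (m - 1) := by
          rw [show p = (m - 1) + e by rw [he]; ring, Real.rpow_add huy]; ring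
      _ ≤ C ^ e * (u x / c) ^ (m - 1) := by
          gcongr)
  refine hG.trans (le_of_eq ?_)
  rw [← ht]
  field_simp

/-- Decay of a solution vanishing on the boundary, in terms of the distance to the boundary and
the normal derivative at the foot point. -/
theorem exists_decay (hu : HalfSol n m p q u) (hp : p * (n - m) < n * (m - 1))
    (hpm : m - 1 < p) (hz : ∀ x ∈ bdry n, u x = 0) : ∃ C > 0, ∀ x ∈ bdry n, ∀ t > 0,
      u (x + t • eN n) ≤ C * t ^ (-(m / (p - (m - 1)))) ∧
      ‖gradient u (x + t • eN n)‖ ≤ C * t ^ (-(m / (p - (m - 1))) - 1) ∧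
      ‖gradient u (x + t • eN n)‖ ≤ C * dn u x := by
  have hn := hu.dim_pos
  obtain ⟨C, hC, hsup⟩ := hu.exists_le_rpow hp hpm
  obtain ⟨c, hc, hhar⟩ := hu.exists_harnack hp hpm
  obtain ⟨D, hD, hgrad⟩ := hu.exists_norm_gradient_le_div hp hpm
  obtain ⟨α, hα⟩ : ∃ α : ℝ, α = m / (p - (m - 1)) := ⟨_, rfl⟩
  rw [← hα] at hsup ⊢
  obtain ⟨k, hk⟩ : ∃ k : ℝ, k = gam n m / ((16:ℝ) ^ gam n m - 1) := ⟨_, rfl⟩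
  have hk0 : 0 < k := by
    have h1 : (1:ℝ) < 16 ^ gam n m := Real.one_lt_rpow (by norm_num) hu.gam_pos
    rw [hk]; exact div_pos hu.gam_pos (by linarith)
  refine ⟨C + D * C + D / (k * c), by positivity, fun x hx t ht => ?_⟩
  have hl : lastC (x + t • eN n) = t := by
    rw [lastC_add_smul, lastC_eN hn, show lastC x = 0 from hx]; ring
  have hxo := add_smul_eN_mem_openHalf hn (bdry_subset hx) ht
  have h1 := hsup _ hxo
  have h3 := hgrad _ hxo
  have hpos := hu.pos _ hxo
  have h4 := hu.hopf hx (hz x hx) ht (mul_pos hc hpos)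
    (fun y _ hy => hhar _ hxo y (by rwa [hl]))
  have hdn := hu.dn_pos hx (hz x hx)
  rw [hl] at h1 h3
  have hta : 0 < t ^ α := by positivity
  have h5 : u (x + t • eN n) ≤ C * t ^ (-α) := by
    rw [Real.rpow_neg ht.le, ← div_eq_mul_inv, le_div_iff₀ hta]; exact h1
  have hDC : 0 < D / (k * c) := by positivity
  refine ⟨h5.trans (mul_le_mul_of_nonneg_right (by nlinarith) (by positivity)), ?_, ?_⟩
  · refine h3.trans ?_
    rw [Real.rpow_sub_one ht.ne', ← mul_div_assoc]
    refine div_le_div_of_nonneg_right ?_ ht.le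
    calc D * u (x + t • eN n) ≤ D * (C * t ^ (-α)) := mul_le_mul_of_nonneg_left h5 hD.le
      _ = D * C * t ^ (-α) := by ring
      _ ≤ _ := mul_le_mul_of_nonneg_right (by linarith) (by positivity)
  · refine h3.trans ?_
    rw [← hk, mul_div_assoc] at h4
    have h6 : u (x + t • eN n) / t ≤ dn u x / (k * c) := by
      rw [le_div_iff₀ (by positivity)]
      calc _ = k * (c * u (x + t • eN n) / t) := by ring
        _ ≤ _ := h4
    calc D * u (x + t • eN n) / t = D * (u (x + t • eN n) / t) := by ring
      _ ≤ D * (dn u x / (k * c)) := mul_le_mul_of_nonneg_left h6 hD.le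
      _ = D / (k * c) * dn u x := by ring
      _ ≤ _ := mul_le_mul_of_nonneg_right (by nlinarith) hdn.le

end HalfSol

/-- The gradient part of the energy-momentum field in the normal direction. -/
def stress (m : ℝ) (g : EuclideanSpace ℝ (Fin n)) : EuclideanSpace ℝ (Fin n) :=
  (‖g‖ ^ (m - 2) * ⟪g, eN n⟫) • g - (‖g‖ ^ m / m) • eN n

theorem norm_rpow_sub_two_mul (m : ℝ) {g : EuclideanSpace ℝ (Fin n)} (hg : g ≠ 0) :
    ‖g‖ ^ (m - 2) * ‖g‖ ^ 2 = ‖g‖ ^ m := by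
  rw [← Real.rpow_natCast, ← Real.rpow_add (norm_pos_iff.2 hg)]; norm_num

theorem norm_stress_flux_le {m : ℝ} (hn : 0 < n) (g : EuclideanSpace ℝ (Fin n)) :
    ‖(‖g‖ ^ (m - 2) * ⟪g, eN n⟫) • g‖ ≤ ‖g‖ ^ m := by
  rcases eq_or_ne g 0 with rfl | hg
  · simp; positivity
  rw [norm_smul, norm_mul, Real.norm_of_nonneg (by positivity : (0:ℝ) ≤ ‖g‖ ^ (m - 2))]
  have h1 : ‖⟪g, eN n⟫‖ ≤ ‖g‖ := by
    simpa [norm_eN hn] using norm_inner_le_norm (𝕜 := ℝ) g (eN n)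
  calc _ ≤ ‖g‖ ^ (m - 2) * ‖g‖ * ‖g‖ := by gcongr
    _ = ‖g‖ ^ m := by rw [← norm_rpow_sub_two_mul m hg]; ring

theorem norm_stress_le {m : ℝ} (hn : 0 < n) (hm : 1 < m) (g : EuclideanSpace ℝ (Fin n)) :
    ‖stress m g‖ ≤ 2 * ‖g‖ ^ m := by
  refine (norm_sub_le _ _).trans ?_
  have h1 := norm_stress_flux_le (m := m) hn g
  have h2 : ‖(‖g‖ ^ m / m) • eN n‖ ≤ ‖g‖ ^ m := by
    rw [norm_smul, norm_eN hn, mul_one, Real.norm_of_nonneg (by positivity)]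
    exact div_le_self (by positivity) hm.le
  linarith

theorem hasFDerivAt_stress_zero {m : ℝ} (hn : 0 < n) (hm : 1 < m) :
    HasFDerivAt (stress m) (0 : EuclideanSpace ℝ (Fin n) →L[ℝ] EuclideanSpace ℝ (Fin n)) 0 := by
  have h0 : stress m (0 : EuclideanSpace ℝ (Fin n)) = 0 := by
    have := norm_stress_le hn hm (0 : EuclideanSpace ℝ (Fin n))
    rw [norm_zero, Real.zero_rpow (by linarith)] at this
    simpa using this
  have hd := hasFDerivAt_norm_rpow (0 : EuclideanSpace ℝ (Fin n)) hm
  rw [hasFDerivAt_iff_isLittleO_nhds_zero] at hd ⊢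
  refine Asymptotics.IsBigO.trans_isLittleO ?_ hd
  refine Asymptotics.IsBigO.of_bound 2 (Eventually.of_forall fun h => ?_)
  have := norm_stress_le hn hm h
  simp [h0, Real.zero_rpow (by linarith : m ≠ 0)]
  rwa [abs_of_nonneg (by positivity)]

theorem hasFDerivAt_stress {m : ℝ} (hm : 1 < m) {g : EuclideanSpace ℝ (Fin n)} (hg : g ≠ 0) :
    ∃ D : EuclideanSpace ℝ (Fin n) →L[ℝ] EuclideanSpace ℝ (Fin n), HasFDerivAt (stress m) D g ∧
      ∀ h, D h = ‖g‖ ^ (m - 2) • (((m - 2) / ‖g‖ ^ 2 * ⟪g, h⟫ * ⟪g, eN n⟫) • g + ⟪h, eN n⟫ • g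
        + ⟪g, eN n⟫ • h - ⟪g, h⟫ • eN n) := by
  have hn : 0 < ‖g‖ := norm_pos_iff.2 hg
  have hNeq : ∀ y : EuclideanSpace ℝ (Fin n),
      (‖y‖ ^ 2) ^ ((m - 2) / 2) = ‖y‖ ^ (m - 2) := by
    intro y
    rw [← Real.rpow_natCast, ← Real.rpow_mul (norm_nonneg _)]; congr 1; push_cast; ring
  have hid := hasFDerivAt_id (𝕜 := ℝ) g
  have hN := (hid.norm_sq).rpow_const (p := (m - 2) / 2) (Or.inl (by simp; positivity))
  have h1 := ((hN.fun_mul (hid.inner ℝ (hasFDerivAt_const (eN n) g))).fun_smul hid).fun_sub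
    (((hasFDerivAt_norm_rpow g hm).mul_const m⁻¹).fun_smul (hasFDerivAt_const (eN n) g))
  simp only [id, hNeq, ← div_eq_mul_inv] at h1
  refine ⟨_, h1, fun h => ?_⟩
  have h3 : (‖g‖ ^ 2) ^ ((m - 2) / 2 - 1) = ‖g‖ ^ (m - 2) / ‖g‖ ^ 2 := by
    rw [Real.rpow_sub_one (by positivity), hNeq]
  have hm0 : m ≠ 0 := by linarith
  simp [h3, fderivInnerCLM_apply]
  ext i
  simp
  field_simp
  ring

theorem differentiable_stress {m : ℝ} (hn : 0 < n) (hm : 1 < m) :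
    Differentiable ℝ (stress m : EuclideanSpace ℝ (Fin n) → EuclideanSpace ℝ (Fin n)) := by
  intro g
  rcases eq_or_ne g 0 with rfl | hg
  · exact (hasFDerivAt_stress_zero hn hm).differentiableAt
  · obtain ⟨D, hD, -⟩ := hasFDerivAt_stress hm hg
    exact hD.differentiableAt

theorem hasFDerivAt_gradient {v : EuclideanSpace ℝ (Fin n) → ℝ} {x : EuclideanSpace ℝ (Fin n)}
    (hv : ContDiffAt ℝ 2 v x) :
    ∃ H : EuclideanSpace ℝ (Fin n) →L[ℝ] EuclideanSpace ℝ (Fin n),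
      HasFDerivAt (gradient v) H x ∧ ∀ ξ ζ, ⟪H ξ, ζ⟫ = hess v x ξ ζ := by
  have hcoord : ∀ (y : EuclideanSpace ℝ (Fin n)) (i : Fin n),
      gradient v y i = fderiv ℝ v y (EuclideanSpace.single i 1) := by
    intro y i
    rw [fderiv_eq_inner_gradient, EuclideanSpace.inner_single_right]; simp
  refine ⟨((PiLp.continuousLinearEquiv 2 ℝ (fun _ : Fin n => ℝ)).symm :
    (Fin n → ℝ) →L[ℝ] EuclideanSpace ℝ (Fin n)).comp
    (ContinuousLinearMap.pi fun i => (hess v x).flip (EuclideanSpace.single i 1)), ?_, ?_⟩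
  · rw [← hasFDerivWithinAt_univ, hasFDerivWithinAt_euclidean]
    intro i
    simp_rw [hasFDerivWithinAt_univ, hcoord]
    exact ((hasFDerivAt_fderiv hv).clm_apply (hasFDerivAt_const _ x)).congr_fderiv
      (by ext ξ; simp)
  · intro ξ ζ
    have hg4 : ∑ i, ζ i • EuclideanSpace.single i (1:ℝ) = ζ := by
      ext j; simp [Finset.sum_apply, Pi.single_apply]
    have h5 := congrArg (fun w => hess v x ξ w) hg4
    simp only [map_sum, map_smul] at h5
    rw [← h5, PiLp.inner_apply]
    simp

/-- The energy-momentum field in the normal direction. -/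
def energyField (m p : ℝ) (u : EuclideanSpace ℝ (Fin n) → ℝ) (x : EuclideanSpace ℝ (Fin n)) :
    EuclideanSpace ℝ (Fin n) :=
  stress m (gradient u x) + (u x ^ (p + 1) / (p + 1)) • eN n

namespace HalfSol

variable {m p q : ℝ} {u : EuclideanSpace ℝ (Fin n) → ℝ}

/-- The energy-momentum field is divergence free. -/
theorem energyField_div (hu : HalfSol n m p q u) {x : EuclideanSpace ℝ (Fin n)}
    (hx : x ∈ openHalf n) :
    DifferentiableAt ℝ (energyField m p u) x ∧
    ∑ i, fderiv ℝ (energyField m p u) x (EuclideanSpace.single i 1) i = 0 := by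
  have hn := hu.dim_pos
  have hm := hu.one_lt
  have hp := hu.p_pos
  obtain ⟨H, hH, hHh⟩ := hasFDerivAt_gradient (hu.contDiffAt hx)
  have hux := hu.pos x hx
  have hU : HasFDerivAt u (fderiv ℝ u x) x :=
    ((hu.contDiffAt hx).differentiableAt (by norm_num)).hasFDerivAt
  have hV := ((hU.rpow_const (p := p + 1) (Or.inl hux.ne')).mul_const (p + 1)⁻¹).fun_smul
    (hasFDerivAt_const (eN n) x)
  have key : ∀ D : EuclideanSpace ℝ (Fin n) →L[ℝ] EuclideanSpace ℝ (Fin n),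
      HasFDerivAt (stress m) D (gradient u x) →
      ∑ i, (D (H (EuclideanSpace.single i 1))) i = - u x ^ p * ⟪gradient u x, eN n⟫ →
      DifferentiableAt ℝ (energyField m p u) x ∧
      ∑ i, fderiv ℝ (energyField m p u) x (EuclideanSpace.single i 1) i = 0 := by
    intro D hD hs
    have h1 := (hD.comp x hH).add hV
    have h2 : HasFDerivAt (energyField m p u) _ x := h1
    refine ⟨h2.differentiableAt, ?_⟩
    rw [h2.fderiv]
    have h4 : ∑ i, ⟪gradient u x, EuclideanSpace.single i 1⟫ * (eN n) i
        = ⟪gradient u x, eN n⟫ := by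
      rw [PiLp.inner_apply]
      refine Finset.sum_congr rfl fun i _ => ?_
      rw [EuclideanSpace.inner_single_right]; simp [mul_comm]
    simp [Finset.sum_add_distrib, hs, fderiv_eq_inner_gradient, -inner_gradient_left]
    have h5 : ∀ i, (p + 1)⁻¹ * ((p + 1) * u x ^ p * ⟪gradient u x, EuclideanSpace.single i 1⟫)
        * (eN n) i = u x ^ p * (⟪gradient u x, EuclideanSpace.single i 1⟫ * (eN n) i) := by
      intro i; field_simp
    simp_rw [h5, ← Finset.mul_sum, h4]
    ring
  by_cases hg : gradient u x = 0
  · refine key 0 (by rw [hg]; exact hasFDerivAt_stress_zero hn hm) (by simp [hg])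
  obtain ⟨D, hD, hDf⟩ := hasFDerivAt_stress hm hg
  refine key D hD ?_
  have h1 := hu.eq x hx
  rw [pLap_eq (hu.contDiffAt hx) hg] at h1
  obtain ⟨g, hgd⟩ : ∃ g, g = gradient u x := ⟨_, rfl⟩
  rw [← hgd] at h1 hDf ⊢
  have hin : ∀ (v : EuclideanSpace ℝ (Fin n)) i, v i = ⟪v, EuclideanSpace.single i 1⟫ := by
    intro v i; rw [EuclideanSpace.inner_single_right]; simp
  have hsum : ∀ v w : EuclideanSpace ℝ (Fin n),
      ∑ i, hess u x (EuclideanSpace.single i 1) v * w i = hess u x w v := by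
    intro v w
    have hg4 : ∑ i, w i • EuclideanSpace.single i (1:ℝ) = w := by
      ext j; simp [Finset.sum_apply, Pi.single_apply]
    have h5 := congrArg (fun w => hess u x w v) hg4
    simp only [map_sum, map_smul] at h5
    rw [← h5]; simp [mul_comm]
  have h6 : ∀ i, (D (H (EuclideanSpace.single i 1))) i = ‖g‖ ^ (m - 2) *
      ((m - 2) / ‖g‖ ^ 2 * ⟪g, eN n⟫ * (hess u x (EuclideanSpace.single i 1) g * g i)
      + hess u x (EuclideanSpace.single i 1) (eN n) * g i
      + ⟪g, eN n⟫ * hess u x (EuclideanSpace.single i 1) (EuclideanSpace.single i 1)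
      - hess u x (EuclideanSpace.single i 1) g * eN n i) := by
    intro i
    rw [hDf, real_inner_comm (H _) g, hHh, hHh]
    have : (H (EuclideanSpace.single i 1)) i = hess u x (EuclideanSpace.single i 1)
      (EuclideanSpace.single i 1) := by rw [hin, hHh]
    simp only [PiLp.smul_apply, PiLp.add_apply, PiLp.sub_apply, smul_eq_mul, this]
    ring
  simp_rw [h6, ← Finset.mul_sum, Finset.sum_sub_distrib, Finset.sum_add_distrib,
    ← Finset.mul_sum, hsum]
  rw [hess_symm (hu.contDiffAt hx) (eN n) g]
  linear_combination ⟪g, eN n⟫ * h1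

end HalfSol

/-- The gradient relative to the closed half-space. -/
def gradW (u : EuclideanSpace ℝ (Fin n) → ℝ) (x : EuclideanSpace ℝ (Fin n)) :
    EuclideanSpace ℝ (Fin n) :=
  (InnerProductSpace.toDual ℝ _).symm (fderivWithin ℝ u (closedHalf n) x)

theorem gradW_eq (u : EuclideanSpace ℝ (Fin n) → ℝ) {x : EuclideanSpace ℝ (Fin n)}
    (hx : x ∈ openHalf n) : gradW u x = gradient u x := by
  unfold gradW gradient
  rw [fderivWithin_of_mem_nhds (closedHalf_mem_nhds hx)]

/-- The energy-momentum field up to the boundary. -/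
def energyW (m p : ℝ) (u : EuclideanSpace ℝ (Fin n) → ℝ) (x : EuclideanSpace ℝ (Fin n)) :
    EuclideanSpace ℝ (Fin n) :=
  stress m (gradW u x) + (u x ^ (p + 1) / (p + 1)) • eN n

theorem energyW_eq (m p : ℝ) (u : EuclideanSpace ℝ (Fin n) → ℝ) {x : EuclideanSpace ℝ (Fin n)}
    (hx : x ∈ openHalf n) : energyW m p u x = energyField m p u x := by
  rw [energyW, energyField, gradW_eq u hx]

namespace HalfSol

variable {m p q : ℝ} {u : EuclideanSpace ℝ (Fin n) → ℝ}

theorem continuousOn_energyW (hu : HalfSol n m p q u) :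
    ContinuousOn (energyW m p u) (closedHalf n) := by
  have hp := hu.p_pos
  have h1 : ContinuousOn (gradW u) (closedHalf n) :=
    (InnerProductSpace.toDual ℝ _).symm.continuous.comp_continuousOn
      (hu.contDiffOn.continuousOn_fderivWithin (uniqueDiffOn_closedHalf hu.dim_pos) (by norm_num))
  have h2 := (differentiable_stress hu.dim_pos hu.one_lt).continuous.comp_continuousOn h1
  have h3 : ContinuousOn (fun x => u x ^ (p + 1) / (p + 1)) (closedHalf n) :=
    (hu.contDiffOn.continuousOn.rpow_const fun _ _ => Or.inr (by linarith)).div_const _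
  exact h2.add (h3.smul continuousOn_const)

theorem gradW_bdry (hu : HalfSol n m p q u) (hz : ∀ x ∈ bdry n, u x = 0)
    {x : EuclideanSpace ℝ (Fin n)} (hx : x ∈ bdry n) : gradW u x = dn u x • eN n := by
  have hn := hu.dim_pos
  have hd : HasFDerivWithinAt u (fderivWithin ℝ u (closedHalf n) x) (closedHalf n) x :=
    (hu.contDiffOn.differentiableOn (by norm_num) x (bdry_subset hx)).hasFDerivWithinAt
  have htan : ∀ ζ : EuclideanSpace ℝ (Fin n), lastC ζ = 0 →
      fderivWithin ℝ u (closedHalf n) x ζ = 0 := by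
    intro ζ hζ
    have hmem : ∀ s : ℝ, x + s • ζ ∈ bdry n := by
      intro s
      change lastC (x + s • ζ) = 0
      rw [lastC_add_smul, hζ, mul_zero, add_zero]
      exact hx
    have hpath : HasDerivAt (fun s : ℝ => x + s • ζ) ζ 0 := by
      simpa using ((hasDerivAt_id (0:ℝ)).smul_const ζ).const_add x
    have hd' : HasFDerivWithinAt u (fderivWithin ℝ u (closedHalf n) x) (closedHalf n)
        (x + (0:ℝ) • ζ) := by simpa using hd
    have h1 := hd'.comp_hasDerivAt (0:ℝ) hpath
      (Eventually.of_forall fun s => bdry_subset (hmem s))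
    have h2 : (u ∘ fun s : ℝ => x + s • ζ) = fun _ => 0 := funext fun s => hz _ (hmem s)
    rw [h2] at h1
    exact h1.unique (hasDerivAt_const _ _)
  refine ext_inner_right ℝ fun v => ?_
  have h3 := htan (v - lastC v • eN n) (by
    rw [lastC_sub, ← zero_add (lastC v • eN n), lastC_add_smul, lastC_eN hn]
    simp [lastC_eq_inner])
  rw [map_sub, map_smul, sub_eq_zero, smul_eq_mul] at h3
  rw [gradW, InnerProductSpace.toDual_symm_apply, h3, inner_smul_left, real_inner_comm v,
    ← lastC_eq_inner, dn]
  simp [mul_comm]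

theorem energyW_bdry (hu : HalfSol n m p q u) (hz : ∀ x ∈ bdry n, u x = 0)
    {x : EuclideanSpace ℝ (Fin n)} (hx : x ∈ bdry n) :
    energyW m p u x = ((1 - 1 / m) * dn u x ^ m) • eN n := by
  have hn := hu.dim_pos
  have hp := hu.p_pos
  have hm := hu.one_lt
  have hd := hu.dn_pos hx (hz x hx)
  have h0 : (0:ℝ) ^ (p + 1) = 0 := Real.zero_rpow (by linarith)
  have h1 : dn u x ^ (m - 2) * dn u x ^ 2 = dn u x ^ m := by
    rw [← Real.rpow_natCast, ← Real.rpow_add hd]; norm_num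
  rw [energyW, stress, hu.gradW_bdry hz hx, hz x hx, h0, norm_smul, norm_eN hn, inner_smul_left,
    real_inner_self_eq_norm_sq, norm_eN hn, Real.norm_of_nonneg hd.le, ← h1]
  ext i
  simp
  linear_combination h1 * eN n i / m

end HalfSol

section Box

variable {k : ℕ}

theorem lastC_toLp (w : Fin (k + 1) → ℝ) : lastC (WithLp.toLp 2 w) = w (Fin.last k) := by
  simp [lastC, Fin.last]

theorem eN_succ : eN (k + 1) = EuclideanSpace.single (Fin.last k) (1:ℝ) := by
  simp [eN, Fin.last]

/-- The tangential coordinates of a point. -/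
def tang (k : ℕ) : (Fin (k + 1) → ℝ) →L[ℝ] (Fin k → ℝ) :=
  ContinuousLinearMap.pi fun i => ContinuousLinearMap.proj i.castSucc

theorem tang_apply (w : Fin (k + 1) → ℝ) (i : Fin k) : tang k w i = w i.castSucc := rfl

/-- The coordinate identification as a continuous linear map. -/
def toE (k : ℕ) : (Fin (k + 1) → ℝ) →L[ℝ] EuclideanSpace ℝ (Fin (k + 1)) :=
  ((PiLp.continuousLinearEquiv 2 ℝ (fun _ : Fin (k + 1) => ℝ)).symm :
    (Fin (k + 1) → ℝ) →L[ℝ] EuclideanSpace ℝ (Fin (k + 1)))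

theorem toE_apply (w : Fin (k + 1) → ℝ) : toE k w = WithLp.toLp 2 w := rfl

/-- Divergence identity on a box resting on the boundary. -/
theorem HalfSol.box_identity {m p q : ℝ} {u : EuclideanSpace ℝ (Fin (k + 1)) → ℝ}
    (hu : HalfSol (k + 1) m p q u) {R : ℝ} (hR : 0 < R) {ψ : (Fin k → ℝ) → ℝ}
    (hψ : ContDiff ℝ 1 ψ) (hψ0 : ∀ y j, |y j| = R → ψ y = 0) :
    ∫ w in Set.Icc (Fin.snoc (fun _ : Fin k => -R) 0 : Fin (k + 1) → ℝ) (fun _ => R),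
      ∑ j : Fin k, energyW m p u (toE k w) j.castSucc * fderiv ℝ ψ (tang k w) (Pi.single j 1)
    = (∫ y in Set.Icc (fun _ : Fin k => -R) (fun _ => R),
        ψ y * energyW m p u (toE k (Fin.snoc y R)) (Fin.last k))
      - ∫ y in Set.Icc (fun _ : Fin k => -R) (fun _ => R),
        ψ y * energyW m p u (toE k (Fin.snoc y 0)) (Fin.last k) := by
  obtain ⟨a, ha⟩ : ∃ a : Fin (k + 1) → ℝ, a = Fin.snoc (fun _ : Fin k => -R) 0 := ⟨_, rfl⟩
  obtain ⟨b, hb⟩ : ∃ b : Fin (k + 1) → ℝ, b = fun _ => R := ⟨_, rfl⟩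
  have ha1 : a (Fin.last k) = 0 := by rw [ha]; simp
  have ha2 : ∀ j : Fin k, a j.castSucc = -R := by intro j; rw [ha]; simp
  have hle : a ≤ b := by
    intro i
    refine Fin.lastCases ?_ (fun j => ?_) i
    · rw [ha1, hb]; exact hR.le
    · rw [ha2, hb]; change -R ≤ R; linarith
  have hmem : ∀ w ∈ Set.Icc a b, toE k w ∈ closedHalf (k + 1) := by
    intro w hw
    change 0 ≤ lastC (WithLp.toLp 2 w)
    rw [lastC_toLp, ← ha1]
    exact hw.1 _
  have hmem' : ∀ w ∈ Set.univ.pi fun i => Set.Ioo (a i) (b i), toE k w ∈ openHalf (k + 1) := by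
    intro w hw
    change 0 < lastC (WithLp.toLp 2 w)
    rw [lastC_toLp, ← ha1]
    exact (hw _ (Set.mem_univ _)).1
  let f : Fin (k + 1) → (Fin (k + 1) → ℝ) → ℝ := fun i w =>
    ψ (tang k w) * energyW m p u (toE k w) i
  let f' : Fin (k + 1) → (Fin (k + 1) → ℝ) → (Fin (k + 1) → ℝ) →L[ℝ] ℝ := fun i w =>
    ψ (tang k w) • ((PiLp.proj 2 (fun _ => ℝ) i).comp
        ((fderiv ℝ (energyField m p u) (toE k w)).comp (toE k)))
      + energyW m p u (toE k w) i • (fderiv ℝ ψ (tang k w)).comp (tang k)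
  have hEc : ContinuousOn (fun w => energyW m p u (toE k w)) (Set.Icc a b) :=
    hu.continuousOn_energyW.comp (toE k).continuous.continuousOn hmem
  have hEci : ∀ i, ContinuousOn (fun w => energyW m p u (toE k w) i) (Set.Icc a b) := fun i =>
    (PiLp.continuous_apply 2 (fun _ => ℝ) i).comp_continuousOn hEc
  have Hc : ∀ i, ContinuousOn (f i) (Set.Icc a b) := fun i =>
    (hψ.continuous.comp (tang k).continuous).continuousOn.mul (hEci i)
  have Hd : ∀ w ∈ (Set.univ.pi fun i => Set.Ioo (a i) (b i)) \ ∅, ∀ i,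
      HasFDerivAt (f i) (f' i w) w := by
    intro w hw i
    have hwo := hmem' w hw.1
    have h1 : HasFDerivAt (energyW m p u) (fderiv ℝ (energyField m p u) (toE k w)) (toE k w) := by
      refine (hu.energyField_div hwo).1.hasFDerivAt.congr_of_eventuallyEq ?_
      filter_upwards [isOpen_openHalf.mem_nhds hwo] with y hy
      exact energyW_eq m p u hy
    have h2 := (PiLp.proj 2 (fun _ : Fin (k + 1) => ℝ) i).hasFDerivAt.comp w
      (h1.comp w (toE k).hasFDerivAt)
    have h3 : HasFDerivAt (fun w => ψ (tang k w)) _ w :=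
      ((hψ.differentiable (by norm_num)) (tang k w)).hasFDerivAt.comp w (tang k).hasFDerivAt
    exact h3.fun_mul h2
  have hae : (Set.univ.pi fun i => Set.Ioo (a i) (b i)) =ᵐ[volume] Set.Icc a b :=
    Measure.univ_pi_Ioo_ae_eq_Icc
  have hpt : ∀ w ∈ Set.univ.pi fun i => Set.Ioo (a i) (b i),
      ∑ i, f' i w (Pi.single i 1) = ∑ j : Fin k,
        energyW m p u (toE k w) j.castSucc * fderiv ℝ ψ (tang k w) (Pi.single j 1) := by
    intro w hw
    have h1 := (hu.energyField_div (hmem' w hw)).2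
    have h2 : ∀ i, toE k (Pi.single i 1) = EuclideanSpace.single i 1 := fun i => rfl
    have h3 : tang k (Pi.single (Fin.last k) 1) = 0 := by
      ext j; simp [tang_apply, (Fin.castSucc_lt_last j).ne]
    have h4 : ∀ j : Fin k, tang k (Pi.single j.castSucc 1) = Pi.single j 1 := by
      intro j; ext l; simp [tang_apply, Pi.single_apply]
    have h5 : ∀ i, f' i w (Pi.single i 1) = ψ (tang k w) *
        (fderiv ℝ (energyField m p u) (toE k w) (EuclideanSpace.single i 1) i)
        + energyW m p u (toE k w) i * fderiv ℝ ψ (tang k w) (tang k (Pi.single i 1)) := by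
      intro i; simp [f', h2]
    simp_rw [h5, Finset.sum_add_distrib, ← Finset.mul_sum, h1, Fin.sum_univ_castSucc, h3, h4]
    simp
  have hψd : Continuous (fderiv ℝ ψ) := hψ.continuous_fderiv (by norm_num)
  have hcont : ContinuousOn (fun w => ∑ j : Fin k,
      energyW m p u (toE k w) j.castSucc * fderiv ℝ ψ (tang k w) (Pi.single j 1))
      (Set.Icc a b) := by
    refine continuousOn_finsetSum _ fun j _ => (hEci _).mul ?_
    exact ((hψd.comp (tang k).continuous).clm_apply continuous_const).continuousOn
  have hmeas : MeasurableSet (Set.univ.pi fun i => Set.Ioo (a i) (b i)) :=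
    MeasurableSet.univ_pi fun i => measurableSet_Ioo
  have Hi : IntegrableOn (fun w => ∑ i, f' i w (Pi.single i 1)) (Set.Icc a b) := by
    refine IntegrableOn.congr_set_ae ?_ hae.symm
    refine IntegrableOn.congr_fun ?_ (fun w hw => (hpt w hw).symm) hmeas
    exact (hcont.integrableOn_compact isCompact_Icc).congr_set_ae hae
  have hmain := integral_divergence_of_hasFDerivAt_off_countable' a b hle f f' ∅
    Set.countable_empty Hc Hd Hi
  rw [← setIntegral_congr_set hae, setIntegral_congr_fun hmeas hpt,
    setIntegral_congr_set hae, Fin.sum_univ_castSucc] at hmain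
  rw [← ha, ← hb, hmain]
  have hlat : ∀ (j : Fin k) (c : ℝ), |c| = R → ∀ y, f j.castSucc (j.castSucc.insertNth c y) = 0 := by
    intro j c hc y
    have : ψ (tang k (j.castSucc.insertNth c y)) = 0 := hψ0 _ j (by rw [tang_apply]; simpa using hc)
    simp only [f, this, zero_mul]
  have hs : ∀ j : Fin k, (∫ y in Set.Icc (a ∘ j.castSucc.succAbove) (b ∘ j.castSucc.succAbove),
      f j.castSucc (j.castSucc.insertNth (b j.castSucc) y)) - (∫ y in Set.Icc (a ∘ j.castSucc.succAbove) (b ∘ j.castSucc.succAbove),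
      f j.castSucc (j.castSucc.insertNth (a j.castSucc) y)) = 0 := by
    intro j
    have e1 := hlat j (b j.castSucc) (by rw [hb]; exact abs_of_pos hR)
    have e2 := hlat j (a j.castSucc) (by rw [ha2, abs_neg]; exact abs_of_pos hR)
    simp only [e1, e2, integral_zero, sub_self]
  rw [Finset.sum_eq_zero fun j _ => hs j, zero_add]
  have h6 : a ∘ (Fin.last k).succAbove = fun _ => -R := by
    funext j; simp [ha2]
  have h7 : b ∘ (Fin.last k).succAbove = fun _ => R := by rw [hb]; rfl
  have h8 : ∀ (y : Fin k → ℝ) (c : ℝ), f (Fin.last k) ((Fin.last k).insertNth c y) =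
      ψ y * energyW m p u (toE k (Fin.snoc y c)) (Fin.last k) := by
    intro y c
    have h9 : tang k (Fin.snoc y c) = y := by ext j; simp [tang_apply]
    simp only [f, Fin.insertNth_last', h9]
  simp only [h6, h7, h8, ha1]
  rw [show b (Fin.last k) = R by rw [hb]]

end Box

theorem rpow_mul_le_young {X y δ κ : ℝ} (hX : 0 ≤ X) (hy : 0 ≤ y) (hδ : 0 < δ) (hκ : 1 < κ) :
    X ^ (1 - 1 / κ) * y ≤ δ * X + δ ^ (1 - κ) * y ^ κ := by
  have hκ0 : 0 < κ := by linarith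
  have hκ1 : 1 / κ < 1 := by rw [div_lt_one hκ0]; exact hκ
  rcases le_or_gt y (δ * X ^ (1 / κ)) with h | h
  · have h1 : X ^ (1 - 1 / κ) * X ^ (1 / κ) = X := by
      rw [← Real.rpow_add_of_nonneg hX (by linarith) (by positivity)]; simp
    have h2 : X ^ (1 - 1 / κ) * y ≤ X ^ (1 - 1 / κ) * (δ * X ^ (1 / κ)) := by gcongr
    have h3 : 0 ≤ δ ^ (1 - κ) * y ^ κ := by positivity
    calc _ ≤ X ^ (1 - 1 / κ) * (δ * X ^ (1 / κ)) := h2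
      _ = δ * (X ^ (1 - 1 / κ) * X ^ (1 / κ)) := by ring
      _ = δ * X := by rw [h1]
      _ ≤ _ := by linarith
  · have hy0 : 0 < y := lt_of_le_of_lt (by positivity) h
    have h1 : X ^ (1 / κ) ≤ y / δ := by rw [le_div_iff₀ hδ]; linarith
    have h2 : X ^ (1 - 1 / κ) = (X ^ (1 / κ)) ^ (κ - 1) := by
      rw [← Real.rpow_mul hX]; congr 1; field_simp
    have h3 : (X ^ (1 / κ)) ^ (κ - 1) ≤ (y / δ) ^ (κ - 1) :=
      Real.rpow_le_rpow (by positivity) h1 (by linarith)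
    have h4 : (y / δ) ^ (κ - 1) * y = δ ^ (1 - κ) * y ^ κ := by
      rw [Real.div_rpow hy hδ.le, div_mul_eq_mul_div, ← Real.rpow_add_one hy0.ne',
        sub_add_cancel, show 1 - κ = -(κ - 1) by ring, Real.rpow_neg hδ.le]
      ring
    have h5 : 0 ≤ δ * X := by positivity
    calc _ ≤ (y / δ) ^ (κ - 1) * y := by rw [h2]; gcongr
      _ ≤ _ := by linarith

theorem integral_add_rpow_neg_le {s κ R : ℝ} (hs : 0 < s) (hκ : 1 < κ) (hR : 0 < R) :
    ∫ t in Set.Icc 0 R, (s + t) ^ (-κ) ≤ s ^ (1 - κ) / (κ - 1) := by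
  rw [integral_Icc_eq_integral_Ioc, ← intervalIntegral.integral_of_le hR.le,
    intervalIntegral.integral_comp_add_left (fun t => t ^ (-κ)) s, integral_rpow, add_zero,
    show -κ + 1 = -(κ - 1) by ring, show 1 - κ = -(κ - 1) by ring, div_neg, ← neg_div, neg_sub]
  · have h1 : 0 < κ - 1 := by linarith
    gcongr
    have : 0 ≤ (s + R) ^ (-(κ - 1)) := by positivity
    linarith
  · refine Or.inr ⟨by linarith, ?_⟩
    rw [Set.uIcc_of_le (by linarith)]
    intro h
    have := h.1
    linarith

/-- Two decay bounds combine into one involving the sum of the scales. -/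
theorem le_rpow_of_two_bounds {s t c g C : ℝ} (hs : 0 < s) (ht : 0 ≤ t) (hc : 0 < c) (hC : 0 < C)
    (h1 : g ≤ C * s ^ (-c)) (h2 : 0 < t → g ≤ C * t ^ (-c)) :
    g ≤ C * 2 ^ c * (s + t) ^ (-c) := by
  have key : ∀ r : ℝ, 0 < r → s + t ≤ 2 * r → C * r ^ (-c) ≤ C * 2 ^ c * (s + t) ^ (-c) := by
    intro r hr hle
    have h3 : (2 * r) ^ (-c) ≤ (s + t) ^ (-c) :=
      Real.rpow_le_rpow_of_nonpos (by linarith) hle (by linarith)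
    rw [Real.mul_rpow (by norm_num) hr.le] at h3
    have h4 : (2:ℝ) ^ c * 2 ^ (-c) = 1 := by rw [← Real.rpow_add (by norm_num)]; simp
    calc C * r ^ (-c) = C * 2 ^ c * (2 ^ (-c) * r ^ (-c)) := by
          linear_combination -(C * r ^ (-c)) * h4
      _ ≤ _ := by gcongr
  rcases le_or_gt t s with h | h
  · exact h1.trans (key s hs (by linarith))
  · exact (h2 (hs.trans h)).trans (key t (hs.trans h) (by linarith))

/-- Polynomial weight vanishing on the lateral boundary of a cube. -/
def cubeWeight (k : ℕ) (R : ℝ) (y : Fin k → ℝ) : ℝ := ∏ j, (1 - (y j / R) ^ 2)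

section CubeWeight

variable {k : ℕ} {R : ℝ}

theorem contDiff_cubeWeight : ContDiff ℝ 1 (cubeWeight k R) := by
  unfold cubeWeight
  refine contDiff_prod fun j _ => ?_
  fun_prop

theorem cubeWeight_eq_zero (hR : 0 < R) {y : Fin k → ℝ} {j : Fin k} (h : |y j| = R) :
    cubeWeight k R y = 0 := by
  refine Finset.prod_eq_zero (Finset.mem_univ j) ?_
  rw [div_pow, ← sq_abs, h, div_self (by positivity), sub_self]

theorem factor_mem (hR : 0 < R) {y : Fin k → ℝ}
    (hy : y ∈ Set.Icc (fun _ : Fin k => -R) (fun _ => R)) (j : Fin k) :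
    0 ≤ 1 - (y j / R) ^ 2 ∧ 1 - (y j / R) ^ 2 ≤ 1 := by
  have h1 : |y j / R| ≤ 1 := by
    rw [abs_div, abs_of_pos hR, div_le_one hR, abs_le]
    exact ⟨hy.1 j, hy.2 j⟩
  have h2 : (y j / R) ^ 2 ≤ 1 := by rwa [sq_le_one_iff_abs_le_one]
  exact ⟨by linarith, by linarith [sq_nonneg (y j / R)]⟩

theorem cubeWeight_nonneg (hR : 0 < R) {y : Fin k → ℝ}
    (hy : y ∈ Set.Icc (fun _ : Fin k => -R) (fun _ => R)) : 0 ≤ cubeWeight k R y :=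
  Finset.prod_nonneg fun j _ => (factor_mem hR hy j).1

theorem cubeWeight_le_one (hR : 0 < R) {y : Fin k → ℝ}
    (hy : y ∈ Set.Icc (fun _ : Fin k => -R) (fun _ => R)) : cubeWeight k R y ≤ 1 :=
  Finset.prod_le_one (fun j _ => (factor_mem hR hy j).1) fun j _ => (factor_mem hR hy j).2

theorem le_cubeWeight (hR : 2 ≤ R) {y : Fin k → ℝ}
    (hy : y ∈ Set.Icc (fun _ : Fin k => (-1:ℝ)) (fun _ => 1)) : (3 / 4) ^ k ≤ cubeWeight k R y := by
  have h1 : ∏ _j : Fin k, (3 / 4 : ℝ) ≤ cubeWeight k R y := by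
    refine Finset.prod_le_prod (fun _ _ => by norm_num) fun j _ => ?_
    have h2 : |y j / R| ≤ 1 / 2 := by
      rw [abs_div, abs_of_pos (by linarith : 0 < R), div_le_iff₀ (by linarith)]
      have : |y j| ≤ 1 := abs_le.2 ⟨hy.1 j, hy.2 j⟩
      linarith
    have h3 : (y j / R) ^ 2 ≤ (1 / 2) ^ 2 := by
      rw [← sq_abs]; gcongr
    linarith
  simpa only [Finset.prod_const, Finset.card_univ, Fintype.card_fin] using h1

theorem abs_fderiv_cubeWeight_pow_le (hR : 0 < R) (N : ℕ) {y : Fin k → ℝ}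
    (hy : y ∈ Set.Icc (fun _ : Fin k => -R) (fun _ => R)) (j : Fin k) :
    |fderiv ℝ (fun y => cubeWeight k R y ^ N) y (Pi.single j 1)|
      ≤ 2 * N / R * cubeWeight k R y ^ (N - 1) := by
  have h1 : ∀ i : Fin k, HasFDerivAt (fun y : Fin k → ℝ => 1 - (y i / R) ^ 2)
      ((-(2 * (y i / R) / R)) • (ContinuousLinearMap.proj i : (Fin k → ℝ) →L[ℝ] ℝ)) y := by
    intro i
    have h2 : HasFDerivAt (fun y : Fin k → ℝ => y i)
        (ContinuousLinearMap.proj i : (Fin k → ℝ) →L[ℝ] ℝ) y := hasFDerivAt_apply i y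
    have h3 := ((h2.mul_const R⁻¹).pow 2).const_sub 1
    simp only [← div_eq_mul_inv] at h3
    refine h3.congr_fderiv ?_
    ext ξ
    simp
    ring
  have h2 : HasFDerivAt (cubeWeight k R) _ y := HasFDerivAt.finsetProd fun i _ => h1 i
  have h3 : HasFDerivAt (fun y => cubeWeight k R y ^ N) _ y := h2.pow N
  rw [h3.fderiv]
  have h4 : (∑ i : Fin k, (∏ j ∈ Finset.univ.erase i, (1 - (y j / R) ^ 2)) •
      (-(2 * (y i / R) / R)) • (ContinuousLinearMap.proj i : (Fin k → ℝ) →L[ℝ] ℝ)) (Pi.single j 1)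
      = (∏ i ∈ Finset.univ.erase j, (1 - (y i / R) ^ 2)) * (-(2 * (y j / R) / R)) := by
    simp only [sum_apply, smul_apply,
      ContinuousLinearMap.proj_apply, smul_eq_mul]
    rw [Finset.sum_eq_single j]
    · simp
    · intro i _ hij; simp [hij]
    · simp
  have h5 : |∏ i ∈ Finset.univ.erase j, (1 - (y i / R) ^ 2)| ≤ 1 := by
    rw [abs_of_nonneg (Finset.prod_nonneg fun i _ => (factor_mem hR hy i).1)]
    exact Finset.prod_le_one (fun i _ => (factor_mem hR hy i).1) fun i _ => (factor_mem hR hy i).2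
  have h6 : |2 * (y j / R) / R| ≤ 2 / R := by
    have : |y j / R| ≤ 1 := by
      rw [abs_div, abs_of_pos hR, div_le_one hR, abs_le]
      exact ⟨hy.1 j, hy.2 j⟩
    rw [abs_div, abs_mul, abs_of_pos hR, abs_two]
    gcongr
    linarith
  have hw := cubeWeight_nonneg hR hy
  rw [smul_apply, h4, smul_eq_mul, abs_mul, abs_mul, abs_neg]
  have h7 : |(N • cubeWeight k R y ^ (N - 1) : ℝ)| = N * cubeWeight k R y ^ (N - 1) := by
    rw [nsmul_eq_mul, abs_of_nonneg (by positivity)]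
  rw [h7]
  calc _ ≤ N * cubeWeight k R y ^ (N - 1) * (1 * (2 / R)) := by gcongr
    _ = _ := by ring

/-- Fubini's theorem on a box resting on the boundary. -/
theorem setIntegral_box {h : (Fin (k + 1) → ℝ) → ℝ}
    (hc : ContinuousOn h (Set.Icc (Fin.snoc (fun _ : Fin k => -R) 0 : Fin (k + 1) → ℝ)
      (fun _ => R))) :
    ∫ w in Set.Icc (Fin.snoc (fun _ : Fin k => -R) 0 : Fin (k + 1) → ℝ) (fun _ => R), h w
    = ∫ y in Set.Icc (fun _ : Fin k => -R) (fun _ => R), ∫ t in Set.Icc 0 R,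
        h (Fin.snoc y t) := by
  obtain ⟨e, he⟩ : ∃ e, e = (MeasurableEquiv.piFinSuccAbove (fun _ => ℝ) (Fin.last k)).symm :=
    ⟨_, rfl⟩
  have hem : MeasurePreserving e := by
    rw [he]
    exact (volume_preserving_piFinSuccAbove (fun _ : Fin (k + 1) => ℝ) (Fin.last k)).symm _
  have hea : ∀ z : ℝ × (Fin k → ℝ), e z = Fin.snoc z.2 z.1 := by
    intro z; rw [he]; simp [MeasurableEquiv.piFinSuccAbove_symm_apply]; rfl
  have hpre : e ⁻¹' (Set.Icc (Fin.snoc (fun _ : Fin k => -R) 0 : Fin (k + 1) → ℝ) (fun _ => R))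
      = Set.Icc 0 R ×ˢ Set.Icc (fun _ : Fin k => -R) (fun _ => R) := by
    ext z
    simp only [Set.mem_preimage, hea, Set.mem_Icc, Pi.le_def, Fin.forall_fin_succ',
      Fin.snoc_castSucc, Fin.snoc_last, Set.mem_prod]
    tauto
  have hint := (hem.integrableOn_comp_preimage e.measurableEmbedding).2
    (hc.integrableOn_compact isCompact_Icc)
  rw [← hem.setIntegral_preimage_emb e.measurableEmbedding, hpre, Measure.volume_eq_prod,
    ← Measure.prod_restrict, integral_prod_symm]
  · simp only [hea]
  · rw [Measure.prod_restrict, ← Measure.volume_eq_prod, ← hpre]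
    exact hint

end CubeWeight

section Box

variable {k : ℕ}

theorem toE_snoc_zero_mem (y : Fin k → ℝ) : toE k (Fin.snoc y 0) ∈ bdry (k + 1) := by
  change lastC (WithLp.toLp 2 _) = 0
  rw [lastC_toLp]; simp

theorem toE_snoc_mem (y : Fin k → ℝ) {t : ℝ} (ht : 0 < t) :
    toE k (Fin.snoc y t) ∈ openHalf (k + 1) := by
  change 0 < lastC (WithLp.toLp 2 _)
  rw [lastC_toLp]; simpa using ht

theorem toE_snoc (y : Fin k → ℝ) (t : ℝ) :
    toE k (Fin.snoc y t) = toE k (Fin.snoc y 0) + t • eN (k + 1) := by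
  rw [eN_succ]
  ext i
  refine Fin.lastCases ?_ (fun j => ?_) i <;> simp [toE_apply]

theorem snoc_tang (w : Fin (k + 1) → ℝ) : Fin.snoc (tang k w) (w (Fin.last k)) = w := by
  funext i
  refine Fin.lastCases ?_ (fun j => ?_) i <;> simp [tang_apply]

theorem continuous_toE_snoc_zero : Continuous fun y : Fin k → ℝ => toE k (Fin.snoc y 0) := by
  refine (toE k).continuous.comp (continuous_pi fun i => ?_)
  refine Fin.lastCases ?_ (fun j => ?_) i
  · simpa using continuous_const
  · simpa using continuous_apply j

/-- The normal derivative as a function of the tangential coordinates. -/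
def dnT (u : EuclideanSpace ℝ (Fin (k + 1)) → ℝ) (y : Fin k → ℝ) : ℝ :=
  dn u (toE k (Fin.snoc y 0))

theorem abs_apply_le (v : EuclideanSpace ℝ (Fin n)) (i : Fin n) : |v i| ≤ ‖v‖ :=
  PiLp.norm_apply_le v i

namespace HalfSol

variable {m p q : ℝ} {u : EuclideanSpace ℝ (Fin (k + 1)) → ℝ}

theorem continuous_dnT (hu : HalfSol (k + 1) m p q u) : Continuous (dnT u) :=
  hu.continuousOn_dn.comp_continuous continuous_toE_snoc_zero
    fun y => bdry_subset (toE_snoc_zero_mem y)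

theorem dnT_pos (hu : HalfSol (k + 1) m p q u) (hz : ∀ x ∈ bdry (k + 1), u x = 0)
    (y : Fin k → ℝ) : 0 < dnT u y :=
  hu.dn_pos (toE_snoc_zero_mem y) (hz _ (toE_snoc_zero_mem y))

theorem abs_energyW_castSucc_le (hu : HalfSol (k + 1) m p q u)
    (x : EuclideanSpace ℝ (Fin (k + 1))) (j : Fin k) :
    |energyW m p u x j.castSucc| ≤ ‖gradW u x‖ ^ m := by
  have h1 : energyW m p u x j.castSucc =
      ((‖gradW u x‖ ^ (m - 2) * ⟪gradW u x, eN (k + 1)⟫) • gradW u x) j.castSucc := by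
    have h2 : eN (k + 1) j.castSucc = 0 := by
      rw [eN_succ]; simp [(Fin.castSucc_lt_last j).ne]
    simp [energyW, stress, h2]
  rw [h1]
  exact (abs_apply_le _ _).trans (norm_stress_flux_le hu.dim_pos _)

theorem abs_energyW_le (hu : HalfSol (k + 1) m p q u)
    {x : EuclideanSpace ℝ (Fin (k + 1))} (hx : x ∈ closedHalf (k + 1)) (i : Fin (k + 1)) :
    |energyW m p u x i| ≤ 2 * ‖gradW u x‖ ^ m + u x ^ (p + 1) := by
  have hp := hu.p_pos
  have hux := hu.nonneg x hx
  refine (abs_apply_le _ _).trans ((norm_add_le _ _).trans ?_)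
  have h1 := norm_stress_le hu.dim_pos hu.one_lt (gradW u x)
  have h2 : ‖(u x ^ (p + 1) / (p + 1)) • eN (k + 1)‖ ≤ u x ^ (p + 1) := by
    rw [norm_smul, norm_eN hu.dim_pos, mul_one, Real.norm_of_nonneg (by positivity)]
    exact div_le_self (by positivity) (by linarith)
  linarith

/-- Integral bound for the interior term. -/
theorem abs_interior_le (hu : HalfSol (k + 1) m p q u) (hz : ∀ x ∈ bdry (k + 1), u x = 0)
    {C c : ℝ} (hC : 1 ≤ C) (hc : 0 < c) (hcm : 1 < c * m)
    (hdec : ∀ (y : Fin k → ℝ) t, 0 < t → ‖gradW u (toE k (Fin.snoc y t))‖ ≤ C * t ^ (-c))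
    (hdec' : ∀ (y : Fin k → ℝ) t, 0 < t → ‖gradW u (toE k (Fin.snoc y t))‖ ≤ C * dnT u y)
    {R : ℝ} (hR : 0 < R) (N : ℕ) :
    |∫ w in Set.Icc (Fin.snoc (fun _ : Fin k => -R) 0 : Fin (k + 1) → ℝ) (fun _ => R),
      ∑ j : Fin k, energyW m p u (toE k w) j.castSucc *
        fderiv ℝ (fun y => cubeWeight k R y ^ N) (tang k w) (Pi.single j 1)|
    ≤ ∫ y in Set.Icc (fun _ : Fin k => -R) (fun _ => R),
      (k * (2 * N) * (C * 2 ^ c) ^ m / (c * m - 1)) / R *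
        (cubeWeight k R y ^ (N - 1) * (dnT u y ^ m) ^ (1 - 1 / (c * m))) := by
  have hm := hu.one_lt
  have hC0 : 0 < C := by linarith
  obtain ⟨B, hB⟩ : ∃ B : ℝ, B = k * (2 * N / R) * (C * 2 ^ c) ^ m := ⟨_, rfl⟩
  have hB0 : 0 ≤ B := by rw [hB]; positivity
  let s : (Fin k → ℝ) → ℝ := fun y => dnT u y ^ (-(1 / c))
  have hs0 : ∀ y, 0 < s y := fun y => Real.rpow_pos_of_pos (hu.dnT_pos hz y) _
  have hsc : Continuous s := hu.continuous_dnT.rpow_const fun y => Or.inl (hu.dnT_pos hz y).ne'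
  have hsd : ∀ y, s y ^ (-c) = dnT u y := by
    intro y
    change (dnT u y ^ (-(1 / c))) ^ (-c) = dnT u y
    rw [← Real.rpow_mul (hu.dnT_pos hz y).le]
    rw [show -(1 / c) * -c = 1 by field_simp, Real.rpow_one]
  have hgrad : ∀ (y : Fin k → ℝ) t, 0 ≤ t →
      ‖gradW u (toE k (Fin.snoc y t))‖ ≤ C * 2 ^ c * (s y + t) ^ (-c) := by
    intro y t ht
    refine le_rpow_of_two_bounds (hs0 y) ht hc hC0 ?_ (hdec y t)
    rw [hsd]
    rcases ht.lt_or_eq with h | h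
    · exact hdec' y t h
    · have hd := hu.dnT_pos hz y
      rw [← h, hu.gradW_bdry hz (toE_snoc_zero_mem y), norm_smul, norm_eN hu.dim_pos, mul_one]
      change ‖dnT u y‖ ≤ _
      rw [Real.norm_of_nonneg hd.le]
      nlinarith
  have hgradm : ∀ (y : Fin k → ℝ) t, 0 ≤ t →
      ‖gradW u (toE k (Fin.snoc y t))‖ ^ m ≤ (C * 2 ^ c) ^ m * (s y + t) ^ (-(c * m)) := by
    intro y t ht
    have h1 : 0 < s y + t := by linarith [hs0 y]
    refine (Real.rpow_le_rpow (norm_nonneg _) (hgrad y t ht) (by linarith)).trans_eq ?_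
    rw [Real.mul_rpow (by positivity) (by positivity), ← Real.rpow_mul h1.le, neg_mul]
  let h : (Fin (k + 1) → ℝ) → ℝ := fun w =>
    B * cubeWeight k R (tang k w) ^ (N - 1) * (s (tang k w) + w (Fin.last k)) ^ (-(c * m))
  have hcube : ∀ w ∈ Set.Icc (Fin.snoc (fun _ : Fin k => -R) 0 : Fin (k + 1) → ℝ) (fun _ => R),
      tang k w ∈ Set.Icc (fun _ : Fin k => -R) (fun _ => R) ∧ 0 ≤ w (Fin.last k) := by
    intro w hw
    refine ⟨⟨fun j => ?_, fun j => hw.2 _⟩, ?_⟩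
    · have := hw.1 j.castSucc
      simpa [tang_apply] using this
    · have := hw.1 (Fin.last k)
      simpa using this
  have hhc : ContinuousOn h
      (Set.Icc (Fin.snoc (fun _ : Fin k => -R) 0 : Fin (k + 1) → ℝ) (fun _ => R)) := by
    refine ContinuousOn.mul (Continuous.continuousOn ?_) (ContinuousOn.rpow_const
      (Continuous.continuousOn ?_) fun w hw => Or.inl ?_)
    · exact continuous_const.mul
        ((contDiff_cubeWeight.continuous.comp (tang k).continuous).pow _)
    · exact (hsc.comp (tang k).continuous).add (continuous_apply _)
    · have := hs0 (tang k w)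
      have := (hcube w hw).2
      linarith
  have hbound : ∀ w ∈ Set.Icc (Fin.snoc (fun _ : Fin k => -R) 0 : Fin (k + 1) → ℝ) (fun _ => R),
      ‖∑ j : Fin k, energyW m p u (toE k w) j.castSucc *
        fderiv ℝ (fun y => cubeWeight k R y ^ N) (tang k w) (Pi.single j 1)‖ ≤ h w := by
    intro w hw
    obtain ⟨hw1, hw2⟩ := hcube w hw
    have hW := cubeWeight_nonneg hR hw1
    have h1 := hgradm (tang k w) (w (Fin.last k)) hw2
    rw [snoc_tang] at h1
    refine (norm_sum_le _ _).trans ?_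
    calc _ ≤ ∑ _j : Fin k, ((C * 2 ^ c) ^ m * (s (tang k w) + w (Fin.last k)) ^ (-(c * m)))
          * (2 * N / R * cubeWeight k R (tang k w) ^ (N - 1)) := by
          refine Finset.sum_le_sum fun j _ => ?_
          rw [norm_mul]
          refine mul_le_mul ((hu.abs_energyW_castSucc_le _ j).trans h1)
            (abs_fderiv_cubeWeight_pow_le hR N hw1 j) (norm_nonneg _)
            ((by positivity : (0:ℝ) ≤ ‖gradW u (toE k w)‖ ^ m).trans h1)
      _ = h w := by
          simp only [h, hB, Finset.sum_const, Finset.card_univ, Fintype.card_fin, nsmul_eq_mul]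
          ring
  rw [← Real.norm_eq_abs]
  refine (norm_integral_le_of_norm_le (hhc.integrableOn_compact isCompact_Icc)
    ((ae_restrict_iff' measurableSet_Icc).2 (Eventually.of_forall hbound))).trans ?_
  rw [setIntegral_box hhc]
  have hinner : ∀ y, ∫ t in Set.Icc 0 R, h (Fin.snoc y t) = B * cubeWeight k R y ^ (N - 1) *
      ∫ t in Set.Icc 0 R, (s y + t) ^ (-(c * m)) := by
    intro y
    rw [← integral_const_mul]
    congr 1
    funext t
    have h9 : tang k (Fin.snoc y t) = y := by ext j; simp [tang_apply]
    simp only [h, h9, Fin.snoc_last]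
  have hcm1 : 0 < c * m - 1 := by linarith
  refine integral_mono_of_nonneg ?_ ?_ ?_
  · refine (ae_restrict_iff' measurableSet_Icc).2 (Eventually.of_forall fun y hy => ?_)
    have hW := cubeWeight_nonneg hR hy
    change 0 ≤ ∫ t in Set.Icc 0 R, h (Fin.snoc y t)
    rw [hinner]
    have : 0 ≤ ∫ t in Set.Icc 0 R, (s y + t) ^ (-(c * m)) :=
      setIntegral_nonneg measurableSet_Icc fun t ht =>
        Real.rpow_nonneg (by linarith [hs0 y, ht.1]) _
    positivity
  · refine Continuous.integrableOn_Icc ?_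
    have h1 : Continuous fun y => (dnT u y ^ m) ^ (1 - 1 / (c * m)) :=
      (hu.continuous_dnT.rpow_const fun y => Or.inl (hu.dnT_pos hz y).ne').rpow_const
        fun y => Or.inl (Real.rpow_pos_of_pos (hu.dnT_pos hz y) m).ne'
    exact continuous_const.mul ((contDiff_cubeWeight.continuous.pow _).mul h1)
  · refine (ae_restrict_iff' measurableSet_Icc).2 (Eventually.of_forall fun y hy => ?_)
    have hW := cubeWeight_nonneg hR hy
    change ∫ t in Set.Icc 0 R, h (Fin.snoc y t) ≤ _
    rw [hinner]
    have h1 := integral_add_rpow_neg_le (hs0 y) hcm hR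
    have hd := hu.dnT_pos hz y
    have h2 : s y ^ (1 - c * m) = (dnT u y ^ m) ^ (1 - 1 / (c * m)) := by
      change (dnT u y ^ (-(1 / c))) ^ (1 - c * m) = _
      rw [← Real.rpow_mul hd.le, ← Real.rpow_mul hd.le]
      congr 1
      field_simp
      ring
    rw [h2] at h1
    calc _ ≤ B * cubeWeight k R y ^ (N - 1) *
          ((dnT u y ^ m) ^ (1 - 1 / (c * m)) / (c * m - 1)) := by gcongr
      _ = _ := by rw [hB]; field_simp

end HalfSol

end Box

section Box

variable {k : ℕ}

theorem volume_cube {R : ℝ} (hR : 0 < R) :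
    (volume : Measure (Fin k → ℝ)).real (Set.Icc (fun _ => -R) (fun _ => R)) = (2 * R) ^ k := by
  rw [measureReal_def, Real.volume_Icc_pi_toReal (fun _ => by change -R ≤ R; linarith)]
  simp only [Finset.prod_const, Finset.card_univ, Fintype.card_fin]
  ring

namespace HalfSol

variable {m p q : ℝ} {u : EuclideanSpace ℝ (Fin (k + 1)) → ℝ}

/-- The weighted boundary energy on large cubes decays. -/
theorem boundary_energy_le (hu : HalfSol (k + 1) m p q u) (hz : ∀ x ∈ bdry (k + 1), u x = 0)
    {C α : ℝ} (hC : 1 ≤ C) (hα : 0 < α) (hαp : α * (p + 1) = (α + 1) * m)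
    (hdec : ∀ (y : Fin k → ℝ) t, 0 < t → u (toE k (Fin.snoc y t)) ≤ C * t ^ (-α) ∧
      ‖gradient u (toE k (Fin.snoc y t))‖ ≤ C * t ^ (-α - 1) ∧
      ‖gradient u (toE k (Fin.snoc y t))‖ ≤ C * dnT u y)
    {N : ℕ} (hN : (α + 1) * m ≤ N) :
    ∃ K, ∀ R, 0 < R → ∫ y in Set.Icc (fun _ : Fin k => -R) (fun _ => R),
      cubeWeight k R y ^ N * dnT u y ^ m ≤ K * R ^ ((k : ℝ) - (α + 1) * m) := by
  have hm := hu.one_lt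
  have hp := hu.p_pos
  have hC0 : 0 < C := by linarith
  obtain ⟨κ, hκ⟩ : ∃ κ : ℝ, κ = (α + 1) * m := ⟨_, rfl⟩
  have hκ1 : 1 < κ := by rw [hκ]; nlinarith
  have hκ0 : 0 < κ := by linarith
  rw [← hκ] at hN ⊢
  have hκi : 1 / κ < 1 := by rw [div_lt_one hκ0]; exact hκ1
  obtain ⟨δ, hδ⟩ : ∃ δ : ℝ, δ = (1 - 1 / m) / 2 := ⟨_, rfl⟩
  have hδ0 : 0 < δ := by
    have : 1 / m < 1 := by rw [div_lt_one (by linarith)]; exact hm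
    rw [hδ]; linarith
  obtain ⟨A, hA⟩ : ∃ A : ℝ, A = k * (2 * N) * (C * 2 ^ (α + 1)) ^ m / ((α + 1) * m - 1) :=
    ⟨_, rfl⟩
  have hA0 : 0 ≤ A := by
    have : 0 < (α + 1) * m - 1 := by rw [← hκ]; linarith
    rw [hA]; positivity
  obtain ⟨D, hD⟩ : ∃ D : ℝ, D = 2 * C ^ m + C ^ (p + 1) + δ ^ (1 - κ) * A ^ κ := ⟨_, rfl⟩
  refine ⟨D * 2 ^ k / δ, fun R hR => ?_⟩
  have hψ : ContDiff ℝ 1 fun y => cubeWeight k R y ^ N := contDiff_cubeWeight.pow N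
  have hid := hu.box_identity hR hψ fun y j hj => by
    have hN0 : N ≠ 0 := by rintro rfl; simp at hN; linarith
    simp [cubeWeight_eq_zero hR hj, hN0]
  have hgW : ∀ (y : Fin k → ℝ) t, 0 < t →
      gradW u (toE k (Fin.snoc y t)) = gradient u (toE k (Fin.snoc y t)) :=
    fun y t ht => gradW_eq u (toE_snoc_mem y ht)
  have hint := hu.abs_interior_le hz hC (by linarith : 0 < α + 1) (by rw [← hκ]; exact hκ1)
    (fun y t ht => by
      rw [hgW y t ht, show -(α + 1) = -α - 1 by ring]; exact (hdec y t ht).2.1)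
    (fun y t ht => by rw [hgW y t ht]; exact (hdec y t ht).2.2) hR N
  rw [hid, ← hA, ← hκ] at hint
  have hbd : ∀ y, cubeWeight k R y ^ N * energyW m p u (toE k (Fin.snoc y 0)) (Fin.last k)
      = 2 * δ * (cubeWeight k R y ^ N * dnT u y ^ m) := by
    intro y
    rw [hu.energyW_bdry hz (toE_snoc_zero_mem y), eN_succ, hδ, dnT]
    simp
    ring
  simp only [hbd, integral_const_mul] at hint
  have hdc : Continuous fun y => dnT u y ^ m :=
    hu.continuous_dnT.rpow_const fun y => Or.inl (hu.dnT_pos hz y).ne'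
  have hfc : Continuous fun y => cubeWeight k R y ^ N * dnT u y ^ m := hψ.continuous.mul hdc
  have hfi : IntegrableOn (fun y => cubeWeight k R y ^ N * dnT u y ^ m)
      (Set.Icc (fun _ : Fin k => -R) (fun _ => R)) := hfc.integrableOn_Icc
  have hci : ∀ c : ℝ, IntegrableOn (fun _ => c) (Set.Icc (fun _ : Fin k => -R) (fun _ => R)) :=
    fun c => continuous_const.integrableOn_Icc
  have hvol := volume_cube (k := k) hR
  -- the contribution of the top face
  have htop : ∫ y in Set.Icc (fun _ : Fin k => -R) (fun _ => R),
      cubeWeight k R y ^ N * energyW m p u (toE k (Fin.snoc y R)) (Fin.last k)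
      ≤ (2 * C ^ m + C ^ (p + 1)) * R ^ (-κ) * (2 * R) ^ k := by
    have h1 := norm_setIntegral_le_of_norm_le_const (μ := volume)
      (s := Set.Icc (fun _ : Fin k => -R) (fun _ => R))
      (f := fun y => cubeWeight k R y ^ N * energyW m p u (toE k (Fin.snoc y R)) (Fin.last k))
      (C := (2 * C ^ m + C ^ (p + 1)) * R ^ (-κ)) isCompact_Icc.measure_lt_top (by
        intro y hy
        have hxo := toE_snoc_mem y hR
        obtain ⟨h2, h3, -⟩ := hdec y R hR
        have h4 := hu.abs_energyW_le (openHalf_subset hxo) (Fin.last k)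
        rw [hgW y R hR] at h4
        have h5 : ‖gradient u (toE k (Fin.snoc y R))‖ ^ m ≤ C ^ m * R ^ (-κ) := by
          refine (Real.rpow_le_rpow (norm_nonneg _) h3 (by linarith)).trans_eq ?_
          rw [Real.mul_rpow hC0.le (by positivity), ← Real.rpow_mul hR.le, hκ]
          congr 2; ring
        have h6 : u (toE k (Fin.snoc y R)) ^ (p + 1) ≤ C ^ (p + 1) * R ^ (-κ) := by
          refine (Real.rpow_le_rpow (hu.pos _ hxo).le h2 (by linarith)).trans_eq ?_
          rw [Real.mul_rpow hC0.le (by positivity), ← Real.rpow_mul hR.le, hκ, ← hαp]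
          congr 2; ring
        have hW0 := cubeWeight_nonneg hR hy
        have hW1 := cubeWeight_le_one hR hy
        have h7 : cubeWeight k R y ^ N ≤ 1 := pow_le_one₀ hW0 hW1
        rw [norm_mul, Real.norm_of_nonneg (by positivity)]
        calc _ ≤ 1 * ‖energyW m p u (toE k (Fin.snoc y R)) (Fin.last k)‖ := by gcongr
          _ ≤ _ := by rw [one_mul, Real.norm_eq_abs]; linarith)
    rw [hvol] at h1
    exact (le_abs_self _).trans h1
  -- the interior contribution is absorbed
  have hyoung : ∫ y in Set.Icc (fun _ : Fin k => -R) (fun _ => R),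
      A / R * (cubeWeight k R y ^ (N - 1) * (dnT u y ^ m) ^ (1 - 1 / κ))
      ≤ ∫ y in Set.Icc (fun _ : Fin k => -R) (fun _ => R),
        (δ * (cubeWeight k R y ^ N * dnT u y ^ m) + δ ^ (1 - κ) * A ^ κ * R ^ (-κ)) := by
    refine setIntegral_mono_on ?_ ((hfi.const_mul δ).add (hci _)) measurableSet_Icc fun y hy => ?_
    · have h1 : Continuous fun y => (dnT u y ^ m) ^ (1 - 1 / κ) :=
        hdc.rpow_const fun y => Or.inl (Real.rpow_pos_of_pos (hu.dnT_pos hz y) m).ne'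
      exact (continuous_const.mul
        ((contDiff_cubeWeight.continuous.pow _).mul h1)).integrableOn_Icc
    · have hW0 := cubeWeight_nonneg hR hy
      have hW1 := cubeWeight_le_one hR hy
      have hd := hu.dnT_pos hz y
      have hN1 : 1 ≤ N := by
        have : (1:ℝ) < N := by linarith
        exact_mod_cast this.le
      have h1 : cubeWeight k R y ^ (N - 1) ≤ (cubeWeight k R y ^ N) ^ (1 - 1 / κ) := by
        rw [← Real.rpow_natCast, ← Real.rpow_natCast, ← Real.rpow_mul hW0]
        refine Real.rpow_le_rpow_of_exponent_ge' hW0 hW1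
          (mul_nonneg (Nat.cast_nonneg _) (by linarith)) ?_
        rw [Nat.cast_sub hN1]
        have : 1 ≤ (N:ℝ) / κ := by rw [le_div_iff₀ hκ0]; linarith
        have h2 : (N:ℝ) * (1 - 1 / κ) = N - N / κ := by ring
        rw [h2]; push_cast; linarith
      have h2 := rpow_mul_le_young (X := cubeWeight k R y ^ N * dnT u y ^ m) (y := A / R)
        (by positivity) (by positivity) hδ0 hκ1
      rw [Real.mul_rpow (by positivity) (by positivity), Real.div_rpow hA0 hR.le] at h2
      rw [Real.rpow_neg hR.le]
      calc _ ≤ A / R * ((cubeWeight k R y ^ N) ^ (1 - 1 / κ) * (dnT u y ^ m) ^ (1 - 1 / κ)) := by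
            gcongr
        _ = (cubeWeight k R y ^ N) ^ (1 - 1 / κ) * (dnT u y ^ m) ^ (1 - 1 / κ) * (A / R) := by
            ring
        _ ≤ _ := h2
        _ = _ := by ring
  rw [integral_add (hfi.const_mul δ) (hci _), setIntegral_const, hvol, smul_eq_mul] at hyoung
  simp only [integral_const_mul] at hyoung
  obtain ⟨S, hS⟩ : ∃ S, S = ∫ y in Set.Icc (fun _ : Fin k => -R) (fun _ => R),
      cubeWeight k R y ^ N * dnT u y ^ m := ⟨_, rfl⟩
  rw [← hS] at hint hyoung ⊢
  have h1 := (abs_le.1 hint).1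
  have h2 : δ * S ≤ D * R ^ (-κ) * (2 * R) ^ k := by
    rw [hD]
    nlinarith
  have h3 : R ^ ((k : ℝ) - κ) = R ^ (-κ) * R ^ k := by
    rw [← Real.rpow_natCast, ← Real.rpow_add hR]; congr 1; ring
  rw [h3, div_mul_eq_mul_div, le_div_iff₀ hδ0]
  calc S * δ = δ * S := by ring
    _ ≤ _ := h2
    _ = _ := by rw [mul_pow]; ring

/-- Weighted boundary energies on large cubes are bounded below. -/
theorem le_boundary_energy (hu : HalfSol (k + 1) m p q u) (hz : ∀ x ∈ bdry (k + 1), u x = 0)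
    (N : ℕ) : ∃ c > 0, ∀ R, 2 ≤ R → c ≤ ∫ y in Set.Icc (fun _ : Fin k => -R) (fun _ => R),
      cubeWeight k R y ^ N * dnT u y ^ m := by
  have hdc : Continuous fun y => dnT u y ^ m :=
    hu.continuous_dnT.rpow_const fun y => Or.inl (hu.dnT_pos hz y).ne'
  have hd0 : ∀ y, 0 < dnT u y ^ m := fun y => Real.rpow_pos_of_pos (hu.dnT_pos hz y) m
  have hi1 : IntegrableOn (fun y => ((3 / 4 : ℝ) ^ k) ^ N * dnT u y ^ m)
      (Set.Icc (fun _ : Fin k => (-1:ℝ)) (fun _ => 1)) :=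
    (continuous_const.mul hdc).integrableOn_Icc
  refine ⟨∫ y in Set.Icc (fun _ : Fin k => (-1:ℝ)) (fun _ => 1),
    ((3 / 4 : ℝ) ^ k) ^ N * dnT u y ^ m, ?_, fun R hR => ?_⟩
  · rw [gt_iff_lt, setIntegral_pos_iff_support_of_nonneg_ae
      (Eventually.of_forall fun y => (mul_pos (by positivity) (hd0 y)).le) hi1]
    have h1 : Function.support (fun y => ((3 / 4 : ℝ) ^ k) ^ N * dnT u y ^ m) = Set.univ :=
      Set.eq_univ_of_forall fun y => (mul_pos (by positivity) (hd0 y)).ne'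
    rw [h1, Set.univ_inter, Real.volume_Icc_pi]
    simp
    norm_num
    positivity
  · have hR0 : 0 < R := by linarith
    have hsub : Set.Icc (fun _ : Fin k => (-1:ℝ)) (fun _ => 1) ⊆
        Set.Icc (fun _ : Fin k => -R) (fun _ => R) :=
      Set.Icc_subset_Icc (fun _ => by change -R ≤ -1; linarith)
        (fun _ => by change 1 ≤ R; linarith)
    have hfi : IntegrableOn (fun y => cubeWeight k R y ^ N * dnT u y ^ m)
        (Set.Icc (fun _ : Fin k => -R) (fun _ => R)) :=
      ((contDiff_cubeWeight.continuous.pow N).mul hdc).integrableOn_Icc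
    refine (setIntegral_mono_on hi1 (hfi.mono_set hsub) measurableSet_Icc fun y hy => ?_).trans
      (setIntegral_mono_set hfi ?_ hsub.eventuallyLE)
    · have := le_cubeWeight hR hy
      have := (hd0 y).le
      gcongr
    · refine (ae_restrict_iff' measurableSet_Icc).2 (Eventually.of_forall fun y hy => ?_)
      exact mul_nonneg (pow_nonneg (cubeWeight_nonneg hR0 hy) N) (hd0 y).le

end HalfSol

end Box

/-- There is no solution with zero boundary values for superlinear exponents. -/
theorem HalfSol.false_of_zero_bdry_of_lt {m p q : ℝ} {u : EuclideanSpace ℝ (Fin n) → ℝ}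
    (hu : HalfSol n m p q u) (hp : p * (n - m) < n * (m - 1)) (hpm : m - 1 < p)
    (hz : ∀ x ∈ bdry n, u x = 0) : False := by
  obtain ⟨k, rfl⟩ : ∃ k, n = k + 1 := ⟨n - 1, by have := hu.dim_pos; omega⟩
  have hm := hu.one_lt
  obtain ⟨C, hC, hdec⟩ := hu.exists_decay hp hpm hz
  obtain ⟨α, hα⟩ : ∃ α : ℝ, α = m / (p - (m - 1)) := ⟨_, rfl⟩
  have he : 0 < p - (m - 1) := by linarith
  have hα0 : 0 < α := by rw [hα]; positivity
  have hαe : α * (p - (m - 1)) = m := by rw [hα]; field_simp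
  rw [← hα] at hdec
  obtain ⟨N, hN⟩ := exists_nat_ge ((α + 1) * m)
  obtain ⟨K, hK⟩ := hu.boundary_energy_le hz (le_max_right C 1) hα0
    (by linear_combination hαe) (fun y t ht => by
      obtain ⟨h1, h2, h3⟩ := hdec _ (toE_snoc_zero_mem y) t ht
      rw [← toE_snoc] at h1 h2 h3
      have hd := (hu.dnT_pos hz y).le
      refine ⟨h1.trans ?_, h2.trans ?_, h3.trans ?_⟩
      · gcongr; exact le_max_left C 1
      · gcongr; exact le_max_left C 1
      · exact mul_le_mul_of_nonneg_right (le_max_left C 1) hd) hN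
  obtain ⟨c, hc, hcR⟩ := hu.le_boundary_energy hz N
  have hexp : 0 < (α + 1) * m - k := by
    push_cast at hp
    have h1 : (p - (m - 1)) * (k + 1 - m) < m * (m - 1) := by nlinarith
    have h2 : (k + 1 - m) < α * (m - 1) := by
      by_contra! hcon
      have : (p - (m - 1)) * (α * (m - 1)) ≤ (p - (m - 1)) * (k + 1 - m) := by gcongr
      have h3 : (p - (m - 1)) * (α * (m - 1)) = m * (m - 1) := by
        linear_combination (m - 1) * hαe
      linarith
    nlinarith
  refine false_of_rpow_le (t0 := 2) (K := K / c) hexp fun R hR => ?_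
  have hR0 : 0 < R := by linarith
  have h1 := (hcR R hR).trans (hK R hR0)
  rw [show (k : ℝ) - (α + 1) * m = -((α + 1) * m - k) by ring, Real.rpow_neg hR0.le,
    ← div_eq_mul_inv, le_div_iff₀ (by positivity)] at h1
  rw [le_div_iff₀ hc]
  linarith

end HalfSpace

/-- **Liouville theorem for the Serrin index range.** If `0 < p < n(m-1)/(n-m)` and
`m-1 < q < (n-1)(m-1)/(n-m)`, there is no nontrivial nonnegative `C²` solution of
`Δ_m u + u^p = 0`, `u > 0` in `ℝⁿ₊` with `|∇u|^{m-2} ∂u/∂xₙ = -u^q` on `∂ℝⁿ₊`: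
every such solution is identically zero. -/
theorem no_nontrivial_solution_serrin_range
    (n : ℕ) (m p q : ℝ) (hm : 1 < m) (hmn : m < n)
    (hp0 : 0 < p) (hp1 : p < (n : ℝ) * (m - 1) / (n - m))
    (hq0 : m - 1 < q) (hq1 : q < ((n : ℝ) - 1) * (m - 1) / (n - m))
    (u : EuclideanSpace ℝ (Fin n) → ℝ)
    (hnonneg : ∀ x ∈ closedHalf n, 0 ≤ u x)
    (hC2 : ContDiffOn ℝ 2 u (closedHalf n))
    (hXC1 : ContDiffOn ℝ 1 (fieldX m u) (closedHalf n ∩ {x | gradient u x ≠ 0}))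
    (heq : ∀ x ∈ openHalf n, pLap m u x + u x ^ p = 0)
    (hpos : ∀ x ∈ openHalf n, 0 < u x)
    (hbc : ∀ x ∈ bdry n, ‖gradient u x‖ ^ (m - 2) * pdn u x = -(u x ^ q)) :
    ∀ x ∈ closedHalf n, u x = 0 := by
  have hu : HalfSol n m p q u := ⟨hm, hmn, hp0, hnonneg, hC2, heq, hpos, hbc⟩
  have hp : p * (n - m) < n * (m - 1) := by rwa [lt_div_iff₀ (by linarith)] at hp1
  exfalso
  rcases hu.bdry_dichotomy with h | h
  · exact hu.false_of_pos_bdry hp h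
  rcases le_or_gt p (m - 1) with hpm | hpm
  · exact hu.false_of_zero_bdry_of_le hpm h
  · exact hu.false_of_zero_bdry_of_lt hp hpm h
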